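/- arXiv:math/0606463 — 3 statements merged into one kernel-verified Lean document; each statement's English description precedes it below -/
import Mathlib

section
/- Let f_0,…,f_{n+1} ∈ S_d (d ≥ 1) be linearly independent homogeneous polynomials with no common zero in projective n-space over an algebraic closure of k. Then for every integer b, the space of syzygies Syz_b = {(A_0,…,A_{n+1}) ∈ (S_{b−d})^{n+2} : ∑_i A_i f_i = 0} is spanned over k by Koszul syzygies p·(f_j e_i − f_i e_j) (p ∈ S_{b−2d}, 0 ≤ i < j ≤ n+1) together with Bezout syzygies ((−1)^i ∑_{|α|=b−d} φ(Δ^i_α) x^α)_{i=0}^{n+1} for φ ranging over linear functionals on S_{ρ−b+d} vanishing on (f_0,…,f_{n+1}) ∩ S_{ρ−b+d}, where ρ = (n+1)(d−1). -/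
open MvPolynomial

set_option synthInstance.maxHeartbeats 1000000
set_option maxHeartbeats 1000000
set_option maxSynthPendingDepth 3

noncomputable section

/-- The "mixed" variable assignment: variables with index `< j` are sent to the
`y`-variables (the second summand), variables with index `≥ j` to the `x`-variables
(the first summand). -/
def mixv (k : Type*) [Field k] (n : ℕ) (j : ℕ) :
    Fin (n + 1) → MvPolynomial (Fin (n + 1) ⊕ Fin (n + 1)) k :=
  fun i => if (i : ℕ) < j then X (Sum.inr i) else X (Sum.inl i)

/-- `D` is the `j`-th divided difference `Δ_j(f)` of `f`. -/
def IsDivDiff (k : Type*) [Field k] (n : ℕ) (f : MvPolynomial (Fin (n + 1)) k)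
    (j : Fin (n + 1)) (D : MvPolynomial (Fin (n + 1) ⊕ Fin (n + 1)) k) : Prop :=
  D * (X (Sum.inl j) - X (Sum.inr j)) =
    aeval (mixv k n (j : ℕ)) f - aeval (mixv k n ((j : ℕ) + 1)) f

/-- Writing `Q ∈ k[x_0,…,x_n,y_0,…,y_n]` as `∑_α Q_α(x) y^α`, this is the coefficient
`Q_α(x) ∈ k[x_0,…,x_n]` of the monomial `y^α`. -/
def coeffY (k : Type*) [Field k] (n : ℕ) (Q : MvPolynomial (Fin (n + 1) ⊕ Fin (n + 1)) k)
    (α : Fin (n + 1) →₀ ℕ) : MvPolynomial (Fin (n + 1)) k :=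
  MvPolynomial.coeff α ((sumAlgEquiv k (Fin (n + 1)) (Fin (n + 1))) (rename Sum.swap Q))

/-- The `ℤ`-indexed graded piece `S_m ⊆ S = k[x_0,…,x_n]` (zero in negative degrees). -/
def gradedPiece (k : Type*) [Field k] (n : ℕ) (m : ℤ) :
    Submodule k (MvPolynomial (Fin (n + 1)) k) :=
  if 0 ≤ m then homogeneousSubmodule (Fin (n + 1)) k m.toNat else ⊥

/-- The linear map `(S_a)^{n+2} → S`, `(A_0,…,A_{n+1}) ↦ ∑ A_i f_i`; its kernel is the
space of syzygies of `f_0,…,f_{n+1}` (in the appropriate degree). -/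
def syzMap (k : Type*) [Field k] (n : ℕ) (a : ℤ)
    (f : Fin (n + 2) → MvPolynomial (Fin (n + 1)) k) :
    (Fin (n + 2) → ↥(gradedPiece k n a)) →ₗ[k] MvPolynomial (Fin (n + 1)) k :=
  ∑ i : Fin (n + 2),
    (LinearMap.mulRight k (f i)).comp
      (((gradedPiece k n a).subtype).comp (LinearMap.proj i))

namespace KB

theorem mem_P {σ T : Type*} [CommRing T] (N : ℕ) (s : Set σ) (p : MvPolynomial σ T) :
    p ∈ Ideal.span ((fun j => (X j : MvPolynomial σ T) ^ N) '' s) ↔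
      ∀ m : σ →₀ ℕ, (∀ j ∈ s, m j < N) → coeff m p = 0 := by
  classical
  have h1 : ((fun j => (X j : MvPolynomial σ T) ^ N) '' s) =
      (fun m => monomial m (1 : T)) '' ((fun j => Finsupp.single j N) '' s) := by
    rw [Set.image_image]
    simp [X_pow_eq_monomial]
  rw [h1, mem_ideal_span_monomial_image]
  constructor
  · intro h m hm
    by_contra hc
    obtain ⟨_, ⟨j, hj, rfl⟩, hle⟩ := h m (mem_support_iff.2 hc)
    have := hle j
    simp at this
    exact absurd (hm j hj) (by omega)
  · intro h m hm
    by_contra hc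
    apply mem_support_iff.1 hm
    apply h
    intro j hj
    by_contra hlt
    apply hc
    refine ⟨_, ⟨j, hj, rfl⟩, ?_⟩
    simpa using hlt

theorem nzd_sub {σ T : Type*} [CommRing T] (N : ℕ) (s : Set σ) (i : σ) (hi : i ∉ s) (a : T)
    (p : MvPolynomial σ T)
    (h : (X i - C a) * p ∈ Ideal.span ((fun j => (X j : MvPolynomial σ T) ^ N) '' s)) :
    p ∈ Ideal.span ((fun j => (X j : MvPolynomial σ T) ^ N) '' s) := by
  classical
  rw [mem_P] at h ⊢
  intro m hm
  have key : ∀ r : ℕ, coeff m p = a ^ r * coeff (m + Finsupp.single i r) p := by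
    intro r
    induction r with
    | zero => simp
    | succ r ih =>
      rw [ih]
      have := h (m + Finsupp.single i r + Finsupp.single i 1) (by
        intro j hj
        have : j ≠ i := fun e => hi (e ▸ hj)
        simpa [Finsupp.single_apply, this.symm] using hm j hj)
      rw [sub_mul, coeff_sub, add_comm _ (Finsupp.single i 1), coeff_X_mul, coeff_C_mul,
        sub_eq_zero] at this
      rw [this, add_comm (Finsupp.single i 1), add_assoc, ← Finsupp.single_add]
      ring
  rw [key (p.totalDegree + 1), coeff_eq_zero_of_totalDegree_lt, mul_zero]
  have : (m + Finsupp.single i (p.totalDegree + 1)).degree =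
      m.degree + (p.totalDegree + 1) := by simp
  rw [Finsupp.degree_apply] at this
  omega

theorem nzd_pow {σ T : Type*} [CommRing T] (N : ℕ) (s : Set σ) (i : σ) (hi : i ∉ s)
    (p : MvPolynomial σ T)
    (h : X i ^ N * p ∈ Ideal.span ((fun j => (X j : MvPolynomial σ T) ^ N) '' s)) :
    p ∈ Ideal.span ((fun j => (X j : MvPolynomial σ T) ^ N) '' s) := by
  have : ∀ M : ℕ, X i ^ M * p ∈ Ideal.span ((fun j => (X j : MvPolynomial σ T) ^ N) '' s) →
      p ∈ Ideal.span ((fun j => (X j : MvPolynomial σ T) ^ N) '' s) := by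
    intro M
    induction M with
    | zero => simp
    | succ M ih =>
      intro hM
      apply ih
      apply nzd_sub N s i hi 0
      convert hM using 1
      simp only [map_zero]
      ring
  exact this N h

theorem det_row_zero {ι R : Type*} [Fintype ι] [DecidableEq ι] [CommRing R]
    (P : Matrix ι ι R) (z w : ι → R) (h : P.mulVec z = w) (i : ι) :
    P.det * z i = ∑ j, P.adjugate i j * w j := by
  have h2 : P.adjugate.mulVec w = P.det • z := by
    rw [← h, Matrix.mulVec_mulVec, Matrix.adjugate_mul, Matrix.smul_mulVec, Matrix.one_mulVec]
  have := congrFun h2 i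
  simp only [Matrix.mulVec, dotProduct, Pi.smul_apply, smul_eq_mul] at this
  exact this.symm

theorem det_transition {ι R : Type*} [Fintype ι] [DecidableEq ι] [CommRing R]
    (z w : ι → R) (J : Ideal R) (J' : ι → Ideal R) (hJ : ∀ i, J' i ≤ J)
    (hw : ∀ i j, j ≠ i → w j ∈ J' i) (hz : ∀ i p, z i * p ∈ J' i → p ∈ J' i)
    (M M' : Matrix ι ι R) (hM : M.mulVec z = w) (hM' : M'.mulVec z = w) :
    M.det - M'.det ∈ J := by
  classical
  let Q : Finset ι → Matrix ι ι R := fun s => Matrix.of fun i => if i ∈ s then M' i else M i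
  have hQ : ∀ s, (Q s).mulVec z = w := by
    intro s
    ext i
    by_cases hi : i ∈ s
    · rw [← hM']; simp [Q, Matrix.mulVec, hi]
    · rw [← hM]; simp [Q, Matrix.mulVec, hi]
  have key : ∀ s : Finset ι, M.det - (Q s).det ∈ J := by
    intro s
    induction s using Finset.induction_on with
    | empty =>
      have : Q ∅ = M := by ext i j; simp [Q]
      rw [this, sub_self]; exact J.zero_mem
    | insert i s his ih =>
      have e1 : Q (insert i s) = (Q s).updateRow i (M' i) := by
        ext a b
        by_cases h : a = i
        · subst h; simp [Q]
        · simp [Q, h]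
      have e2 : Q s = (Q s).updateRow i (M i) := by
        ext a b
        by_cases h : a = i
        · subst h; simp [Q, his]
        · simp [h]
      have e3 : (Q s).det - (Q (insert i s)).det = ((Q s).updateRow i (M i - M' i)).det := by
        have := Matrix.det_updateRow_add (Q s) i (M i - M' i) (M' i)
        rw [sub_add_cancel, ← e2, ← e1] at this
        rw [this]; ring
      have e4 : ((Q s).updateRow i (M i - M' i)).det ∈ J := by
        apply hJ i
        apply hz i
        rw [mul_comm, det_row_zero _ z (fun j => if j = i then 0 else w j)]
        · apply Ideal.sum_mem
          intro j _
          by_cases h : j = i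
          · simp [h]
          · simp only [h, if_false]
            exact Ideal.mul_mem_left _ _ (hw i j h)
        · ext a
          by_cases h : a = i
          · subst h
            have h1 := congrFun hM a
            have h2 := congrFun hM' a
            simp only [Matrix.mulVec] at h1 h2
            have h3 : (fun j => M a j - M' a j) = (fun j => M a j) - (fun j => M' a j) := rfl
            simp [Matrix.mulVec, h3, h1, h2, sub_dotProduct]
          · have := congrFun (hQ s) a
            simp only [Matrix.mulVec] at this
            simp [Matrix.mulVec, h, this]
      have := J.add_mem ih e4
      rw [← e3] at this
      simpa using this
  have : Q Finset.univ = M' := by ext i j; simp [Q]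
  rw [← this]
  exact key _

theorem alt_sum_apply {R M N ι κ : Type*} [CommRing R] [AddCommGroup M] [Module R M]
    [AddCommGroup N] [Module R N] (s : Finset κ) (g : κ → M [⋀^ι]→ₗ[R] N) (v : ι → M) :
    (∑ i ∈ s, g i) v = ∑ i ∈ s, g i v := by
  classical
  induction s using Finset.induction_on with
  | empty => simp
  | insert i s hi ih => rw [Finset.sum_insert hi, Finset.sum_insert hi, AlternatingMap.add_apply, ih]

/-- Cauchy-Binet in codimension one. -/
theorem cauchyBinet {R : Type*} [CommRing R] (m : ℕ)
    (c : Matrix (Fin m) (Fin (m + 1)) R) (E : Matrix (Fin (m + 1)) (Fin m) R) :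
    (c * E).det = ∑ i : Fin (m + 1), (c.submatrix id i.succAbove).det *
      (E.submatrix i.succAbove id).det := by
  let F : (Fin (m + 1) → R) [⋀^Fin m]→ₗ[R] R :=
    (Matrix.detRowAlternating (n := Fin m) (R := R)).compLinearMap (Matrix.mulVecLin c)
  let G : (Fin (m + 1) → R) [⋀^Fin m]→ₗ[R] R :=
    ∑ i : Fin (m + 1), (c.submatrix id i.succAbove).det •
      (Matrix.detRowAlternating (n := Fin m) (R := R)).compLinearMap
        (LinearMap.funLeft R R i.succAbove)
  have hF : F E.transpose = (c * E).det := by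
    rw [← Matrix.det_transpose]
    rfl
  have hG : G E.transpose = ∑ i : Fin (m + 1), (c.submatrix id i.succAbove).det *
      (E.submatrix i.succAbove id).det := by
    refine (alt_sum_apply _ _ _).trans ?_
    refine Finset.sum_congr rfl fun i _ => ?_
    rw [← Matrix.det_transpose (E.submatrix _ _)]
    rfl
  rw [← hF, ← hG]
  congr 1
  apply Module.Basis.ext_alternating (Pi.basisFun R (Fin (m + 1)))
  intro v hv
  obtain ⟨i, hi⟩ : ∃ i, i ∉ Set.range v := by
    by_contra hc
    push Not at hc
    have : Function.Surjective v := hc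
    have := Fintype.card_le_of_surjective v this
    simp at this
  have hw : ∀ l, ∃ a, i.succAbove a = v l := fun l =>
    Fin.exists_succAbove_eq (fun e => hi ⟨l, e⟩)
  choose τ hτ using hw
  have hinj : Function.Injective τ := fun a b hab => hv (by rw [← hτ, ← hτ, hab])
  let τ' : Equiv.Perm (Fin m) := Equiv.ofBijective τ (Finite.injective_iff_bijective.1 hinj)
  have hFv : F (fun l => Pi.basisFun R _ (v l)) =
      (((c.submatrix id i.succAbove).transpose).submatrix τ' id).det := by
    simp only [F, AlternatingMap.compLinearMap_apply]
    show Matrix.det _ = _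
    congr 1
    ext a b
    simp [τ', hτ]
  have hGv : ∀ j, Matrix.det (fun l => (LinearMap.funLeft R R j.succAbove)
      (Pi.basisFun R (Fin (m + 1)) (v l))) =
      if j = i then ((1 : Matrix (Fin m) (Fin m) R).submatrix τ' id).det else 0 := by
    intro j
    split_ifs with h
    · subst h
      congr 1
      ext a b
      simp [τ', ← hτ, Matrix.one_apply, LinearMap.funLeft_apply, Pi.single_apply, eq_comm]
    · obtain ⟨a, ha⟩ := Fin.exists_succAbove_eq (Ne.symm h)
      apply Matrix.det_eq_zero_of_column_eq_zero a
      intro l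
      rw [LinearMap.funLeft_apply, ha, Pi.basisFun_apply, Pi.single_apply, if_neg]
      exact fun e => hi ⟨l, e.symm⟩
  rw [hFv]
  simp only [G, alt_sum_apply, AlternatingMap.smul_apply, smul_eq_mul,
    AlternatingMap.compLinearMap_apply]
  have : ∀ j, Matrix.detRowAlternating (fun l => (LinearMap.funLeft R R j.succAbove)
      (Pi.basisFun R (Fin (m + 1)) (v l))) =
      if j = i then ((1 : Matrix (Fin m) (Fin m) R).submatrix τ' id).det else 0 := hGv
  simp only [this]
  rw [Matrix.det_permute, Matrix.det_permute, Matrix.det_transpose]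
  simp [mul_comm]

end KB
namespace KB

section ext
variable {R M : Type*} [CommRing R] [AddCommGroup M] [Module R M]

/-- The Koszul differential. -/
def kd (g : Module.Dual R M) : ExteriorAlgebra R M →ₗ[R] ExteriorAlgebra R M :=
  CliffordAlgebra.contractLeft g

theorem kd_mul (g : Module.Dual R M) (a : M) (b : ExteriorAlgebra R M) :
    kd g (ExteriorAlgebra.ι R a * b) = g a • b - ExteriorAlgebra.ι R a * kd g b :=
  CliffordAlgebra.contractLeft_ι_mul _ a b

theorem kd_kd (g : Module.Dual R M) (b : ExteriorAlgebra R M) : kd g (kd g b) = 0 :=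
  CliffordAlgebra.contractLeft_contractLeft _ b

theorem kd_ι (g : Module.Dual R M) (a : M) :
    kd g (ExteriorAlgebra.ι R a) = algebraMap R _ (g a) :=
  CliffordAlgebra.contractLeft_ι _ _ a

theorem kd_algebraMap (g : Module.Dual R M) (a : R) :
    kd g (algebraMap R _ a) = 0 :=
  CliffordAlgebra.contractLeft_algebraMap _ _ a

theorem ext_left_induction {P : ExteriorAlgebra R M → Prop}
    (algebraMap : ∀ r : R, P (algebraMap _ _ r)) (add : ∀ x y, P x → P y → P (x + y))
    (ι_mul : ∀ x m, P x → P (ExteriorAlgebra.ι R m * x)) (x : ExteriorAlgebra R M) : P x :=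
  CliffordAlgebra.left_induction (Q := 0) (P := P) algebraMap add ι_mul x

theorem fst_snd_mul [Module Rᵐᵒᵖ M] [IsCentralScalar R M] (v : M) (x : ExteriorAlgebra R M) :
    (ExteriorAlgebra.toTrivSqZeroExt (ExteriorAlgebra.ι R v * x)).fst = 0 ∧
    (ExteriorAlgebra.toTrivSqZeroExt (ExteriorAlgebra.ι R v * x)).snd =
      (ExteriorAlgebra.toTrivSqZeroExt x).fst • v := by
  rw [map_mul, ExteriorAlgebra.toTrivSqZeroExt_ι]
  constructor <;> simp

theorem fst_kd [Module Rᵐᵒᵖ M] [IsCentralScalar R M] (g : Module.Dual R M)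
    (x : ExteriorAlgebra R M) :
    (ExteriorAlgebra.toTrivSqZeroExt (kd g x)).fst =
      g (ExteriorAlgebra.toTrivSqZeroExt x).snd := by
  induction x using ext_left_induction with
  | algebraMap r => rw [kd_algebraMap]; simp [TrivSqZeroExt.algebraMap_eq_inl]
  | add x y hx hy => simp [hx, hy]
  | ι_mul x m hx =>
    rw [kd_mul, map_sub, TrivSqZeroExt.fst_sub, (fst_snd_mul _ _).1, (fst_snd_mul _ _).2]
    simp [mul_comm]

theorem snd_kd [Module Rᵐᵒᵖ M] [IsCentralScalar R M] (g : Module.Dual R M)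
    (K : Submodule R M) (hK : ∀ v b, g v • b - g b • v ∈ K)
    (x : ExteriorAlgebra R M) :
    (ExteriorAlgebra.toTrivSqZeroExt (kd g x)).snd ∈ K := by
  induction x using ext_left_induction with
  | algebraMap r => rw [kd_algebraMap]; simp
  | add x y hx hy => simpa using K.add_mem hx hy
  | ι_mul x m hx =>
    rw [kd_mul, map_sub, TrivSqZeroExt.snd_sub, (fst_snd_mul _ _).2, map_smul,
      TrivSqZeroExt.snd_smul, fst_kd]
    exact hK _ _

theorem koszul_of_boundary (g : Module.Dual R M)
    (K : Submodule R M) (hK : ∀ v b, g v • b - g b • v ∈ K) (a : M)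
    (h : ∃ x, ExteriorAlgebra.ι R a = kd g x) : a ∈ K := by
  let _ : Module Rᵐᵒᵖ M := Module.compHom _ ((RingHom.id R).fromOpposite mul_comm)
  have _ : IsCentralScalar R M := ⟨fun r m => rfl⟩
  obtain ⟨x, hx⟩ := h
  have := snd_kd g K hK x
  rw [← hx, ExteriorAlgebra.toTrivSqZeroExt_ι] at this
  simpa using this

end ext

section chain
variable {R : Type*} [CommRing R] {m : ℕ}

theorem free_nzd (r : R) (J : Ideal R) (h : ∀ p, r * p ∈ J → p ∈ J)
    (w : (ExteriorAlgebra R (Fin m → R))) (hw : r • w ∈ J • (⊤ : Submodule R (ExteriorAlgebra R (Fin m → R)))) : w ∈ J • (⊤ : Submodule R (ExteriorAlgebra R (Fin m → R))) := by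
  have b := (Pi.basisFun R (Fin m)).ExteriorAlgebra
  have key : ∀ w : (ExteriorAlgebra R (Fin m → R)), w ∈ J • (⊤ : Submodule R (ExteriorAlgebra R (Fin m → R))) ↔ ∀ i, b.repr w i ∈ J := by
    intro w
    constructor
    · intro h i
      refine Submodule.smul_induction_on h ?_ ?_
      · intro a ha x _
        simpa using J.mul_mem_right _ ha
      · intro x y hx hy
        simpa using J.add_mem hx hy
    · intro h
      rw [← b.sum_repr w]
      exact Submodule.sum_mem _ fun i _ => Submodule.smul_mem_smul (h i) trivial
  rw [key] at hw ⊢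
  intro i
  apply h
  simpa using hw i

theorem map_smul_top (J : Ideal R) (F : (ExteriorAlgebra R (Fin m → R)) →ₗ[R] (ExteriorAlgebra R (Fin m → R))) (w : (ExteriorAlgebra R (Fin m → R)))
    (hw : w ∈ J • (⊤ : Submodule R (ExteriorAlgebra R (Fin m → R)))) : F w ∈ J • (⊤ : Submodule R (ExteriorAlgebra R (Fin m → R))) := by
  have : F w ∈ (J • (⊤ : Submodule R (ExteriorAlgebra R (Fin m → R)))).map F := ⟨w, hw, rfl⟩
  rw [Submodule.map_smul''] at this
  exact Submodule.smul_mono le_rfl le_top this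

theorem chain {κ : Type*} (g : Module.Dual R (Fin m → R)) (c : κ → Fin m → R)
    (J : Set κ → Ideal R) (hJ : ∀ s, J s = Ideal.span ((fun i => g (c i)) '' s))
    (hreg : ∀ s i, i ∉ s → ∀ p, g (c i) * p ∈ J s → p ∈ J s)
    (w : (ExteriorAlgebra R (Fin m → R))) (hw : kd g w = 0) (l : List κ) (hl : l.Nodup) :
    kd g ((l.map fun i => ExteriorAlgebra.ι R (c i)).prod * w) ∈
        J {i | i ∈ l} • (⊤ : Submodule R (ExteriorAlgebra R (Fin m → R))) ∧
    ((∃ x, ∃ y ∈ J {i | i ∈ l} • (⊤ : Submodule R (ExteriorAlgebra R (Fin m → R))),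
      (l.map fun i => ExteriorAlgebra.ι R (c i)).prod * w = kd g x + y) → ∃ x, w = kd g x) := by
  induction l with
  | nil =>
    constructor
    · simp [hw]
    · rintro ⟨x, y, hy, h⟩
      refine ⟨x, ?_⟩
      have : J {i | i ∈ ([] : List κ)} = ⊥ := by simp [hJ]
      rw [this] at hy
      simp at hy
      simpa [hy] using h
  | cons i l ih =>
    rw [List.nodup_cons] at hl
    obtain ⟨ih1, ih2⟩ := ih hl.2
    have hset : {a | a ∈ i :: l} = insert i {a | a ∈ l} := by ext; simp
    have hins : J {a | a ∈ i :: l} = Ideal.span {g (c i)} ⊔ J {a | a ∈ l} := by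
      rw [hset, hJ, hJ, Set.image_insert_eq, Ideal.span_insert]
    set W := (l.map fun i => ExteriorAlgebra.ι R (c i)).prod * w with hW
    have hle : J {a | a ∈ l} ≤ J {a | a ∈ i :: l} := by rw [hins]; exact le_sup_right
    have hmem : g (c i) ∈ J {a | a ∈ i :: l} := by
      rw [hins]; exact Ideal.mem_sup_left (Ideal.mem_span_singleton_self _)
    rw [List.map_cons, List.prod_cons, mul_assoc, ← hW]
    have hmul : ∀ y ∈ J {a | a ∈ l} • (⊤ : Submodule R (ExteriorAlgebra R (Fin m → R))),
        ExteriorAlgebra.ι R (c i) * y ∈ J {a | a ∈ l} • (⊤ : Submodule R (ExteriorAlgebra R (Fin m → R))) :=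
      fun y hy => map_smul_top _ (LinearMap.mulLeft R (ExteriorAlgebra.ι R (c i))) y hy
    constructor
    · rw [kd_mul]
      exact Submodule.sub_mem _ (Submodule.smul_mem_smul hmem trivial)
        (Submodule.smul_mono hle le_rfl (hmul _ ih1))
    · rintro ⟨x, y, hy, h⟩
      apply ih2
      rw [hins, Submodule.sup_smul] at hy
      obtain ⟨y1, hy1, y2, hy2, rfl⟩ := Submodule.mem_sup.1 hy
      rw [Submodule.ideal_span_singleton_smul] at hy1
      obtain ⟨C, -, rfl⟩ := hy1
      refine ⟨C, W - kd g C, ?_, by abel⟩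
      apply free_nzd (g (c i)) _ (hreg _ i hl.1)
      have h2 := congrArg (kd g) h
      simp only [kd_mul, map_add, kd_kd, zero_add] at h2
      have h3 : kd g (g (c i) • C) = g (c i) • kd g C := map_smul _ _ _
      have h4 : g (c i) • (W - kd g C) = kd g y2 + ExteriorAlgebra.ι R (c i) * kd g W := by
        have h5 : kd g (DistribSMul.toLinearMap R (ExteriorAlgebra R (Fin m → R)) (g (c i)) C) =
            g (c i) • kd g C := h3
        rw [h5, sub_eq_iff_eq_add] at h2
        rw [smul_sub, h2]
        abel
      rw [h4]
      exact Submodule.add_mem _ (map_smul_top _ _ _ hy2) (hmul _ ih1)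

end chain
end KB
namespace KB

theorem ιMulti_eq_det {R : Type*} [CommRing R] {m : ℕ} (v : Fin m → Fin m → R) :
    ExteriorAlgebra.ιMulti R m v =
      (Matrix.of v).det • ExteriorAlgebra.ιMulti R m (fun i => Pi.basisFun R (Fin m) i) := by
  let G : (Fin m → R) [⋀^Fin m]→ₗ[R] ExteriorAlgebra R (Fin m → R) :=
    (LinearMap.toSpanSingleton R _
      (ExteriorAlgebra.ιMulti R m (fun i => Pi.basisFun R (Fin m) i))).compAlternatingMap
      (Matrix.detRowAlternating)
  have hG : ∀ v, G v = (Matrix.of v).det •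
      ExteriorAlgebra.ιMulti R m (fun i => Pi.basisFun R (Fin m) i) := fun v => rfl
  rw [← hG]
  congr 1
  apply Module.Basis.ext_alternating (Pi.basisFun R (Fin m))
  intro τ hτ
  let τ' : Equiv.Perm (Fin m) := Equiv.ofBijective τ (Finite.injective_iff_bijective.1 hτ)
  rw [hG]
  have h1 := AlternatingMap.map_perm (ExteriorAlgebra.ιMulti R m)
    (fun i => Pi.basisFun R (Fin m) i) τ'
  have h2 : (Matrix.of fun i => Pi.basisFun R (Fin m) (τ i)).det =
      ((Equiv.Perm.sign τ' : ℤ) : R) := by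
    have : (Matrix.of fun i => Pi.basisFun R (Fin m) (τ i)) =
        (1 : Matrix (Fin m) (Fin m) R).submatrix τ' id := by
      ext a b
      simp [τ', Matrix.one_apply, Pi.single_apply, eq_comm]
    rw [this, Matrix.det_permute]
    simp
  rw [h2]
  refine Eq.trans h1 ?_
  rw [Units.smul_def, Int.cast_smul_eq_zsmul]

theorem koszul_of_det {R : Type*} [CommRing R] {n : ℕ} (f : Fin (n + 2) → R)
    (c : Matrix (Fin (n + 1)) (Fin (n + 2)) R) (y : Fin (n + 1) → R)
    (hc : ∀ j, ∑ i, c j i * f i = y j)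
    (hreg : ∀ (s : Set (Fin (n + 1))) i, i ∉ s → ∀ p, y i * p ∈ Ideal.span (y '' s) →
      p ∈ Ideal.span (y '' s))
    (A : Fin (n + 2) → R) (hA : ∑ i, A i * f i = 0)
    (hdet : ∑ i : Fin (n + 2), (-1) ^ (i : ℕ) * A i * (c.submatrix id i.succAbove).det ∈
      Ideal.span (y '' Set.univ))
    (K : Submodule R (Fin (n + 2) → R))
    (hK : ∀ i j, f j • Pi.single i (1 : R) - f i • Pi.single j (1 : R) ∈ K) : A ∈ K := by
  let g : Module.Dual R (Fin (n + 2) → R) := ∑ i, f i • LinearMap.proj i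
  have hg : ∀ v, g v = ∑ i, v i * f i := by
    intro v
    simp [g, mul_comm]
  apply koszul_of_boundary g K
  · intro v b
    have : g v • b - g b • v = ∑ i, ∑ j, (v j * b i) •
        (f j • Pi.single i (1 : R) - f i • Pi.single j (1 : R)) := by
      ext t
      simp only [hg, Pi.sub_apply, Pi.smul_apply, smul_eq_mul, Finset.sum_apply, mul_sub,
        Finset.sum_sub_distrib, Pi.single_apply, Finset.sum_mul]
      congr 1
      · rw [Finset.sum_comm]
        refine Finset.sum_congr rfl fun j _ => ?_
        simp
        ring
      · refine Finset.sum_congr rfl fun j _ => ?_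
        simp
        ring
    rw [this]
    exact Submodule.sum_mem _ fun i _ => Submodule.sum_mem _ fun j _ => K.smul_mem _ (hK i j)
  have hgc : (fun i => g (c i)) = y := by
    ext i; rw [hg, hc]
  have hch := chain (κ := Fin (n + 1)) g c (fun s => Ideal.span (y '' s))
    (by rw [hgc]; simp) (by
      intro s i hi p hp
      exact hreg s i hi p (by rw [← congrFun hgc i]; exact hp))
    (ExteriorAlgebra.ι R A) (by rw [kd_ι, hg, hA, map_zero]) (List.finRange (n + 1))
    (List.nodup_finRange _)
  apply hch.2
  refine ⟨0, _, ?_, by rw [map_zero, zero_add]⟩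
  obtain ⟨v, hv1, hv2⟩ : ∃ v : Fin (n + 2) → Fin (n + 2) → R,
      (∀ i : Fin (n + 1), v i.castSucc = c i) ∧ v (Fin.last _) = A :=
    ⟨Fin.snoc (α := fun _ => Fin (n + 2) → R) c A,
      fun i => Fin.snoc_castSucc (α := fun _ => Fin (n + 2) → R) _ _ i,
      Fin.snoc_last (α := fun _ => Fin (n + 2) → R) _ _⟩
  have h1 : ((List.finRange (n + 1)).map fun i => ExteriorAlgebra.ι R (c i)).prod *
      ExteriorAlgebra.ι R A = ExteriorAlgebra.ιMulti R (n + 2) v := by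
    rw [ExteriorAlgebra.ιMulti_apply, List.ofFn_succ', List.concat_eq_append, List.prod_append]
    simp only [hv1, hv2, List.ofFn_eq_map, List.prod_singleton]
  rw [h1, ιMulti_eq_det]
  have h2 : {i | i ∈ List.finRange (n + 1)} = Set.univ := by ext; simp
  rw [h2]
  refine Submodule.smul_mem_smul ?_ Submodule.mem_top
  rw [Matrix.det_succ_row _ (Fin.last _)]
  have : ∑ j : Fin (n + 2), (-1) ^ ((Fin.last (n + 1) : Fin (n + 2)) + (j : ℕ) : ℕ) *
      (Matrix.of v) (Fin.last (n + 1)) j *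
      ((Matrix.of v).submatrix
        (Fin.last (n + 1)).succAbove j.succAbove).det =
      (-1) ^ (n + 1) *
      ∑ i : Fin (n + 2), (-1) ^ (i : ℕ) * A i * (c.submatrix id i.succAbove).det := by
    rw [Finset.mul_sum]
    refine Finset.sum_congr rfl fun j _ => ?_
    have : (Matrix.of v).submatrix
        (Fin.last (n + 1)).succAbove j.succAbove = c.submatrix id j.succAbove := by
      ext a b
      simp [hv1]
    rw [this]
    simp [pow_add, hv2]
    ring
  rw [this]
  exact Ideal.mul_mem_left _ _ hdet

end KB
namespace KB

section cm
variable {σ k T : Type*} [Field k] [CommRing T] [Algebra k T]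

/-- Apply a linear functional to all coefficients. -/
def cmap (φ : T →ₗ[k] k) : MvPolynomial σ T →ₗ[k] MvPolynomial σ k where
  toFun p := ∑ m ∈ p.support, monomial m (φ (coeff m p))
  map_add' p q := by
    classical
    ext m
    have h : ∀ p : MvPolynomial σ T,
        coeff m (∑ m ∈ p.support, monomial m (φ (coeff m p))) = φ (coeff m p) := by
      intro p
      simp only [coeff_sum, coeff_monomial, Finset.sum_ite_eq', mem_support_iff]
      split_ifs with h
      · rfl
      · rw [not_ne_iff.1 h, map_zero]
    rw [coeff_add, h, h, h, coeff_add, map_add]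
  map_smul' a p := by
    classical
    ext m
    have h : ∀ p : MvPolynomial σ T,
        coeff m (∑ m ∈ p.support, monomial m (φ (coeff m p))) = φ (coeff m p) := by
      intro p
      simp only [coeff_sum, coeff_monomial, Finset.sum_ite_eq', mem_support_iff]
      split_ifs with h
      · rfl
      · rw [not_ne_iff.1 h, map_zero]
    rw [RingHom.id_apply, coeff_smul, h, h, coeff_smul, map_smul]

theorem coeff_cmap (φ : T →ₗ[k] k) (m : σ →₀ ℕ) (p : MvPolynomial σ T) :
    coeff m (cmap φ p) = φ (coeff m p) := by
  classical
  show coeff m (∑ m ∈ p.support, monomial m (φ (coeff m p))) = φ (coeff m p)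
  simp only [coeff_sum, coeff_monomial, Finset.sum_ite_eq', mem_support_iff]
  split_ifs with h
  · rfl
  · rw [not_ne_iff.1 h, map_zero]

theorem cmap_mul (φ : T →ₗ[k] k) (q : MvPolynomial σ k) (p : MvPolynomial σ T) :
    cmap φ (MvPolynomial.map (algebraMap k T) q * p) = q * cmap φ p := by
  classical
  ext m
  rw [coeff_cmap, coeff_mul, coeff_mul, map_sum]
  refine Finset.sum_congr rfl fun x _ => ?_
  rw [coeff_cmap, coeff_map, ← Algebra.smul_def, map_smul, smul_eq_mul]

end cm

section main
variable {k : Type*} [Field k] {n : ℕ}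

/-- View a polynomial in `x, y` as a polynomial in `y` over `k[x]`. -/
def toY (k : Type*) [Field k] (n : ℕ) : MvPolynomial (Fin (n + 1) ⊕ Fin (n + 1)) k →ₐ[k]
    MvPolynomial (Fin (n + 1)) (MvPolynomial (Fin (n + 1)) k) :=
  (sumAlgEquiv k (Fin (n + 1)) (Fin (n + 1))).toAlgHom.comp (rename Sum.swap)

theorem toY_inl (f : MvPolynomial (Fin (n + 1)) k) : toY k n (rename Sum.inl f) = C f := by
  have : (toY k n).comp (rename Sum.inl) = IsScalarTower.toAlgHom k
        (MvPolynomial (Fin (n + 1)) k)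
        (MvPolynomial (Fin (n + 1)) (MvPolynomial (Fin (n + 1)) k)) := by
    ext; simp [toY]
  exact DFunLike.congr_fun this f

theorem toY_inr (f : MvPolynomial (Fin (n + 1)) k) : toY k n (rename Sum.inr f) =
    MvPolynomial.map (algebraMap k (MvPolynomial (Fin (n + 1)) k)) f := by
  have : (toY k n).comp (rename Sum.inr) =
      MvPolynomial.mapAlgHom (Algebra.ofId k (MvPolynomial (Fin (n + 1)) k)) := by
    ext; simp [toY]
  exact DFunLike.congr_fun this f

theorem toY_X_inl (j : Fin (n + 1)) : toY k n (X (Sum.inl j)) = C (X j) := by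
  simp [toY]

theorem toY_X_inr (j : Fin (n + 1)) : toY k n (X (Sum.inr j)) = X j := by
  simp [toY]

/-- the Bezoutians, as polynomials in `y` over `k[x]` -/
def bz (E : Matrix (Fin (n + 2)) (Fin (n + 1)) (MvPolynomial (Fin (n + 1) ⊕ Fin (n + 1)) k))
    (i : Fin (n + 2)) : MvPolynomial (Fin (n + 1)) (MvPolynomial (Fin (n + 1)) k) :=
  toY k n (E.submatrix i.succAbove id).det

theorem bz_eq (E : Matrix (Fin (n + 2)) (Fin (n + 1))
    (MvPolynomial (Fin (n + 1) ⊕ Fin (n + 1)) k)) (i : Fin (n + 2)) :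
    bz E i = ((E.map (toY k n)).submatrix i.succAbove id).det := by
  rw [bz, AlgHom.map_det]
  rfl

theorem alt_minors {R : Type*} [CommRing R] {m : ℕ} (E : Matrix (Fin (m + 1)) (Fin m) R)
    (l : Fin m) :
    ∑ i : Fin (m + 1), (-1) ^ (i : ℕ) * E i l * (E.submatrix i.succAbove id).det = 0 := by
  let F : Matrix (Fin (m + 1)) (Fin (m + 1)) R :=
    Matrix.of fun i => Fin.cons (E i l) (E i)
  have h0 : F.det = 0 := by
    apply Matrix.det_zero_of_column_eq (i := 0) (j := l.succ) (Fin.succ_ne_zero l).symm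
    intro i
    simp [F]
  rw [Matrix.det_succ_column_zero] at h0
  rw [← h0]
  rfl

theorem hE_toY (f : Fin (n + 2) → MvPolynomial (Fin (n + 1)) k)
    (E : Matrix (Fin (n + 2)) (Fin (n + 1)) (MvPolynomial (Fin (n + 1) ⊕ Fin (n + 1)) k))
    (hE : ∀ i, ∑ l, E i l * (X (Sum.inl l) - X (Sum.inr l)) =
      rename Sum.inl (f i) - rename Sum.inr (f i)) (i : Fin (n + 2)) :
    ∑ l, toY k n (E i l) * (C (X l) - X l) = C (f i) -
      MvPolynomial.map (algebraMap k (MvPolynomial (Fin (n + 1)) k)) (f i) := by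
  have := congrArg (toY k n) (hE i)
  rw [map_sub, toY_inl, toY_inr, map_sum] at this
  rw [← this]
  refine Finset.sum_congr rfl fun l _ => ?_
  rw [map_mul, map_sub, toY_X_inl, toY_X_inr]

theorem bezout_syz (f : Fin (n + 2) → MvPolynomial (Fin (n + 1)) k)
    (E : Matrix (Fin (n + 2)) (Fin (n + 1)) (MvPolynomial (Fin (n + 1) ⊕ Fin (n + 1)) k))
    (hE : ∀ i, ∑ l, E i l * (X (Sum.inl l) - X (Sum.inr l)) =
      rename Sum.inl (f i) - rename Sum.inr (f i))
    (φ : MvPolynomial (Fin (n + 1)) k →ₗ[k] k) (hφ : ∀ x ∈ Ideal.span (Set.range f), φ x = 0) :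
    ∑ i : Fin (n + 2), ((-1) ^ (i : ℕ) * cmap φ (bz E i)) * f i = 0 := by
  have h1 : ∑ i : Fin (n + 2), (-1) ^ (i : ℕ) * (C (f i) -
      MvPolynomial.map (algebraMap k (MvPolynomial (Fin (n + 1)) k)) (f i)) * bz E i = 0 := by
    have : ∀ i : Fin (n + 2), (-1) ^ (i : ℕ) * (C (f i) -
      MvPolynomial.map (algebraMap k (MvPolynomial (Fin (n + 1)) k)) (f i)) * bz E i =
      ∑ l, (C (X l) - X l) * ((-1) ^ (i : ℕ) * (E.map (toY k n)) i l *
        ((E.map (toY k n)).submatrix i.succAbove id).det) := by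
      intro i
      rw [← hE_toY f E hE, bz_eq, Finset.mul_sum, Finset.sum_mul]
      refine Finset.sum_congr rfl fun l _ => ?_
      rw [Matrix.map_apply]
      ring
    rw [Finset.sum_congr rfl fun i _ => this i, Finset.sum_comm]
    apply Finset.sum_eq_zero
    intro l _
    rw [← Finset.mul_sum, alt_minors, mul_zero]
  have h2 := congrArg (cmap φ) h1
  rw [map_sum, map_zero] at h2
  rw [← neg_eq_zero, ← h2, ← Finset.sum_neg_distrib]
  refine Finset.sum_congr rfl fun i _ => ?_
  have h3 : (-1) ^ (i : ℕ) * (C (f i) -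
      MvPolynomial.map (algebraMap k (MvPolynomial (Fin (n + 1)) k)) (f i)) * bz E i =
      C (f i) * ((-1) ^ (i : ℕ) * bz E i) -
      MvPolynomial.map (algebraMap k (MvPolynomial (Fin (n + 1)) k))
        ((-1) ^ (i : ℕ) * f i) * bz E i := by
    simp only [map_mul, map_pow, map_neg, map_one]
    ring
  have h4 : ∀ Q : MvPolynomial (Fin (n + 1)) (MvPolynomial (Fin (n + 1)) k),
      cmap φ (C (f i) * Q) = 0 := by
    intro Q
    ext m
    rw [coeff_cmap, coeff_C_mul, coeff_zero]
    exact hφ _ (Ideal.mul_mem_right _ _ (Ideal.subset_span ⟨i, rfl⟩))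
  rw [h3, map_sub, h4, cmap_mul]
  ring

theorem prod_coeff (N : ℕ) (hN : 1 ≤ N) (m : Fin (n + 1) →₀ ℕ) (hm : ∀ j, m j < N) :
    coeff m (∏ j : Fin (n + 1), ∑ a ∈ Finset.range N,
      (C (X j) : MvPolynomial (Fin (n + 1)) (MvPolynomial (Fin (n + 1)) k)) ^ a *
        X j ^ (N - 1 - a)) =
    monomial (Finsupp.equivFunOnFinite.symm fun j => N - 1 - m j) 1 := by
  classical
  rw [Finset.prod_univ_sum, coeff_sum]
  have h : ∀ p : Fin (n + 1) → ℕ, ∏ j, ((C (X j) : MvPolynomial (Fin (n + 1))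
      (MvPolynomial (Fin (n + 1)) k)) ^ p j * X j ^ (N - 1 - p j)) =
      C (monomial (Finsupp.equivFunOnFinite.symm p) 1) *
        monomial (Finsupp.equivFunOnFinite.symm fun j => N - 1 - p j) 1 := by
    intro p
    rw [Finset.prod_mul_distrib, monomial_eq, monomial_eq]
    simp [Finsupp.prod_fintype]
  rw [Finset.sum_eq_single (fun j => N - 1 - m j)]
  · rw [h, coeff_C_mul, coeff_monomial, if_pos, mul_one]
    ext j
    have := hm j
    simp
    omega
  · intro p hp hne
    rw [h, coeff_C_mul, coeff_monomial, if_neg, mul_zero]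
    intro he
    apply hne
    ext j
    have h1 := DFunLike.congr_fun he j
    have h2 := Finset.mem_range.1 (Fintype.mem_piFinset.1 hp j)
    simp at h1
    omega
  · intro hno
    exfalso
    apply hno
    rw [Fintype.mem_piFinset]
    intro j
    simp
    omega

theorem det_cE (f : Fin (n + 2) → MvPolynomial (Fin (n + 1)) k)
    (E : Matrix (Fin (n + 2)) (Fin (n + 1)) (MvPolynomial (Fin (n + 1) ⊕ Fin (n + 1)) k))
    (hE : ∀ i, ∑ l, E i l * (X (Sum.inl l) - X (Sum.inr l)) =
      rename Sum.inl (f i) - rename Sum.inr (f i)) (N : ℕ)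
    (c : Matrix (Fin (n + 1)) (Fin (n + 2)) (MvPolynomial (Fin (n + 1)) k))
    (hc : ∀ j, ∑ i, c j i * f i = X j ^ N) (m : Fin (n + 1) →₀ ℕ) (hm : ∀ j, m j < N) :
    coeff m ((c.map (MvPolynomial.map (algebraMap k (MvPolynomial (Fin (n + 1)) k))) *
        E.map (toY k n)).det -
      ∏ j : Fin (n + 1), ∑ a ∈ Finset.range N,
      (C (X j) : MvPolynomial (Fin (n + 1)) (MvPolynomial (Fin (n + 1)) k)) ^ a *
        X j ^ (N - 1 - a)) ∈ Ideal.span (Set.range f) := by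
  classical
  set I := Ideal.span (Set.range f) with hI
  have hXI : ∀ j, (X j : MvPolynomial (Fin (n + 1)) k) ^ N ∈ I := by
    intro j
    rw [← hc]
    exact Ideal.sum_mem _ fun i _ => Ideal.mul_mem_left _ _ (Ideal.subset_span ⟨i, rfl⟩)
  let π : MvPolynomial (Fin (n + 1)) (MvPolynomial (Fin (n + 1)) k) →+*
    MvPolynomial (Fin (n + 1)) (MvPolynomial (Fin (n + 1)) k ⧸ I) :=
      MvPolynomial.map (Ideal.Quotient.mk I)
  rw [← Ideal.Quotient.eq_zero_iff_mem, ← coeff_map]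
  refine (mem_P N Set.univ _).1 ?_ m (fun j _ => hm j)
  show π _ ∈ _
  have hdiag : (∏ j : Fin (n + 1), ∑ a ∈ Finset.range N,
      (C (X j) : MvPolynomial (Fin (n + 1)) (MvPolynomial (Fin (n + 1)) k)) ^ a *
        X j ^ (N - 1 - a)) = (Matrix.diagonal fun j => ∑ a ∈ Finset.range N,
      (C (X j) : MvPolynomial (Fin (n + 1)) (MvPolynomial (Fin (n + 1)) k)) ^ a *
        X j ^ (N - 1 - a)).det := by
    rw [Matrix.det_diagonal]
  rw [hdiag, map_sub, RingHom.map_det, RingHom.map_det]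
  apply det_transition (fun l => π (C (X l) - X l)) (fun j => - X j ^ N) _
    (fun i => Ideal.span ((fun j => (X j : MvPolynomial (Fin (n + 1))
      (MvPolynomial (Fin (n + 1)) k ⧸ I)) ^ N) '' {i}ᶜ))
  · intro i
    exact Ideal.span_mono (Set.image_mono (Set.subset_univ _))
  · intro i j hij
    exact neg_mem (Ideal.subset_span ⟨j, hij, rfl⟩)
  · intro i p hp
    apply nzd_sub N _ i (by simp) (Ideal.Quotient.mk I (X i))
    rw [← neg_mem_iff]
    convert hp using 1
    simp [π]
    ring
  · ext1 j
    have h1 : ∑ l, (c.map (MvPolynomial.map (algebraMap k (MvPolynomial (Fin (n + 1)) k))) *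
        E.map (toY k n)) j l * (C (X l) - X l) =
        ∑ i, MvPolynomial.map (algebraMap k (MvPolynomial (Fin (n + 1)) k)) (c j i) * C (f i)
          - X j ^ N := by
      simp only [Matrix.mul_apply, Finset.sum_mul]
      rw [Finset.sum_comm]
      have h2 : ∀ i, ∑ l, (c.map (MvPolynomial.map
          (algebraMap k (MvPolynomial (Fin (n + 1)) k)))) j i *
          (E.map (toY k n)) i l * (C (X l) - X l) =
          MvPolynomial.map (algebraMap k (MvPolynomial (Fin (n + 1)) k)) (c j i) * C (f i) -
          MvPolynomial.map (algebraMap k (MvPolynomial (Fin (n + 1)) k)) (c j i * f i) := by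
        intro i
        rw [map_mul, ← mul_sub, ← hE_toY f E hE, Finset.mul_sum]
        refine Finset.sum_congr rfl fun l _ => ?_
        simp only [Matrix.map_apply]
        ring
      rw [Finset.sum_congr rfl fun i _ => h2 i, Finset.sum_sub_distrib, ← map_sum, hc]
      simp
    have h3 := congrArg π h1
    rw [map_sub, map_sum, map_sum] at h3
    have h4 : ∀ i, π (MvPolynomial.map (algebraMap k (MvPolynomial (Fin (n + 1)) k)) (c j i) *
        C (f i)) = 0 := by
      intro i
      rw [map_mul]
      have : π (C (f i)) = 0 := by
        show MvPolynomial.map _ _ = _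
        have hfI : f i ∈ I := Ideal.subset_span ⟨i, rfl⟩
        rw [map_C, Ideal.Quotient.eq_zero_iff_mem.2 hfI, C_0]
      rw [this, mul_zero]
    rw [Finset.sum_eq_zero fun i _ => h4 i] at h3
    have h5 : π (X j ^ N) = X j ^ N := by simp [π]
    rw [h5, zero_sub] at h3
    rw [← h3]
    simp only [Matrix.mulVec, dotProduct, map_mul]
    rfl
  · ext1 j
    have h1 : π ((∑ a ∈ Finset.range N,
      (C (X j) : MvPolynomial (Fin (n + 1)) (MvPolynomial (Fin (n + 1)) k)) ^ a *
        X j ^ (N - 1 - a)) * (C (X j) - X j)) = - X j ^ N := by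
      rw [(Commute.all _ _).geom_sum₂_mul, map_sub]
      have h5 : π (X j ^ N) = X j ^ N := by simp [π]
      have h6 : π (C (X j) ^ N) = 0 := by
        rw [← C_pow]
        show MvPolynomial.map _ _ = _
        rw [map_C, Ideal.Quotient.eq_zero_iff_mem.2 (hXI j), C_0]
      rw [h5, h6, zero_sub]
    rw [← h1, map_mul]
    simp only [Matrix.mulVec, dotProduct]
    rw [Finset.sum_eq_single j]
    · simp
    · intro b _ hb
      simp [Matrix.diagonal_apply_ne _ hb.symm]
    · simp

theorem main_struct (f : Fin (n + 2) → MvPolynomial (Fin (n + 1)) k)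
    (E : Matrix (Fin (n + 2)) (Fin (n + 1)) (MvPolynomial (Fin (n + 1) ⊕ Fin (n + 1)) k))
    (hE : ∀ i, ∑ l, E i l * (X (Sum.inl l) - X (Sum.inr l)) =
      rename Sum.inl (f i) - rename Sum.inr (f i)) (N : ℕ) (hN : 1 ≤ N)
    (c : Matrix (Fin (n + 1)) (Fin (n + 2)) (MvPolynomial (Fin (n + 1)) k))
    (hc : ∀ j, ∑ i, c j i * f i = X j ^ N)
    (A : Fin (n + 2) → MvPolynomial (Fin (n + 1)) k) (hA : ∑ i, A i * f i = 0)
    (K : Submodule (MvPolynomial (Fin (n + 1)) k)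
      (Fin (n + 2) → MvPolynomial (Fin (n + 1)) k))
    (hK : ∀ i j, f j • Pi.single i (1 : MvPolynomial (Fin (n + 1)) k) -
      f i • Pi.single j (1 : MvPolynomial (Fin (n + 1)) k) ∈ K) :
    ∃ φ : MvPolynomial (Fin (n + 1)) k →ₗ[k] k,
      (∀ x ∈ Ideal.span (Set.range f), φ x = 0) ∧
      (A - fun i : Fin (n + 2) => (-1) ^ (i : ℕ) * cmap φ (bz E i)) ∈ K := by
  classical
  set J : Ideal (MvPolynomial (Fin (n + 1)) k) :=
    Ideal.span ((fun j => (X j : MvPolynomial (Fin (n + 1)) k) ^ N) '' Set.univ) with hJ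
  set u : MvPolynomial (Fin (n + 1)) k :=
    ∑ i : Fin (n + 2), (-1) ^ (i : ℕ) * A i * (c.submatrix id i.succAbove).det with hu
  let μ : Fin (n + 1) →₀ ℕ := Finsupp.equivFunOnFinite.symm fun _ => N - 1
  have hμ : ∀ j, μ j < N := by intro j; simp [μ]; omega
  let φ : MvPolynomial (Fin (n + 1)) k →ₗ[k] k :=
    (lcoeff k μ).comp (LinearMap.mulRight k u)
  have hφ : ∀ x, φ x = coeff μ (x * u) := fun x => rfl
  have hfu : ∀ t, u * f t ∈ J := by
    intro t
    let M0 : Matrix (Fin (n + 2)) (Fin (n + 2)) (MvPolynomial (Fin (n + 1)) k) :=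
      Matrix.of (Fin.cons (α := fun _ => Fin (n + 2) → MvPolynomial (Fin (n + 1)) k) A c)
    have h1 : M0.det = u := by
      rw [Matrix.det_succ_row_zero]
      rfl
    rw [← h1, det_row_zero M0 f (Fin.cons (α := fun _ => MvPolynomial (Fin (n + 1)) k) 0
      fun j => X j ^ N)]
    · rw [Fin.sum_univ_succ, Fin.cons_zero, mul_zero, zero_add]
      refine Ideal.sum_mem _ fun j _ => ?_
      rw [Fin.cons_succ]
      exact Ideal.mul_mem_left _ _ (Ideal.subset_span ⟨j, trivial, rfl⟩)
    · ext1 j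
      refine Fin.cases ?_ (fun j => ?_) j
      · rw [Fin.cons_zero]
        exact hA
      · rw [Fin.cons_succ]
        exact hc j
  have hkill : ∀ x ∈ Ideal.span (Set.range f), φ x = 0 := by
    intro x hx
    rw [hφ]
    refine (mem_P N Set.univ _).1 ?_ μ fun j _ => hμ j
    rw [← hJ]
    have : Ideal.span (Set.range f) ≤ Submodule.comap (LinearMap.mulRight
        (MvPolynomial (Fin (n + 1)) k) u) J := by
      rw [Ideal.span, Submodule.span_le]
      rintro _ ⟨t, rfl⟩
      show f t * u ∈ J
      rw [mul_comm]
      exact hfu t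
    exact this hx
  refine ⟨φ, hkill, ?_⟩
  apply koszul_of_det f c (fun j => X j ^ N) hc (fun s i hi p hp => nzd_pow N s i hi p hp)
  · simp only [Pi.sub_apply, sub_mul, Finset.sum_sub_distrib]
    rw [hA, bezout_syz f E hE φ hkill, sub_zero]
  · rw [← hJ]
    have h1 : ∑ i : Fin (n + 2), (-1) ^ (i : ℕ) *
        (A - fun i : Fin (n + 2) => (-1) ^ (i : ℕ) * cmap φ (bz E i)) i *
        (c.submatrix id i.succAbove).det = u -
        cmap φ (c.map (MvPolynomial.map (algebraMap k (MvPolynomial (Fin (n + 1)) k))) *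
        E.map (toY k n)).det := by
      rw [cauchyBinet, map_sum, hu, ← Finset.sum_sub_distrib]
      refine Finset.sum_congr rfl fun i _ => ?_
      have h2 : ((c.map (MvPolynomial.map (algebraMap k
          (MvPolynomial (Fin (n + 1)) k)))).submatrix id i.succAbove).det =
          MvPolynomial.map (algebraMap k (MvPolynomial (Fin (n + 1)) k))
            (c.submatrix id i.succAbove).det := by
        rw [RingHom.map_det]
        rfl
      rw [h2, cmap_mul, ← bz_eq]
      have h3 : ((-1 : MvPolynomial (Fin (n + 1)) k) ^ (i : ℕ)) * (-1) ^ (i : ℕ) = 1 := by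
        rw [← mul_pow]; simp
      simp only [Pi.sub_apply]
      linear_combination (-cmap φ (bz E i) * (c.submatrix id i.succAbove).det) * h3
    rw [h1, hJ, mem_P]
    intro m hm
    have hm' : ∀ j, m j < N := fun j => hm j trivial
    have h4 := hkill _ (det_cE f E hE N c hc m hm')
    rw [coeff_sub, map_sub, prod_coeff N hN m hm', sub_eq_zero] at h4
    rw [coeff_sub, coeff_cmap, h4, hφ, sub_eq_zero]
    have h5 : μ = (Finsupp.equivFunOnFinite.symm fun j => N - 1 - m j) + m := by
      ext j
      have := hm' j
      simp [μ]
      omega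
    rw [h5, coeff_monomial_mul, one_mul]
  · exact hK

end main
end KB
namespace KB

section hom
variable {σ k : Type*} [Field k]

theorem hc_mul {p : MvPolynomial σ k} {d : ℕ} (hp : p.IsHomogeneous d) (q : MvPolynomial σ k)
    (e : ℕ) : homogeneousComponent e (q * p) =
      if d ≤ e then homogeneousComponent (e - d) q * p else 0 := by
  classical
  conv_lhs => rw [← sum_homogeneousComponent q]
  rw [Finset.sum_mul, map_sum]
  have h : ∀ i, homogeneousComponent e (homogeneousComponent i q * p) =
      if i + d = e then homogeneousComponent i q * p else 0 := by
    intro i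
    rw [homogeneousComponent_of_mem ((mem_homogeneousSubmodule _ _).2
      ((homogeneousComponent_isHomogeneous i q).mul hp))]
    simp only [eq_comm]
  rw [Finset.sum_congr rfl fun i _ => h i]
  split_ifs with hde
  · rw [Finset.sum_eq_single (e - d)]
    · rw [if_pos (by omega)]
    · intro b _ hb
      rw [if_neg (by omega)]
    · intro hno
      rw [if_pos (by omega)]
      rw [homogeneousComponent_eq_zero, zero_mul]
      simp at hno
      omega
  · apply Finset.sum_eq_zero
    intro i _
    rw [if_neg (by omega)]

theorem homog_cancel {p q : MvPolynomial σ k} {d e : ℕ} (hp : p.IsHomogeneous d) (hp0 : p ≠ 0)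
    (hq : (q * p).IsHomogeneous (e + d)) : q.IsHomogeneous e := by
  have h := hc_mul hp q (e + d)
  rw [homogeneousComponent_eq_self hq, if_pos (by omega), Nat.add_sub_cancel] at h
  rw [mul_right_cancel₀ hp0 h]
  exact homogeneousComponent_isHomogeneous _ _

theorem det_homog {m : Type*} [Fintype m] [DecidableEq m] (M : Matrix m m (MvPolynomial σ k))
    (e : ℕ) (h : ∀ i j, (M i j).IsHomogeneous e) : M.det.IsHomogeneous (Fintype.card m * e) := by
  rw [Matrix.det_apply]
  apply IsHomogeneous.sum
  intro τ _
  have h1 : (∏ i, M (τ i) i).IsHomogeneous (Fintype.card m * e) := by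
    have := IsHomogeneous.prod Finset.univ (fun i => M (τ i) i) (fun _ => e) fun i _ => h _ _
    simpa using this
  rcases Int.units_eq_one_or (Equiv.Perm.sign τ) with h2 | h2
  · rw [h2, one_smul]; exact h1
  · rw [h2, Units.neg_smul, one_smul]; exact h1.neg

end hom

section dd
variable {k : Type*} [Field k] {n : ℕ}

theorem xy_ne (c : Fin (n + 1)) : (X (Sum.inl c) - X (Sum.inr c) :
    MvPolynomial (Fin (n + 1) ⊕ Fin (n + 1)) k) ≠ 0 := by
  rw [sub_ne_zero]
  intro h
  have := X_injective h
  simp at this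

theorem mixv_homog (j : ℕ) (i : Fin (n + 1)) : (mixv k n j i).IsHomogeneous 1 := by
  unfold mixv
  split_ifs <;> exact isHomogeneous_X _ _

theorem dd_homog {f : MvPolynomial (Fin (n + 1)) k} {d : ℕ} (hd : 1 ≤ d)
    (hf : f.IsHomogeneous d) {c : Fin (n + 1)} {D} (hD : IsDivDiff k n f c D) :
    D.IsHomogeneous (d - 1) := by
  have h1 : (X (Sum.inl c) - X (Sum.inr c) :
    MvPolynomial (Fin (n + 1) ⊕ Fin (n + 1)) k).IsHomogeneous 1 :=
    (isHomogeneous_X _ _).sub (isHomogeneous_X _ _)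
  apply homog_cancel h1 (xy_ne c)
  unfold IsDivDiff at hD
  rw [hD, Nat.sub_add_cancel hd]
  have h2 : ∀ j, (aeval (mixv k n j) f).IsHomogeneous d := by
    intro j
    have := hf.aeval (mixv k n j) (n := 1) (mixv_homog j)
    simpa using this
  exact (h2 _).sub (h2 _)

theorem dd_sum {f : MvPolynomial (Fin (n + 1)) k}
    {D : Fin (n + 1) → MvPolynomial (Fin (n + 1) ⊕ Fin (n + 1)) k}
    (hD : ∀ c, IsDivDiff k n f c (D c)) :
    ∑ l, D l * (X (Sum.inl l) - X (Sum.inr l)) = rename Sum.inl f - rename Sum.inr f := by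
  have h : ∀ l, D l * (X (Sum.inl l) - X (Sum.inr l)) =
    (fun j : ℕ => aeval (mixv k n j) f - aeval (mixv k n (j + 1)) f) (l : ℕ) := fun l => hD l
  rw [Finset.sum_congr rfl fun l _ => h l, Fin.sum_univ_eq_sum_range
    (fun j : ℕ => aeval (mixv k n j) f - aeval (mixv k n (j + 1)) f) (n + 1),
    Finset.sum_range_sub' (fun j : ℕ => aeval (mixv k n j) f)]
  congr 1
  · have : mixv k n 0 = fun i => X (Sum.inl i) := by ext1 i; simp [mixv]
    have h2 : aeval (fun i => X (Sum.inl i)) =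
      (rename Sum.inl : MvPolynomial (Fin (n + 1)) k →ₐ[k]
        MvPolynomial (Fin (n + 1) ⊕ Fin (n + 1)) k) := by ext; simp
    rw [this, h2]
  · have : mixv k n (n + 1) = fun i => X (Sum.inr i) := by
      ext1 i
      exact if_pos i.2
    have h2 : aeval (fun i => X (Sum.inr i)) =
      (rename Sum.inr : MvPolynomial (Fin (n + 1)) k →ₐ[k]
        MvPolynomial (Fin (n + 1) ⊕ Fin (n + 1)) k) := by ext; simp
    rw [this, h2]

theorem exists_E (f : Fin (n + 2) → MvPolynomial (Fin (n + 1)) k)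
    (D : Fin (n + 2) →
      Matrix (Fin (n + 1)) (Fin (n + 1)) (MvPolynomial (Fin (n + 1) ⊕ Fin (n + 1)) k))
    (hD : ∀ (i : Fin (n + 2)) (r c : Fin (n + 1)),
      IsDivDiff k n (f (i.succAbove r)) c (D i r c)) :
    ∃ E : Matrix (Fin (n + 2)) (Fin (n + 1)) (MvPolynomial (Fin (n + 1) ⊕ Fin (n + 1)) k),
      (∀ s c, IsDivDiff k n (f s) c (E s c)) ∧ ∀ i, D i = E.submatrix i.succAbove id := by
  have h : ∀ s : Fin (n + 2), ∃ i : Fin (n + 2), ∃ r, i.succAbove r = s := by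
    intro s
    obtain ⟨i, hi⟩ := exists_ne s
    obtain ⟨r, hr⟩ := Fin.exists_succAbove_eq hi.symm
    exact ⟨i, r, hr⟩
  choose i r hr using h
  have hE : ∀ s c, IsDivDiff k n (f s) c (D (i s) (r s) c) := by
    intro s c
    have := hD (i s) (r s) c
    rwa [hr] at this
  refine ⟨Matrix.of fun s c => D (i s) (r s) c, hE, ?_⟩
  intro a
  ext1 p c
  have h1 := hD a p c
  have h2 := hE (a.succAbove p) c
  unfold IsDivDiff at h1 h2
  exact mul_right_cancel₀ (xy_ne c) (h1.trans h2.symm)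

theorem toY_monomial (s : Fin (n + 1) ⊕ Fin (n + 1) →₀ ℕ) (a : k) :
    toY k n (monomial s a) = monomial (Finsupp.equivFunOnFinite.symm fun j => s (Sum.inr j))
      (monomial (Finsupp.equivFunOnFinite.symm fun j => s (Sum.inl j)) a) := by
  have h1 : toY k n (C a) = C (C a) := by simp [toY]
  rw [monomial_eq, monomial_eq, monomial_eq, map_mul, h1]
  simp [Finsupp.prod_fintype, toY_X_inl, toY_X_inr]
  ring

theorem toY_homog {Q : MvPolynomial (Fin (n + 1) ⊕ Fin (n + 1)) k} {ρ : ℕ}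
    (hQ : Q.IsHomogeneous ρ) (α γ : Fin (n + 1) →₀ ℕ)
    (h : coeff γ (coeff α (toY k n Q)) ≠ 0) : γ.degree + α.degree = ρ := by
  classical
  rw [Q.as_sum, map_sum, coeff_sum, coeff_sum] at h
  obtain ⟨s, hs, hne⟩ := Finset.exists_ne_zero_of_sum_ne_zero h
  have hsd : s.degree = ρ := by
    by_contra hne
    exact mem_support_iff.1 hs (hQ.coeff_eq_zero hne)
  rw [toY_monomial, coeff_monomial] at hne
  split_ifs at hne with h1
  · rw [coeff_monomial] at hne
    split_ifs at hne with h2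
    · rw [← hsd, ← h1, ← h2]
      simp [Finsupp.degree_eq_sum]
    · exact absurd rfl hne
  · exact absurd (coeff_zero _) hne

theorem exists_N (f : Fin (n + 2) → MvPolynomial (Fin (n + 1)) k)
    (hz : ∀ x : Fin (n + 1) → AlgebraicClosure k, (∀ i, aeval x (f i) = 0) → x = 0) :
    ∃ N, 1 ≤ N ∧ ∃ c : Matrix (Fin (n + 1)) (Fin (n + 2)) (MvPolynomial (Fin (n + 1)) k),
      ∀ j, ∑ i, c j i * f i = X j ^ N := by
  have h1 : ∀ j : Fin (n + 1), ∃ m : ℕ,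
      (X j : MvPolynomial (Fin (n + 1)) k) ^ m ∈ Ideal.span (Set.range f) := by
    intro j
    have : (X j : MvPolynomial (Fin (n + 1)) k) ∈ (Ideal.span (Set.range f)).radical := by
      rw [← vanishingIdeal_zeroLocus_eq_radical (K := AlgebraicClosure k)]
      intro x hx
      have := hz x fun i => hx _ (Ideal.subset_span ⟨i, rfl⟩)
      rw [this]
      simp
    exact this
  choose m hm using h1
  let N := ∑ j, m j + 1
  have h2 : ∀ j, (X j : MvPolynomial (Fin (n + 1)) k) ^ N ∈ Ideal.span (Set.range f) := by
    intro j
    refine Ideal.pow_mem_of_pow_mem _ (hm j) ?_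
    have := Finset.single_le_sum (f := m) (fun _ _ => Nat.zero_le _) (Finset.mem_univ j)
    omega
  refine ⟨N, by omega, ?_⟩
  have h3 : ∀ j, ∃ c : Fin (n + 2) → MvPolynomial (Fin (n + 1)) k,
      ∑ i, c i * f i = X j ^ N := fun j => Ideal.mem_span_range_iff_exists_fun.1 (h2 j)
  choose c hc using h3
  exact ⟨Matrix.of c, hc⟩

theorem mem_gp {m : ℤ} {p : MvPolynomial (Fin (n + 1)) k} :
    p ∈ gradedPiece k n m ↔ ∀ s, coeff s p ≠ 0 → (s.degree : ℤ) = m := by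
  unfold gradedPiece
  split_ifs with h
  · rw [mem_homogeneousSubmodule]
    constructor
    · intro hp s hs
      by_contra hne
      exact hs (hp.coeff_eq_zero (by omega))
    · intro hp s hs
      have := hp s hs
      have e : Finsupp.weight 1 s = s.degree := by rw [Finsupp.degree_eq_weight_one]; rfl
      rw [e]
      omega
  · rw [Submodule.mem_bot]
    constructor
    · rintro rfl s hs
      simp at hs
    · intro hp
      ext s
      by_contra hne
      have := hp s (by simpa using hne)
      omega

/-- projection to a graded piece -/
def pr (k : Type*) [Field k] (n : ℕ) (m : ℤ) :
    MvPolynomial (Fin (n + 1)) k →ₗ[k] MvPolynomial (Fin (n + 1)) k :=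
  if 0 ≤ m then homogeneousComponent m.toNat else 0

theorem coeff_pr (m : ℤ) (p : MvPolynomial (Fin (n + 1)) k) (s : Fin (n + 1) →₀ ℕ) :
    coeff s (pr k n m p) = if (s.degree : ℤ) = m then coeff s p else 0 := by
  unfold pr
  split_ifs with h h1 h1
  · rw [coeff_homogeneousComponent, if_pos (by omega)]
  · rw [coeff_homogeneousComponent, if_neg (by omega)]
  · omega
  · simp

theorem pr_mem (m : ℤ) (p : MvPolynomial (Fin (n + 1)) k) : pr k n m p ∈ gradedPiece k n m := by
  rw [mem_gp]
  intro s hs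
  rw [coeff_pr] at hs
  by_contra hne
  rw [if_neg hne] at hs
  exact hs rfl

theorem pr_self {m : ℤ} {p : MvPolynomial (Fin (n + 1)) k} (hp : p ∈ gradedPiece k n m) :
    pr k n m p = p := by
  ext s
  rw [coeff_pr]
  split_ifs with h
  · rfl
  · by_contra hne
    exact h (mem_gp.1 hp s (Ne.symm hne))

theorem pr_ne {m m' : ℤ} (hm : m ≠ m') {p : MvPolynomial (Fin (n + 1)) k}
    (hp : p ∈ gradedPiece k n m') : pr k n m p = 0 := by
  ext s
  rw [coeff_pr, coeff_zero]
  split_ifs with h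
  · by_contra hne
    exact hm (h.symm.trans (mem_gp.1 hp s hne))
  · rfl

theorem pr_mul {p : MvPolynomial (Fin (n + 1)) k} {d : ℕ} (hp : p.IsHomogeneous d)
    (q : MvPolynomial (Fin (n + 1)) k) (m : ℤ) :
    pr k n m (q * p) = pr k n (m - d) q * p := by
  unfold pr
  split_ifs with h h1 h1
  · rw [hc_mul hp, if_pos (by omega)]
    congr 3
    omega
  · rw [hc_mul hp, if_neg (by omega), LinearMap.zero_apply, zero_mul]
  · omega
  · simp

theorem pr_ideal {f : Fin (n + 2) → MvPolynomial (Fin (n + 1)) k} {d : ℕ}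
    (hf : ∀ i, (f i).IsHomogeneous d) (m : ℤ) {x : MvPolynomial (Fin (n + 1)) k}
    (hx : x ∈ Ideal.span (Set.range f)) : pr k n m x ∈ Ideal.span (Set.range f) := by
  obtain ⟨q, rfl⟩ := Ideal.mem_span_range_iff_exists_fun.1 hx
  rw [map_sum]
  refine Ideal.sum_mem _ fun i _ => ?_
  rw [pr_mul (hf i)]
  exact Ideal.mul_mem_left _ _ (Ideal.subset_span ⟨i, rfl⟩)

/-- projection to a graded piece, as a map to the subspace -/
def prG (k : Type*) [Field k] (n : ℕ) (m : ℤ) :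
    MvPolynomial (Fin (n + 1)) k →ₗ[k] gradedPiece k n m :=
  (pr k n m).codRestrict _ (pr_mem m)

theorem cmap_pr (φ : MvPolynomial (Fin (n + 1)) k →ₗ[k] k) (ρ a : ℤ)
    (Q : MvPolynomial (Fin (n + 1)) (MvPolynomial (Fin (n + 1)) k))
    (hQ : ∀ s, coeff s Q ∈ gradedPiece k n (ρ - s.degree)) :
    pr k n a (cmap φ Q) = cmap (φ.comp (pr k n (ρ - a))) Q := by
  ext s
  rw [coeff_pr, coeff_cmap, coeff_cmap, LinearMap.comp_apply]
  split_ifs with h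
  · rw [pr_self]
    rw [← h]
    exact hQ s
  · rw [pr_ne _ (hQ s), map_zero]
    omega

theorem cmap_sum (ρ a r : ℤ) (ha : 0 ≤ a) (hr : r = ρ - a) (φ : Module.Dual k (gradedPiece k n r))
    (Q : MvPolynomial (Fin (n + 1)) (MvPolynomial (Fin (n + 1)) k))
    (hQ : ∀ s, coeff s Q ∈ gradedPiece k n (ρ - s.degree))
    (u : (Fin (n + 1) → ℕ) → gradedPiece k n r)
    (hu : ∀ β ∈ Finset.Nat.antidiagonalTuple (n + 1) a.toNat,
      (u β : MvPolynomial (Fin (n + 1)) k) = coeff (Finsupp.equivFunOnFinite.symm β) Q) :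
    ∑ β ∈ Finset.Nat.antidiagonalTuple (n + 1) a.toNat,
      φ (u β) • monomial (Finsupp.equivFunOnFinite.symm β) (1 : k) =
      cmap (φ.comp (prG k n r)) Q := by
  classical
  ext s
  rw [coeff_cmap, coeff_sum, LinearMap.comp_apply]
  simp only [coeff_smul, coeff_monomial, smul_eq_mul, mul_ite, mul_one, mul_zero]
  have hmem : (s : Fin (n + 1) → ℕ) ∈ Finset.Nat.antidiagonalTuple (n + 1) a.toNat ↔
      (s.degree : ℤ) = a := by
    rw [Finset.Nat.mem_antidiagonalTuple, Finsupp.degree_eq_sum]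
    omega
  have hs : Finsupp.equivFunOnFinite.symm (s : Fin (n + 1) → ℕ) = s := by ext; simp
  by_cases h : (s.degree : ℤ) = a
  · rw [Finset.sum_eq_single (s : Fin (n + 1) → ℕ)]
    · rw [if_pos hs]
      congr 1
      apply Subtype.ext
      rw [hu _ (hmem.2 h), hs]
      show _ = pr k n r _
      rw [pr_self]
      rw [hr, ← h]
      exact hQ s
    · intro β _ hne
      rw [if_neg]
      rintro rfl
      exact hne (by ext; simp)
    · intro hno
      exact absurd (hmem.2 h) hno
  · rw [Finset.sum_eq_zero]
    · have : prG k n r (coeff s Q) = 0 := by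
        apply Subtype.ext
        show pr k n r _ = 0
        exact pr_ne (by omega) (hQ s)
      rw [this, map_zero]
    · intro β hβ
      rw [if_neg]
      rintro rfl
      apply h
      rw [← hmem]
      exact hβ

theorem syzMap_apply (a : ℤ) (f : Fin (n + 2) → MvPolynomial (Fin (n + 1)) k)
    (A : Fin (n + 2) → gradedPiece k n a) :
    syzMap k n a f A = ∑ i, (A i : MvPolynomial (Fin (n + 1)) k) * f i := by
  simp [syzMap]

theorem koszul_apply (f : Fin (n + 2) → MvPolynomial (Fin (n + 1)) k) (i j t : Fin (n + 2))
    (hij : i < j) : (f j • Pi.single i (1 : MvPolynomial (Fin (n + 1)) k) -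
      f i • Pi.single j (1 : MvPolynomial (Fin (n + 1)) k) :
        Fin (n + 2) → MvPolynomial (Fin (n + 1)) k) t =
      if t = i then f j else if t = j then -f i else 0 := by
  simp only [Pi.sub_apply, Pi.smul_apply, Pi.single_apply, smul_eq_mul]
  split_ifs with h1 h2
  · exact absurd (h1.symm.trans h2) hij.ne
  · ring
  · ring
  · ring

end dd
end KB
/-- For `f_0,…,f_{n+1} ∈ S_d` linearly independent with no common
projective zero and for every integer `b`, the space `Syz_b` of syzygies with entries in
`S_{b−d}` is spanned by the Koszul syzygies together with the Bezout syzygies. -/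
theorem syzygies_spanned_by_koszul_and_bezout
    (k : Type*) [Field k] (n : ℕ) (d : ℕ) (hd : 1 ≤ d)
    (f : Fin (n + 2) → MvPolynomial (Fin (n + 1)) k)
    (hf : ∀ i, (f i).IsHomogeneous d)
    (hindep : LinearIndependent k f)
    (hz : ∀ x : Fin (n + 1) → AlgebraicClosure k,
      (∀ i, aeval x (f i) = 0) → x = 0)
    (D : Fin (n + 2) →
      Matrix (Fin (n + 1)) (Fin (n + 1)) (MvPolynomial (Fin (n + 1) ⊕ Fin (n + 1)) k))
    (hD : ∀ (i : Fin (n + 2)) (r c : Fin (n + 1)),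
      IsDivDiff k n (f (i.succAbove r)) c (D i r c))
    (b : ℤ) :
    LinearMap.ker (syzMap k n (b - d) f) =
      Submodule.span k
        ({A | ∃ p ∈ gradedPiece k n (b - 2 * d), ∃ i j : Fin (n + 2), i < j ∧
            ∀ t, ((A t : MvPolynomial (Fin (n + 1)) k)) =
              p * (if t = i then f j else if t = j then -f i else 0)} ∪
         {A | ∃ φ : Module.Dual k ↥(gradedPiece k n (((n + 1) * (d - 1) : ℤ) - b + d)),
            (∀ x : ↥(gradedPiece k n (((n + 1) * (d - 1) : ℤ) - b + d)),
              (x : MvPolynomial (Fin (n + 1)) k) ∈ Ideal.span (Set.range f) → φ x = 0) ∧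
            ∃ u : Fin (n + 2) → (Fin (n + 1) → ℕ) →
                ↥(gradedPiece k n (((n + 1) * (d - 1) : ℤ) - b + d)),
              (∀ (i : Fin (n + 2)),
                ∀ β ∈ Finset.Nat.antidiagonalTuple (n + 1) (b - d).toNat,
                  (u i β : MvPolynomial (Fin (n + 1)) k) =
                    coeffY k n (D i).det (Finsupp.equivFunOnFinite.symm β)) ∧
              ∀ t : Fin (n + 2),
                ((A t : MvPolynomial (Fin (n + 1)) k)) =
                  (-1 : k) ^ (t : ℕ) •
                    ∑ β ∈ Finset.Nat.antidiagonalTuple (n + 1) (b - d).toNat,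
                      φ (u t β) •
                        monomial (Finsupp.equivFunOnFinite.symm β) (1 : k)}) := by
  classical
  obtain ⟨E, hEd, hDE⟩ := KB.exists_E f D hD
  have hE : ∀ i, ∑ l, E i l * (X (Sum.inl l) - X (Sum.inr l)) =
      rename Sum.inl (f i) - rename Sum.inr (f i) := fun i => KB.dd_sum (hEd i)
  obtain ⟨N, hN, c, hc⟩ := KB.exists_N f hz
  have hcY : ∀ t α, coeffY k n (D t).det α = coeff α (KB.bz E t) := by
    intro t α
    rw [hDE t]
    rfl
  have hQ : ∀ t s, coeff s (KB.bz E t) ∈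
      gradedPiece k n (((n + 1) * (d - 1) : ℤ) - (s.degree : ℤ)) := by
    intro t s
    rw [KB.mem_gp]
    intro γ hγ
    have h1 : ((E.submatrix t.succAbove id).det).IsHomogeneous ((n + 1) * (d - 1)) := by
      have := KB.det_homog (E.submatrix t.succAbove id) (d - 1)
        fun i j => KB.dd_homog hd (hf _) (hEd _ _)
      simpa using this
    have h2 := KB.toY_homog h1 s γ hγ
    zify [hd] at h2
    omega
  by_cases hb : 0 ≤ b - d
  swap
  · have hsub : Subsingleton (gradedPiece k n (b - d)) := by
      unfold gradedPiece
      rw [if_neg hb]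
      infer_instance
    have hall : ∀ P Q : Submodule k (Fin (n + 2) → gradedPiece k n (b - d)), P = Q := by
      intro P Q
      exact Subsingleton.elim _ _
    exact hall _ _
  apply le_antisymm
  · intro A hA
    rw [LinearMap.mem_ker, KB.syzMap_apply] at hA
    let K : Submodule (MvPolynomial (Fin (n + 1)) k)
      (Fin (n + 2) → MvPolynomial (Fin (n + 1)) k) :=
      Submodule.span _ (Set.range fun ij : Fin (n + 2) × Fin (n + 2) =>
        f ij.2 • Pi.single ij.1 (1 : MvPolynomial (Fin (n + 1)) k) -
        f ij.1 • Pi.single ij.2 (1 : MvPolynomial (Fin (n + 1)) k))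
    obtain ⟨φ, hφ, hmem⟩ := KB.main_struct f E hE N hN c hc
      (fun i => (A i : MvPolynomial (Fin (n + 1)) k)) hA K
      (fun i j => Submodule.subset_span ⟨(i, j), rfl⟩)
    obtain ⟨q, hq⟩ := Submodule.mem_span_range_iff_exists_fun _ |>.1 hmem
    let ψ : Module.Dual k (gradedPiece k n (((n + 1) * (d - 1) : ℤ) - b + d)) :=
      φ.comp (Submodule.subtype _)
    let u : Fin (n + 2) → (Fin (n + 1) → ℕ) →
        gradedPiece k n (((n + 1) * (d - 1) : ℤ) - b + d) := fun i β =>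
      KB.prG k n _ (coeffY k n (D i).det (Finsupp.equivFunOnFinite.symm β))
    have hu : ∀ (i : Fin (n + 2)),
        ∀ β ∈ Finset.Nat.antidiagonalTuple (n + 1) (b - d).toNat,
          (u i β : MvPolynomial (Fin (n + 1)) k) =
            coeffY k n (D i).det (Finsupp.equivFunOnFinite.symm β) := by
      intro i β hβ
      show KB.pr k n _ _ = _
      apply KB.pr_self
      rw [hcY]
      have h1 := hQ i (Finsupp.equivFunOnFinite.symm β)
      have h2 : ((Finsupp.equivFunOnFinite.symm β).degree : ℤ) = b - d := by
        rw [Finset.Nat.mem_antidiagonalTuple] at hβ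
        rw [Finsupp.degree_eq_sum]
        simp only [Finsupp.equivFunOnFinite_symm_apply_apply]
        omega
      rw [h2] at h1
      convert h1 using 2
      ring
    let B : Fin (n + 2) → gradedPiece k n (b - d) := fun t =>
      KB.prG k n _ ((-1) ^ (t : ℕ) * KB.cmap φ (KB.bz E t))
    have hB : ∀ t, (B t : MvPolynomial (Fin (n + 1)) k) = (-1 : k) ^ (t : ℕ) •
        ∑ β ∈ Finset.Nat.antidiagonalTuple (n + 1) (b - d).toNat,
          ψ (u t β) • monomial (Finsupp.equivFunOnFinite.symm β) (1 : k) := by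
      intro t
      show KB.pr k n _ _ = _
      have h1 := KB.cmap_sum (((n + 1) * (d - 1) : ℤ)) (b - d) _ hb (by ring) ψ (KB.bz E t) (hQ t)
        (u t) (fun β hβ => (hu t β hβ).trans (hcY _ _))
      rw [h1]
      have h2 : ((-1) ^ (t : ℕ) * KB.cmap φ (KB.bz E t)) =
          (-1 : k) ^ (t : ℕ) • KB.cmap φ (KB.bz E t) := by
        rw [smul_eq_C_mul]
        simp
      rw [h2, map_smul, KB.cmap_pr φ _ _ _ (hQ t)]
      congr 1
      have h3 : (((n + 1) * (d - 1) : ℤ)) - (b - d) = ((n + 1) * (d - 1) : ℤ) - b + d := by ring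
      rw [h3]
      rfl
    let Z : Fin (n + 2) × Fin (n + 2) → Fin (n + 2) → gradedPiece k n (b - d) := fun ij t =>
      KB.prG k n _ (q ij * (f ij.2 • Pi.single ij.1 (1 : MvPolynomial (Fin (n + 1)) k) -
        f ij.1 • Pi.single ij.2 (1 : MvPolynomial (Fin (n + 1)) k) :
          Fin (n + 2) → MvPolynomial (Fin (n + 1)) k) t)
    have hAeq : A = B + ∑ ij, Z ij := by
      ext1 t
      apply Subtype.ext
      rw [Pi.add_apply, Finset.sum_apply]
      simp only [B, Z]
      rw [← map_sum, ← map_add]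
      show _ = KB.pr k n _ _
      have h1 : ∑ ij, q ij * (f ij.2 • Pi.single ij.1 (1 : MvPolynomial (Fin (n + 1)) k) -
          f ij.1 • Pi.single ij.2 (1 : MvPolynomial (Fin (n + 1)) k) :
          Fin (n + 2) → MvPolynomial (Fin (n + 1)) k) t =
          (A t : MvPolynomial (Fin (n + 1)) k) - (-1) ^ (t : ℕ) * KB.cmap φ (KB.bz E t) := by
        have h2 := congrFun hq t
        rw [Finset.sum_apply] at h2
        exact h2
      rw [h1]
      rw [add_sub_cancel, KB.pr_self (A t).2]
    rw [hAeq]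
    refine add_mem (Submodule.subset_span (Or.inr
      ⟨ψ, fun x hx => hφ _ hx, u, hu, hB⟩)) (Submodule.sum_mem _ fun ij _ => ?_)
    obtain ⟨i, j⟩ := ij
    have hhom : ∀ t, (f j • Pi.single i (1 : MvPolynomial (Fin (n + 1)) k) -
        f i • Pi.single j (1 : MvPolynomial (Fin (n + 1)) k) :
          Fin (n + 2) → MvPolynomial (Fin (n + 1)) k) t |>.IsHomogeneous d := by
      intro t
      simp only [Pi.sub_apply, Pi.smul_apply, Pi.single_apply, smul_eq_mul, mul_ite, mul_one,
        mul_zero]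
      apply IsHomogeneous.sub <;> split_ifs
      · exact hf _
      · exact isHomogeneous_zero _ _ _
      · exact hf _
      · exact isHomogeneous_zero _ _ _
    have hZ : ∀ t, (Z (i, j) t : MvPolynomial (Fin (n + 1)) k) =
        KB.pr k n (b - 2 * d) (q (i, j)) *
        (f j • Pi.single i (1 : MvPolynomial (Fin (n + 1)) k) -
        f i • Pi.single j (1 : MvPolynomial (Fin (n + 1)) k) :
          Fin (n + 2) → MvPolynomial (Fin (n + 1)) k) t := by
      intro t
      have := KB.pr_mul (hhom t) (q (i, j)) (b - d)
      rw [show b - (d : ℤ) - d = b - 2 * d by ring] at this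
      exact this
    rcases lt_trichotomy i j with hij | hij | hij
    · apply Submodule.subset_span
      refine Or.inl ⟨_, KB.pr_mem _ (q (i, j)), i, j, hij, fun t => ?_⟩
      rw [hZ, KB.koszul_apply f i j t hij]
    · have : Z (i, j) = 0 := by
        ext1 t
        apply Subtype.ext
        rw [hZ, hij, sub_self]
        simp
      rw [this]
      exact zero_mem _
    · apply Submodule.subset_span
      refine Or.inl ⟨_, neg_mem (KB.pr_mem _ (q (i, j))), j, i, hij, fun t => ?_⟩
      rw [hZ, ← KB.koszul_apply f j i t hij, Pi.sub_apply, Pi.sub_apply]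
      ring
  · rw [Submodule.span_le]
    rintro A (⟨p, hp, i, j, hij, hA⟩ | ⟨φ, hφ, u, hu, hA⟩)
    · rw [SetLike.mem_coe, LinearMap.mem_ker, KB.syzMap_apply]
      have h1 : ∀ t, (A t : MvPolynomial (Fin (n + 1)) k) * f t =
          (if t = i then p * f j * f i else 0) + (if t = j then - p * f i * f j else 0) := by
        intro t
        rw [hA]
        by_cases h1 : t = i
        · subst h1
          rw [if_pos rfl, if_pos rfl, if_neg hij.ne, add_zero]
        · by_cases h2 : t = j
          · subst h2
            rw [if_neg h1, if_neg h1, if_pos rfl, if_pos rfl]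
            ring
          · simp [h1, h2]
      rw [Finset.sum_congr rfl fun t _ => h1 t, Finset.sum_add_distrib]
      simp
      ring
    · rw [SetLike.mem_coe, LinearMap.mem_ker, KB.syzMap_apply]
      rw [← KB.bezout_syz f E hE (φ.comp (KB.prG k n _))
        (fun x hx => hφ _ (KB.pr_ideal hf _ hx))]
      refine Finset.sum_congr rfl fun t _ => ?_
      congr 1
      rw [hA, KB.cmap_sum (((n + 1) * (d - 1) : ℤ)) (b - d) _ hb (by ring) φ (KB.bz E t) (hQ t)
        (u t) (fun β hβ => (hu t β hβ).trans (hcY _ _)), smul_eq_C_mul]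
      simp
end
end

section
/- Let f_0,…,f_{n+1} ∈ S_d (d ≥ 1) be homogeneous polynomials with no common zero in projective n-space over an algebraic closure of k (equivalently, S/(f_0,…,f_{n+1}) is finite-dimensional over k). Let K_• be the Koszul complex of f_0,…,f_{n+1} over S, with K_j = ⋀^j(S^{n+2}) and differential e_{i_1}∧⋯∧e_{i_j} ↦ ∑_{t=1}^{j} (−1)^{t−1} f_{i_t} e_{i_1}∧⋯ê_{i_t}⋯∧e_{i_j}. Then the homology H_i(K_•) vanishes for all i ≥ 2; i.e., K_• is exact except at K_1 and K_0. -/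
open MvPolynomial

set_option synthInstance.maxHeartbeats 1000000
set_option maxHeartbeats 1000000
set_option maxSynthPendingDepth 3

noncomputable section

namespace KoszulAux

section abstract_part

variable {R V : Type*} [CommRing R] [AddCommGroup V] [Module R V]

/-- Left multiplication by a vector, as a map between exterior powers. -/
def wedge (j : ℕ) (a : V) : ⋀[R]^j V →ₗ[R] ⋀[R]^(j + 1) V :=
  exteriorPower.alternatingMapLinearEquiv ((exteriorPower.ιMulti R (j + 1)).curryLeft a)

lemma wedge_apply (j : ℕ) (a : V) (g : Fin j → V) :
    wedge (R := R) j a (exteriorPower.ιMulti R j g) =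
      exteriorPower.ιMulti R (j + 1) (Matrix.vecCons a g) := by
  simp [wedge]

variable (φ : V →ₗ[R] R) (δ : ∀ j : ℕ, ⋀[R]^(j + 1) V →ₗ[R] ⋀[R]^j V)

/-- The defining formula of the Koszul differential. -/
def IsKoszul : Prop := ∀ (j : ℕ) (g : Fin (j + 1) → V),
  δ j (exteriorPower.ιMulti R (j + 1) g) =
    ∑ t : Fin (j + 1), ((-1 : R) ^ (t : ℕ) * φ (g t)) •
      exteriorPower.ιMulti R j (g ∘ t.succAbove)

variable {φ δ}

lemma delta_wedge (h : IsKoszul φ δ) (j : ℕ) (a : V) (c : ⋀[R]^(j + 1) V) :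
    δ (j + 1) (wedge (j + 1) a c) = φ a • c - wedge j a (δ j c) := by
  have key : (δ (j + 1)).comp (wedge (j + 1) a) =
      φ a • LinearMap.id - (wedge j a).comp (δ j) := by
    apply exteriorPower.linearMap_ext
    ext1 g
    simp only [LinearMap.compAlternatingMap_apply, LinearMap.comp_apply, LinearMap.sub_apply,
      LinearMap.smul_apply, LinearMap.id_apply, wedge_apply]
    rw [h (j + 1), h j, Fin.sum_univ_succ, map_sum, sub_eq_add_neg, ← Finset.sum_neg_distrib]
    congr 1
    · have : (Matrix.vecCons a g) ∘ (Fin.succAbove 0) = g := by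
        ext i; simp
      rw [this]; simp
    · refine Finset.sum_congr rfl fun t _ => ?_
      have : (Matrix.vecCons a g) ∘ (t.succ.succAbove) = Matrix.vecCons a (g ∘ t.succAbove) := by
        funext i
        refine Fin.cases ?_ (fun i => ?_) i <;> simp
      rw [this, map_smul, wedge_apply]
      simp [pow_succ]
  simpa using LinearMap.congr_fun key c

lemma delta_delta (h : IsKoszul φ δ) (j : ℕ) (c : ⋀[R]^(j + 2) V) :
    δ j (δ (j + 1) c) = 0 := by
  have key : (δ j).comp (δ (j + 1)) = 0 := by
    induction j with
    | zero =>
      apply exteriorPower.linearMap_ext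
      ext1 g
      simp only [LinearMap.compAlternatingMap_apply, LinearMap.comp_apply]
      rw [h 1]
      simp only [map_sum, map_smul, h 0]
      have e : ∀ u v : Fin 0 → V, exteriorPower.ιMulti R 0 u = exteriorPower.ιMulti R 0 v := by
        intro u v; congr 1; exact Subsingleton.elim _ _
      simp only [Fin.sum_univ_succ, Fin.sum_univ_zero, Finset.univ_unique, Finset.sum_singleton]
      rw [e _ (fun _ => 0), e (((g ∘ Fin.succAbove (Fin.succ default))) ∘ _) (fun _ => 0)]
      simp [smul_smul]
      rw [← sub_eq_add_neg, ← sub_smul, mul_comm, sub_self, zero_smul]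
    | succ j ih =>
      apply exteriorPower.linearMap_ext
      ext1 g
      have hg : exteriorPower.ιMulti R (j + 1 + 2) g =
          wedge (j + 1 + 1) (g 0) (exteriorPower.ιMulti R (j + 1 + 1) (Matrix.vecTail g)) := by
        rw [wedge_apply]; congr 1; exact (Matrix.cons_head_tail g).symm
      simp only [LinearMap.compAlternatingMap_apply, LinearMap.comp_apply]
      rw [hg, delta_wedge h, map_sub, delta_wedge h, map_smul]
      have := LinearMap.congr_fun (ih (δ (j + 2) c))
        (exteriorPower.ιMulti R (j + 1 + 1) (Matrix.vecTail g))
      simp only [LinearMap.comp_apply] at this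
      rw [this]
      simp
  exact LinearMap.congr_fun key c

lemma map_smul_top {M N : Type*} [AddCommGroup M] [Module R M] [AddCommGroup N] [Module R N]
    (I : Ideal R) (F : M →ₗ[R] N) {x : M} (hx : x ∈ I • (⊤ : Submodule R M)) :
    F x ∈ I • (⊤ : Submodule R N) := by
  have := Submodule.mem_map_of_mem (f := F) hx
  rw [Submodule.map_smul''] at this
  exact Submodule.smul_mono le_rfl le_top this

lemma mem_smul_top_basis {M ι : Type*} [AddCommGroup M] [Module R M]
    (b : Module.Basis ι R M) (I : Ideal R) (x : M) :
    x ∈ I • (⊤ : Submodule R M) ↔ ∀ i, b.repr x i ∈ I := by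
  constructor
  · intro hx i
    have := map_smul_top I (b.coord i) hx
    simpa using this
  · intro hx
    rw [← b.linearCombination_repr x, Finsupp.linearCombination_apply]
    exact Submodule.sum_mem _ fun i _ => Submodule.smul_mem_smul (hx i) trivial

lemma main_abs {m : ℕ} (b : Module.Basis (Fin m) R V) (h : IsKoszul φ δ) (N : ℕ)
    (y : ℕ → R) (I : ℕ → Ideal R) (hI : ∀ r, r < N → I (r + 1) = I r ⊔ Ideal.span {y r})
    (hy : ∀ r, r < N → ∃ a, φ a = y r)
    (hreg : ∀ r, r < N → ∀ z, y r * z ∈ I r → z ∈ I r) (s : ℕ) :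
    ∀ r, r + s = N → ∀ j, m < j + 1 + s → ∀ c : ⋀[R]^(j + 1) V,
      δ j c ∈ I r • (⊤ : Submodule R (⋀[R]^j V)) →
      ∃ u : ⋀[R]^(j + 2) V, c - δ (j + 1) u ∈ I r • (⊤ : Submodule R (⋀[R]^(j + 1) V)) := by
  induction s with
  | zero =>
    intro r _ j hj c _
    refine ⟨0, ?_⟩
    rw [mem_smul_top_basis (b.exteriorPower (n := j + 1))]
    intro i
    exfalso
    have h1 := Set.powersetCard.mem_iff.mp i.2
    have h2 := Finset.card_le_univ (i : Finset (Fin m))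
    simp at h2
    omega
  | succ s ih =>
    intro r hr j hj c hc
    have hrN : r < N := by omega
    obtain ⟨a, ha⟩ := hy r hrN
    have hw := delta_wedge h j a c
    rw [ha] at hw
    have hle : I r ≤ I (r + 1) := by rw [hI r hrN]; exact le_sup_left
    have hyI : y r ∈ I (r + 1) := by
      rw [hI r hrN]; exact Ideal.mem_sup_right (Ideal.mem_span_singleton_self _)
    have h3 := map_smul_top (I r) (wedge (R := R) j a) hc
    obtain ⟨u, hu⟩ := ih (r + 1) (by omega) (j + 1) (by omega) (wedge (j + 1) a c) (by
      rw [hw]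
      exact Submodule.sub_mem _ (Submodule.smul_mem_smul hyI trivial)
        (Submodule.smul_mono_left hle h3))
    rw [hI r hrN, Submodule.sup_smul, Submodule.mem_sup] at hu
    obtain ⟨p, hp, q, hq, hpq⟩ := hu
    rw [Submodule.ideal_span_singleton_smul, Submodule.mem_smul_pointwise_iff_exists] at hq
    obtain ⟨v, -, rfl⟩ := hq
    refine ⟨v, ?_⟩
    have h4 := congrArg (δ (j + 1)) hpq
    rw [map_sub, hw, delta_delta h, map_add, map_smul] at h4
    have h5 : y r • (c - δ (j + 1) v) = δ (j + 1) p + wedge j a (δ j c) := by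
      rw [smul_sub, sub_eq_iff_eq_add]
      rw [sub_zero, eq_sub_iff_add_eq] at h4
      rw [← h4]; abel
    have h6 : y r • (c - δ (j + 1) v) ∈ I r • (⊤ : Submodule R (⋀[R]^(j + 1) V)) := by
      rw [h5]
      exact Submodule.add_mem _ (map_smul_top _ _ hp) h3
    rw [mem_smul_top_basis (b.exteriorPower (n := j + 1))] at h6 ⊢
    intro i
    apply hreg r hrN
    simpa using h6 i

end abstract_part

lemma X_pow_regular {k σ : Type*} [Field k] (e : σ → ℕ) (T : Set σ) (r : σ) (hr : r ∉ T)
    (z : MvPolynomial σ k)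
    (hz : (X r : MvPolynomial σ k) ^ e r * z ∈
      Ideal.span ((fun i => (X i : MvPolynomial σ k) ^ e i) '' T)) :
    z ∈ Ideal.span ((fun i => (X i : MvPolynomial σ k) ^ e i) '' T) := by
  classical
  have hs : ((fun i => (X i : MvPolynomial σ k) ^ e i) '' T) =
      (fun s => monomial s (1 : k)) '' ((fun i => Finsupp.single i (e i)) '' T) := by
    rw [Set.image_image]
    simp [X_pow_eq_monomial]
  rw [hs, mem_ideal_span_monomial_image] at hz ⊢
  intro w hw
  have h1 : Finsupp.single r (e r) + w ∈ ((X r : MvPolynomial σ k) ^ e r * z).support := by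
    rw [X_pow_eq_monomial, mem_support_iff, coeff_monomial_mul, one_mul]
    exact mem_support_iff.mp hw
  obtain ⟨_, ⟨i, hi, rfl⟩, hle⟩ := hz _ h1
  refine ⟨_, ⟨i, hi, rfl⟩, ?_⟩
  have hne : r ≠ i := fun h => hr (h ▸ hi)
  simp only [Finsupp.single_le_iff] at hle ⊢
  simpa [Finsupp.single_apply, hne] using hle

end KoszulAux

/-- Let `f_0,…,f_{n+1} ∈ S_d` (`d ≥ 1`) have no common zero in
projective `n`-space over an algebraic closure of `k`, and let `K_•` be their Koszul
complex, `K_j = ⋀^j(S^{n+2})` with the contraction differential `δ`.  Then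
`H_i(K_•) = 0` for all `i ≥ 2`, i.e. `ker(δ : K_{t+2} → K_{t+1}) = im(δ : K_{t+3} → K_{t+2})`
for all `t ≥ 0`. -/
theorem koszul_complex_exact_in_high_degrees
    (k : Type*) [Field k] (n : ℕ) (d : ℕ) (hd : 1 ≤ d)
    (f : Fin (n + 2) → MvPolynomial (Fin (n + 1)) k)
    (hf : ∀ i, (f i).IsHomogeneous d)
    (hz : ∀ x : Fin (n + 1) → AlgebraicClosure k,
      (∀ i, aeval x (f i) = 0) → x = 0)
    (δ : ∀ j : ℕ,
      ↥(⋀[MvPolynomial (Fin (n + 1)) k]^(j + 1)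
          (Fin (n + 2) → MvPolynomial (Fin (n + 1)) k)) →ₗ[MvPolynomial (Fin (n + 1)) k]
      ↥(⋀[MvPolynomial (Fin (n + 1)) k]^j
          (Fin (n + 2) → MvPolynomial (Fin (n + 1)) k)))
    (hδ : ∀ (j : ℕ) (g : Fin (j + 1) → (Fin (n + 2) → MvPolynomial (Fin (n + 1)) k))
        (w : ↥(⋀[MvPolynomial (Fin (n + 1)) k]^(j + 1)
          (Fin (n + 2) → MvPolynomial (Fin (n + 1)) k))),
        ((w : ExteriorAlgebra (MvPolynomial (Fin (n + 1)) k)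
            (Fin (n + 2) → MvPolynomial (Fin (n + 1)) k)) =
          ExteriorAlgebra.ιMulti (MvPolynomial (Fin (n + 1)) k) (j + 1) g) →
        ∀ (w' : Fin (j + 1) → ↥(⋀[MvPolynomial (Fin (n + 1)) k]^j
          (Fin (n + 2) → MvPolynomial (Fin (n + 1)) k))),
        (∀ t, ((w' t : ExteriorAlgebra (MvPolynomial (Fin (n + 1)) k)
            (Fin (n + 2) → MvPolynomial (Fin (n + 1)) k)) =
          ExteriorAlgebra.ιMulti (MvPolynomial (Fin (n + 1)) k) j (g ∘ t.succAbove))) →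
        δ j w = ∑ t : Fin (j + 1),
          ((-1 : MvPolynomial (Fin (n + 1)) k) ^ (t : ℕ) *
            ∑ i : Fin (n + 2), g t i * f i) • w' t) :
    ∀ t : ℕ, LinearMap.ker (δ (t + 1)) = LinearMap.range (δ (t + 2)) := by
  
  set φ : (Fin (n + 2) → MvPolynomial (Fin (n + 1)) k) →ₗ[MvPolynomial (Fin (n + 1)) k]
      MvPolynomial (Fin (n + 1)) k := Fintype.linearCombination _ f with hφ
  have hφa : ∀ v, φ v = ∑ i, v i * f i := by
    intro v; simp [hφ, Fintype.linearCombination_apply]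
  have hK : KoszulAux.IsKoszul φ δ := by
    intro j g
    rw [hδ j g _ rfl (fun t => exteriorPower.ιMulti _ j (g ∘ t.succAbove)) (fun t => rfl)]
    simp only [hφa]
  have hX : ∀ i : Fin (n + 1), ∃ e : ℕ, ∃ a, φ a = (X i : MvPolynomial (Fin (n + 1)) k) ^ e := by
    intro i
    have h1 : (X i : MvPolynomial (Fin (n + 1)) k) ∈ (Ideal.span (Set.range f)).radical := by
      rw [← vanishingIdeal_zeroLocus_eq_radical (K := AlgebraicClosure k),
        mem_vanishingIdeal_iff]
      intro x hx
      rw [zeroLocus_span] at hx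
      have := hz x (fun i => hx _ ⟨i, rfl⟩)
      simp [this]
    obtain ⟨e, he⟩ := h1
    obtain ⟨c, hc⟩ := (Ideal.mem_span_range_iff_exists_fun).mp he
    exact ⟨e, c, by rw [hφa, hc]⟩
  choose e a ha using hX
  let I : ℕ → Ideal (MvPolynomial (Fin (n + 1)) k) := fun r =>
    Ideal.span ((fun i => (X i : MvPolynomial (Fin (n + 1)) k) ^ e i) '' {i | (i : ℕ) < r})
  let y : ℕ → MvPolynomial (Fin (n + 1)) k := fun r =>
    if h : r < n + 1 then X ⟨r, h⟩ ^ e ⟨r, h⟩ else 0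
  have hI0 : I 0 = ⊥ := by simp [I]
  intro t
  apply le_antisymm
  · intro c hc
    rw [LinearMap.mem_ker] at hc
    obtain ⟨u, hu⟩ := KoszulAux.main_abs (Pi.basisFun _ (Fin (n + 2))) hK (n + 1) y I
      (by
        intro r hr
        simp only [I, y, dif_pos hr]
        rw [← Ideal.span_union]
        congr 1
        ext p
        constructor
        · rintro ⟨i, hi, rfl⟩
          rcases Nat.lt_succ_iff_lt_or_eq.mp hi with h | h
          · exact Or.inl ⟨i, h, rfl⟩
          · right
            have : i = ⟨r, hr⟩ := Fin.ext h
            subst this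
            rfl
        · rintro (⟨i, hi, rfl⟩ | h)
          · exact ⟨i, Nat.lt_succ_of_lt hi, rfl⟩
          · exact ⟨⟨r, hr⟩, Nat.lt_succ_self r, h.symm⟩)
      (by
        intro r hr
        simp only [y, dif_pos hr]
        exact ⟨_, ha _⟩)
      (by
        intro r hr z hz
        simp only [y, dif_pos hr] at hz
        exact KoszulAux.X_pow_regular e _ _ (by simp) z hz)
      (n + 1) 0 (by omega) (t + 1) (by omega) c (by rw [hc]; exact Submodule.zero_mem _)
    rw [hI0, Submodule.bot_smul, Submodule.mem_bot, sub_eq_zero] at hu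
    exact ⟨u, hu.symm⟩
  · rintro _ ⟨u, rfl⟩
    rw [LinearMap.mem_ker]
    exact KoszulAux.delta_delta hK (t + 1) u
end
end

section
/- Let m ≥ n and let f_0,…,f_m ∈ S_d (d ≥ 1) be linearly independent homogeneous polynomials with no common zero in projective n-space over an algebraic closure of k. Let K_• be the Koszul complex of f_0,…,f_m, graded so that K_j = ⋀^j(S(−d)^{m+1}), i.e., the degree-b piece of K_j is ⋀^j(k^{m+1}) ⊗_k S_{b−jd}, and the contraction differential e_{i_1}∧⋯∧e_{i_j} ↦ ∑_t (−1)^{t−1} f_{i_t} e_{i_1}∧⋯ê_{i_t}⋯∧e_{i_j} preserves degree. Set σ = (m+1)d − (n+1). Then for every integer a and every i with 0 ≤ i ≤ m−n, there is a k-linear isomorphism (H_i(K_•)_{σ−a})^* ≅ H_{m−n−i}(K_•)_a between the indicated graded pieces of the Koszul homology; in particular dim_k H_i(K_•)_{σ−a} = dim_k H_{m−n−i}(K_•)_a. -/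
open MvPolynomial TensorProduct

set_option synthInstance.maxHeartbeats 1000000
set_option maxHeartbeats 1000000
set_option maxSynthPendingDepth 3

noncomputable section

/-- The degree-`b` graded piece `⋀^j(k^{m+1}) ⊗ S_{b−jd}` of the `j`-th term
`K_j = ⋀^j(S(−d)^{m+1})` of the Koszul complex of `m+1` forms of degree `d`. -/
abbrev koszulPiece (k : Type*) [Field k] (n m d : ℕ) (j : ℕ) (b : ℤ) : Type _ :=
  ↥(⋀[k]^j (Fin (m + 1) → k)) ⊗[k] ↥(gradedPiece k n (b - (j : ℤ) * d))

/-- The cycles of the (degree-preserving) Koszul differential `δ` in homological degree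
`i` and internal degree `b`:  all of `K_0` when `i = 0`, and `ker(δ : K_i → K_{i−1})`
when `i ≥ 1`. -/
def koszulCycles (k : Type*) [Field k] (n m d : ℕ)
    (δ : ∀ (j : ℕ) (b : ℤ), koszulPiece k n m d (j + 1) b →ₗ[k] koszulPiece k n m d j b) :
    ∀ (i : ℕ) (b : ℤ), Submodule k (koszulPiece k n m d i b)
  | 0, _ => ⊤
  | (t + 1), b => LinearMap.ker (δ t b)

/-- The degree-`b` part of the `i`-th Koszul homology `H_i(K_•)_b`, namely
`cycles/boundaries`. -/
abbrev koszulHomology (k : Type*) [Field k] (n m d : ℕ)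
    (δ : ∀ (j : ℕ) (b : ℤ), koszulPiece k n m d (j + 1) b →ₗ[k] koszulPiece k n m d j b)
    (i : ℕ) (b : ℤ) : Type _ :=
  ↥(koszulCycles k n m d δ i b) ⧸
    Submodule.comap (koszulCycles k n m d δ i b).subtype (LinearMap.range (δ i b))


set_option linter.all false

namespace KD

section Generic

variable {k : Type*} [Field k] {I : Type*} [Fintype I] [LinearOrder I]
  {M : Type*} [AddCommGroup M] [Module k M]

/-- sign of `i` relative to `T` -/
def sg (k : Type*) [Field k] {I : Type*} [LinearOrder I] (i : I) (T : Finset I) : k :=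
  (-1) ^ (T.filter (fun t => t < i)).card

lemma sg_mul_self (i : I) (T : Finset I) : sg k i T * sg k i T = 1 := by
  simp [sg, ← mul_pow]

lemma sg_insert_lt {i l : I} (T : Finset I) (h : i < l) (hi : i ∉ T) :
    sg k l (insert i T) = - sg k l T := by
  unfold sg
  rw [Finset.filter_insert, if_pos h, Finset.card_insert_of_notMem (by simp [hi]), pow_succ]
  ring

lemma sg_insert_not_lt {i l : I} (T : Finset I) (h : ¬ i < l) :
    sg k l (insert i T) = sg k l T := by
  unfold sg
  rw [Finset.filter_insert, if_neg h]

lemma sg_erase_not_lt {i l : I} (T : Finset I) (h : ¬ i < l) :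
    sg k l (T.erase i) = sg k l T := by
  unfold sg
  rw [Finset.filter_erase, Finset.erase_eq_of_notMem (by simp [h])]

lemma sg_erase_lt {i l : I} (T : Finset I) (h : i < l) (hi : i ∈ T) :
    sg k l (T.erase i) = - sg k l T := by
  conv_rhs => rw [← Finset.insert_erase hi, sg_insert_lt _ h (Finset.notMem_erase i T)]
  simp

/-- annihilation -/
def an (k : Type*) [Field k] {I : Type*} [LinearOrder I]
    (M : Type*) [AddCommGroup M] [Module k M] (i : I) :
    (Finset I → M) →ₗ[k] (Finset I → M) where
  toFun c := fun T => if i ∈ T then 0 else sg k i T • c (insert i T)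
  map_add' c c' := by ext T; by_cases h : i ∈ T <;> simp [h]
  map_smul' a c := by ext T; by_cases h : i ∈ T <;> simp [h, smul_comm a]

/-- creation -/
def cr (k : Type*) [Field k] {I : Type*} [LinearOrder I]
    (M : Type*) [AddCommGroup M] [Module k M] (i : I) :
    (Finset I → M) →ₗ[k] (Finset I → M) where
  toFun c := fun T => if i ∈ T then sg k i T • c (T.erase i) else 0
  map_add' c c' := by ext T; by_cases h : i ∈ T <;> simp [h]
  map_smul' a c := by ext T; by_cases h : i ∈ T <;> simp [h, smul_comm a]

lemma an_apply (i : I) (c : Finset I → M) (T : Finset I) :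
    an k M i c T = if i ∈ T then 0 else sg k i T • c (insert i T) := rfl

lemma cr_apply (i : I) (c : Finset I → M) (T : Finset I) :
    cr k M i c T = if i ∈ T then sg k i T • c (T.erase i) else 0 := rfl

lemma an_an_self (i : I) (c : Finset I → M) : an k M i (an k M i c) = 0 := by
  ext T; simp [an_apply]

lemma an_an (i l : I) (h : i ≠ l) (c : Finset I → M) :
    an k M i (an k M l c) + an k M l (an k M i c) = 0 := by
  wlog hil : i < l generalizing i l
  · rw [add_comm]; exact this l i h.symm (lt_of_le_of_ne (not_lt.mp hil) h.symm)
  ext T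
  by_cases hi : i ∈ T
  · by_cases hl : l ∈ T <;> simp [an_apply, hi, hl]
  by_cases hl : l ∈ T
  · simp [an_apply, hi, hl]
  simp only [Pi.add_apply, an_apply, hi, hl, if_false, Finset.mem_insert, h, h.symm, or_self,
    smul_smul, Pi.zero_apply]
  rw [sg_insert_lt T hil hi, sg_insert_not_lt T hil.not_gt, Finset.insert_comm, ← add_smul]
  convert zero_smul k _ using 2
  ring

lemma an_cr_self (i : I) (c : Finset I → M) :
    an k M i (cr k M i c) + cr k M i (an k M i c) = c := by
  ext T
  by_cases hi : i ∈ T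
  · simp [an_apply, cr_apply, hi, smul_smul, sg_erase_not_lt, sg_mul_self]
  · simp [an_apply, cr_apply, hi, smul_smul, sg_insert_not_lt, sg_mul_self]

lemma an_cr (i l : I) (h : i ≠ l) (c : Finset I → M) :
    an k M i (cr k M l c) + cr k M l (an k M i c) = 0 := by
  ext T
  by_cases hi : i ∈ T
  · by_cases hl : l ∈ T <;> simp [an_apply, cr_apply, hi, hl, h, h.symm]
  by_cases hl : l ∈ T
  · simp only [Pi.add_apply, an_apply, cr_apply, hi, hl, if_false, if_true, Finset.mem_insert,
      h.symm, h, smul_smul, Pi.zero_apply, or_true, Finset.mem_erase, and_false]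
    rw [Finset.erase_insert_of_ne h, ← add_smul]
    convert zero_smul k _ using 2
    rcases lt_or_gt_of_ne h with h1 | h1
    · rw [sg_insert_lt T h1 hi, sg_erase_not_lt T h1.not_gt]; ring
    · rw [sg_insert_not_lt T h1.not_gt, sg_erase_lt T h1 hl]; ring
  · simp [an_apply, cr_apply, hi, hl, h.symm]

lemma an_compLeft (i : I) (φ : Module.End k M) (c : Finset I → M) :
    an k M i (φ.compLeft (Finset I) c) = φ.compLeft (Finset I) (an k M i c) := by
  ext T; by_cases hi : i ∈ T <;> simp [an_apply, hi]

lemma cr_compLeft (i : I) (φ : Module.End k M) (c : Finset I → M) :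
    cr k M i (φ.compLeft (Finset I) c) = φ.compLeft (Finset I) (cr k M i c) := by
  ext T; by_cases hi : i ∈ T <;> simp [cr_apply, hi]

/-- Koszul differential -/
def dd (φ : I → Module.End k M) : (Finset I → M) →ₗ[k] (Finset I → M) :=
  ∑ i, an k M i ∘ₗ (φ i).compLeft (Finset I)

/-- homotopy -/
def hh (φ : I → Module.End k M) : (Finset I → M) →ₗ[k] (Finset I → M) :=
  ∑ i, cr k M i ∘ₗ (φ i).compLeft (Finset I)

lemma dd_apply (φ : I → Module.End k M) (c : Finset I → M) (T : Finset I) :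
    dd φ c T = ∑ i, if i ∈ T then 0 else sg k i T • φ i (c (insert i T)) := by
  simp [dd, LinearMap.sum_apply, Finset.sum_apply, an_apply]

lemma hh_apply (φ : I → Module.End k M) (c : Finset I → M) (T : Finset I) :
    hh φ c T = ∑ i, if i ∈ T then sg k i T • φ i (c (T.erase i)) else 0 := by
  simp [hh, LinearMap.sum_apply, Finset.sum_apply, cr_apply]

lemma dd_dd (φ : I → Module.End k M) (hφ : ∀ i l x, φ i (φ l x) = φ l (φ i x))
    (c : Finset I → M) : dd φ (dd φ c) = 0 := by
  have : dd φ (dd φ c) = ∑ p : I × I, an k M p.1 (an k M p.2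
      ((φ p.1).compLeft (Finset I) ((φ p.2).compLeft (Finset I) c))) := by
    rw [Fintype.sum_prod_type]
    rw [Finset.sum_comm]
    simp only [dd, LinearMap.sum_apply, map_sum, LinearMap.comp_apply, an_compLeft]
  rw [this]
  refine Finset.sum_involution (fun p _ => p.swap) ?_ ?_ ?_ ?_
  · rintro ⟨i, l⟩ _
    by_cases h : i = l
    · subst h; simp [an_an_self]
    · have hc : (φ l).compLeft (Finset I) ((φ i).compLeft (Finset I) c)
        = (φ i).compLeft (Finset I) ((φ l).compLeft (Finset I) c) := by
        ext T; simp [hφ l i]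
      simp only [Prod.swap, hc]
      exact an_an i l h _
  · rintro ⟨i, l⟩ _ h h'
    simp only [Prod.swap, Prod.mk.injEq] at h'
    rw [h'.1] at h
    exact h (by simp [an_an_self])
  · intros; simp
  · intros; simp

lemma dd_hh (φ ψ : I → Module.End k M) (hφ : ∀ i l x, φ i (ψ l x) = ψ l (φ i x))
    (c : Finset I → M) : dd φ (hh ψ c) + hh ψ (dd φ c)
      = fun T => ∑ i, φ i (ψ i (c T)) := by
  have h1 : dd φ (hh ψ c) = ∑ i, ∑ l, an k M i (cr k M l
      ((φ i).compLeft (Finset I) ((ψ l).compLeft (Finset I) c))) := by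
    simp only [dd, hh, LinearMap.sum_apply, map_sum, LinearMap.comp_apply, cr_compLeft]
    exact Finset.sum_comm
  have h2 : hh ψ (dd φ c) = ∑ i, ∑ l, cr k M l (an k M i
      ((φ i).compLeft (Finset I) ((ψ l).compLeft (Finset I) c))) := by
    rw [Finset.sum_comm]
    simp only [dd, hh, LinearMap.sum_apply, map_sum, LinearMap.comp_apply]
    rw [Finset.sum_comm]
    refine Finset.sum_congr rfl fun l _ => Finset.sum_congr rfl fun i _ => ?_
    rw [← an_compLeft]
    congr 2
    ext T; simp [hφ]
  rw [h1, h2, ← Finset.sum_add_distrib]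
  simp only [← Finset.sum_add_distrib]
  have : ∀ i, ∑ l, (an k M i (cr k M l
      ((φ i).compLeft (Finset I) ((ψ l).compLeft (Finset I) c))) + cr k M l (an k M i
      ((φ i).compLeft (Finset I) ((ψ l).compLeft (Finset I) c))))
      = (φ i).compLeft (Finset I) ((ψ i).compLeft (Finset I) c) := by
    intro i
    rw [Finset.sum_eq_single i]
    · rw [an_cr_self]
    · intro l _ hl; exact an_cr i l hl.symm _
    · simp
  simp only [this]
  ext T; simp [Finset.sum_apply]

end Generic

section Abs

variable {k : Type*} [Field k] {V : Type*} [AddCommGroup V] [Module k V]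

/-- abstract homology -/
abbrev HH (D : V →ₗ[k] V) (C : ℕ → Submodule k V) (j : ℕ) : Type _ :=
  ↥(LinearMap.ker D ⊓ C j) ⧸
    Submodule.comap (LinearMap.ker D ⊓ C j).subtype (Submodule.map D (C (j + 1)))

lemma finrank_connecting (D D' D'' p q : V →ₗ[k] V) (C C' C'' : ℕ → Submodule k V)
    (h1 : ∀ j, C' j ≤ C j) (h2 : ∀ j, C'' j ≤ C j)
    (hp : ∀ j, ∀ x ∈ C j, p x ∈ C' j) (hq : ∀ j, ∀ x ∈ C j, q x ∈ C'' j)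
    (hpq : ∀ j, ∀ x ∈ C j, p x + q x = x)
    (hq' : ∀ j, ∀ x ∈ C' j, q x = 0) (hq'' : ∀ j, ∀ x ∈ C'' j, q x = x)
    (hD' : ∀ j, ∀ x ∈ C' j, D' x = D x) (hD'' : ∀ j, ∀ x ∈ C'' j, D'' x = q (D x))
    (hDC : ∀ j, ∀ x ∈ C (j + 1), D x ∈ C j) (hDC' : ∀ j, ∀ x ∈ C' (j + 1), D x ∈ C' j)
    (hDD : ∀ x, D (D x) = 0)
    (hex : ∀ j, ∀ x ∈ C j, D x = 0 → ∃ y ∈ C (j + 1), D y = x) (j : ℕ) :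
    Module.finrank k (HH D'' C'' (j + 1)) = Module.finrank k (HH D' C' j) := by
  have key : ∀ x ∈ C'' (j + 1), D'' x = 0 → D x ∈ C' j := by
    intro x hx h0
    rw [hD'' _ x hx] at h0
    have := hpq j (D x) (hDC j x (h2 _ hx))
    rw [h0, add_zero] at this
    rw [← this]
    exact hp _ _ (hDC j x (h2 _ hx))
  let F : ↥(LinearMap.ker D'' ⊓ C'' (j + 1)) →ₗ[k] ↥(LinearMap.ker D' ⊓ C' j) :=
    (D.domRestrict _).codRestrict _ (by
      rintro ⟨x, hx0, hx⟩
      have := key x hx hx0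
      refine ⟨?_, this⟩
      simp only [LinearMap.domRestrict_apply]
      change D' (D x) = 0
      rw [hD' _ _ this, hDD])
  have hF : ∀ x, (F x : V) = D x := fun x => rfl
  let G : ↥(LinearMap.ker D'' ⊓ C'' (j + 1)) →ₗ[k] HH D' C' j := (Submodule.mkQ _) ∘ₗ F
  have hG : Function.Surjective G := by
    intro z
    obtain ⟨⟨z, hz0, hz⟩, rfl⟩ := Submodule.mkQ_surjective _ z
    replace hz0 : D' z = 0 := hz0
    rw [hD' _ _ hz] at hz0
    obtain ⟨y, hy, hyz⟩ := hex j z (h1 _ hz) hz0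
    have e : D (q y) = z - D (p y) := by
      rw [← hyz, ← map_sub]; congr 1; rw [eq_sub_iff_add_eq, add_comm]; exact hpq _ y hy
    refine ⟨⟨q y, ?_, hq _ y hy⟩, ?_⟩
    · change D'' (q y) = 0
      rw [hD'' _ _ (hq _ y hy), e, map_sub, hq' _ z hz,
        hq' j (D (p y)) (hDC' _ _ (hp _ _ hy)), sub_zero]
    · simp only [G, LinearMap.comp_apply, Submodule.mkQ_apply]
      rw [Submodule.Quotient.eq, Submodule.mem_comap]
      refine ⟨- p y, neg_mem (hp _ _ hy), ?_⟩
      simp only [map_sub, Submodule.subtype_apply, hF, e]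
      rw [hD' _ _ (neg_mem (hp _ _ hy)), map_neg]
      abel
  have hK : LinearMap.ker G = Submodule.comap (LinearMap.ker D'' ⊓ C'' (j + 1)).subtype
      (Submodule.map D'' (C'' (j + 1 + 1))) := by
    ext ⟨c, hc0, hc⟩
    simp only [G, LinearMap.mem_ker, LinearMap.comp_apply, Submodule.mkQ_apply,
      Submodule.Quotient.mk_eq_zero, Submodule.mem_comap, Submodule.subtype_apply, hF]
    constructor
    · rintro ⟨c', hc', e⟩
      rw [hD' _ _ hc'] at e
      obtain ⟨y, hy, hyz⟩ := hex (j + 1) (c - c') (sub_mem (h2 _ hc) (h1 _ hc'))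
        (by rw [map_sub, e, sub_self])
      refine ⟨q y, hq _ _ hy, ?_⟩
      rw [hD'' _ _ (hq _ _ hy)]
      have : D (q y) = c - c' - D (p y) := by
        rw [← hyz, ← map_sub]; congr 1; rw [eq_sub_iff_add_eq, add_comm]; exact hpq _ y hy
      rw [this, map_sub, map_sub, hq'' _ _ hc, hq' _ _ hc', hq' _ _ (hDC' _ _ (hp _ _ hy))]
      simp
    · rintro ⟨y, hy, e⟩
      rw [hD'' _ _ hy] at e
      have hDy := hDC _ _ (h2 _ hy)
      have := hpq _ _ hDy
      refine ⟨- p (D y), neg_mem (hp _ _ hDy), ?_⟩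
      rw [hD' _ _ (neg_mem (hp _ _ hDy)), ← e]
      have h3 := congrArg D this
      rw [map_add, hDD] at h3
      rw [map_neg, neg_eq_iff_add_eq_zero]; exact h3
  rw [← LinearEquiv.finrank_eq (LinearMap.quotKerEquivOfSurjective G hG)]
  exact LinearEquiv.finrank_eq (Submodule.quotEquivOfEq _ _ hK.symm)

lemma finrank_HH (D : V →ₗ[k] V) (C : ℕ → Submodule k V) (j : ℕ)
    (hDD : ∀ x, D (D x) = 0) (hDC : ∀ x ∈ C (j + 1), D x ∈ C j)
    [FiniteDimensional k (C j)] :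
    Module.finrank k (HH D C j) + Module.finrank k (Submodule.map D (C (j + 1)))
      + Module.finrank k (Submodule.map D (C j)) = Module.finrank k (C j) := by
  have hle : Submodule.map D (C (j + 1)) ≤ LinearMap.ker D ⊓ C j := by
    rintro _ ⟨x, hx, rfl⟩
    exact ⟨hDD x, hDC x hx⟩
  have : FiniteDimensional k ↥(LinearMap.ker D ⊓ C j) :=
    Submodule.finiteDimensional_of_le inf_le_right
  have a1 := Submodule.finrank_quotient_add_finrank
    (Submodule.comap (LinearMap.ker D ⊓ C j).subtype (Submodule.map D (C (j + 1))))
  have a2 := LinearEquiv.finrank_eq (Submodule.comapSubtypeEquivOfLe hle)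
  have a3 := LinearMap.finrank_range_add_finrank_ker (D.domRestrict (C j))
  have a4 : LinearMap.range (D.domRestrict (C j)) = Submodule.map D (C j) := by
    rw [LinearMap.range_domRestrict]
  have a5 : Module.finrank k (LinearMap.ker (D.domRestrict (C j)))
      = Module.finrank k ↥(LinearMap.ker D ⊓ C j) := by
    rw [LinearMap.ker_domRestrict]
    have e : Submodule.comap (C j).subtype (LinearMap.ker D) =
      Submodule.comap (C j).subtype (LinearMap.ker D ⊓ C j) := by
      ext x; simp
    first
    | rw [e]
    | (unfold Submodule.submoduleOf; rw [e])
    exact LinearEquiv.finrank_eq (Submodule.comapSubtypeEquivOfLe inf_le_right)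
  rw [a4, a5] at a3
  rw [a2] at a1
  unfold HH
  omega

/-- ranks of adjoint maps agree -/
lemma finrank_adjoint {W V' W' : Type*} [AddCommGroup W] [Module k W] [AddCommGroup V']
    [Module k V'] [AddCommGroup W'] [Module k W'] [FiniteDimensional k V] [FiniteDimensional k W]
    [FiniteDimensional k V'] [FiniteDimensional k W']
    (f : V →ₗ[k] W) (g : W' →ₗ[k] V')
    (P : V' →ₗ[k] Module.Dual k V) (Q : W' →ₗ[k] Module.Dual k W)
    (hP : Function.Injective P) (hQ : Function.Surjective Q)
    (h : ∀ w' v, P (g w') v = Q w' (f v)) :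
    Module.finrank k (LinearMap.range g) = Module.finrank k (LinearMap.range f) := by
  rw [← LinearMap.finrank_range_dualMap_eq_finrank_range f]
  have e : P ∘ₗ g = f.dualMap ∘ₗ Q := by
    ext w' v; simp [h]
  have e1 := LinearMap.range_comp g P
  have e2 := LinearMap.range_comp_of_range_eq_top f.dualMap (LinearMap.range_eq_top.mpr hQ)
  rw [← e2, ← e, e1]
  exact (LinearEquiv.finrank_eq (Submodule.equivMapOfInjective P hP _))

end Abs

end KD

set_option linter.all false

namespace KD

section Shift

open Classical in
/-- truncated shift -/
def shiftEnd (k : Type*) [Field k] {n : ℕ} (A : Set (Fin (n + 1) → ℤ)) (v : Fin (n + 1) → ℤ) :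
    Module.End k ((Fin (n + 1) → ℤ) → k) where
  toFun c := fun e => if e ∈ A ∧ e - v ∈ A then c (e - v) else 0
  map_add' c c' := by ext e; simp only [Pi.add_apply]; split_ifs <;> simp
  map_smul' a c := by
    ext e; simp only [Pi.smul_apply, RingHom.id_apply]; split_ifs <;> simp

variable {k : Type*} [Field k]

open Classical in
lemma shiftEnd_apply {n : ℕ} (A : Set (Fin (n + 1) → ℤ)) (v : Fin (n + 1) → ℤ)
    (c : (Fin (n + 1) → ℤ) → k) (e : Fin (n + 1) → ℤ) :
    shiftEnd k A v c e = if e ∈ A ∧ e - v ∈ A then c (e - v) else 0 := rfl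

variable {n : ℕ}

/-- cast of exponents -/
def ex (u : Fin (n + 1) →₀ ℕ) : Fin (n + 1) → ℤ := fun i => (u i : ℤ)

lemma ex_add (u v : Fin (n + 1) →₀ ℕ) : ex (u + v) = ex u + ex v := by
  ext i; simp [ex]

lemma ex_nonneg (u : Fin (n + 1) →₀ ℕ) : 0 ≤ ex u := by
  intro i; simp [ex]

/-- truncated action of polynomials -/
def act (A : Set (Fin (n + 1) → ℤ)) :
    MvPolynomial (Fin (n + 1)) k →ₗ[k] Module.End k ((Fin (n + 1) → ℤ) → k) :=
  (basisMonomials (Fin (n + 1)) k).constr k (fun u => shiftEnd k A (ex u))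

lemma act_monomial (A : Set (Fin (n + 1) → ℤ)) (u : Fin (n + 1) →₀ ℕ) (a : k) :
    act A (monomial u a) = a • shiftEnd k A (ex u) := by
  have h : act A (monomial u (1 : k)) = shiftEnd k A (ex u) := by
    have := (basisMonomials (Fin (n + 1)) k).constr_basis k (fun u => shiftEnd k A (ex u)) u
    rw [coe_basisMonomials] at this
    exact this
  have h2 : monomial u a = a • monomial u (1 : k) := by simp [smul_monomial]
  rw [h2, map_smul, h]

lemma act_apply (A : Set (Fin (n + 1) → ℤ)) (p : MvPolynomial (Fin (n + 1)) k)
    (c : (Fin (n + 1) → ℤ) → k) (e : Fin (n + 1) → ℤ) :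
    act A p c e = ∑ u ∈ p.support, coeff u p * shiftEnd k A (ex u) c e := by
  have h : act A p = ∑ u ∈ p.support, coeff u p • shiftEnd k A (ex u) := by
    conv_lhs => rw [p.as_sum]
    simp only [map_sum, act_monomial]
  rw [h]
  simp [LinearMap.sum_apply, Finset.sum_apply]

lemma act_ne_zero {A : Set (Fin (n + 1) → ℤ)} {p : MvPolynomial (Fin (n + 1)) k}
    {c : (Fin (n + 1) → ℤ) → k} {e : Fin (n + 1) → ℤ} (h : act A p c e ≠ 0) :
    ∃ u, coeff u p ≠ 0 ∧ e ∈ A ∧ e - ex u ∈ A ∧ c (e - ex u) ≠ 0 := by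
  rw [act_apply] at h
  obtain ⟨u, hu, h⟩ := Finset.exists_ne_zero_of_sum_ne_zero h
  have h2 := right_ne_zero_of_mul h
  rw [shiftEnd_apply] at h2
  split_ifs at h2 with h3
  · exact ⟨u, left_ne_zero_of_mul h, h3.1, h3.2, h2⟩
  · exact absurd rfl h2

lemma shift_shift {A : Set (Fin (n + 1) → ℤ)} (hA : A.OrdConnected) (u v : Fin (n + 1) →₀ ℕ) :
    shiftEnd k A (ex (u + v)) = shiftEnd k A (ex u) * shiftEnd k A (ex v) := by
  apply LinearMap.ext; intro c; funext e
  rw [Module.End.mul_apply]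
  simp only [shiftEnd_apply, ex_add]
  have h1 : e - (ex u + ex v) = e - ex u - ex v := by abel
  rw [h1]
  by_cases h2 : e ∈ A <;> by_cases h3 : e - ex u - ex v ∈ A
  · have : e - ex u ∈ A := by
      refine hA.out h3 h2 ⟨?_, ?_⟩
      · exact sub_le_self _ (ex_nonneg v)
      · exact sub_le_self _ (ex_nonneg u)
    simp [h2, h3, this]
  all_goals simp [h2, h3]

lemma act_mul {A : Set (Fin (n + 1) → ℤ)} (hA : A.OrdConnected)
    (p q : MvPolynomial (Fin (n + 1)) k) : act A (p * q) = act A p * act A q := by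
  induction p using MvPolynomial.induction_on' with
  | monomial u a =>
    induction q using MvPolynomial.induction_on' with
    | monomial v b =>
      rw [monomial_mul]
      simp only [act_monomial, shift_shift hA, smul_mul_smul_comm]
    | add q q' h h' => simp only [mul_add, map_add, h, h']
  | add p p' h h' => simp only [add_mul, map_add, h, h']

lemma act_comm {A : Set (Fin (n + 1) → ℤ)} (hA : A.OrdConnected)
    (p q : MvPolynomial (Fin (n + 1)) k) (c) : act A p (act A q c) = act A q (act A p c) := by
  rw [← Module.End.mul_apply, ← Module.End.mul_apply, ← act_mul hA, ← act_mul hA, mul_comm]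

/-- upward closed subset -/
lemma act_up {A A' : Set (Fin (n + 1) → ℤ)} (hA : A' ⊆ A)
    (hup : ∀ e ∈ A', ∀ e' ∈ A, e ≤ e' → e' ∈ A')
    (p : MvPolynomial (Fin (n + 1)) k) (c : (Fin (n + 1) → ℤ) → k)
    (hc : ∀ e, c e ≠ 0 → e ∈ A') : act A' p c = act A p c := by
  funext e
  rw [act_apply, act_apply]
  refine Finset.sum_congr rfl fun u _ => ?_
  congr 1
  simp only [shiftEnd_apply]
  by_cases h : c (e - ex u) = 0
  · simp [h]
  · have h1 := hc _ h
    have h2 : e ∈ A ↔ e ∈ A' :=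
      ⟨fun h => hup _ h1 _ h (sub_le_self _ (ex_nonneg u)), fun h => hA h⟩
    classical
    simp [h2, h1, hA h1]

open Classical in
lemma act_down {A A'' : Set (Fin (n + 1) → ℤ)} (hA : A'' ⊆ A)
    (p : MvPolynomial (Fin (n + 1)) k) (c : (Fin (n + 1) → ℤ) → k)
    (hc : ∀ e, c e ≠ 0 → e ∈ A'') (e) :
    act A'' p c e = if e ∈ A'' then act A p c e else 0 := by
  rw [act_apply, act_apply]
  by_cases he : e ∈ A''
  · rw [if_pos he]
    refine Finset.sum_congr rfl fun u _ => ?_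
    congr 1
    simp only [shiftEnd_apply]
    by_cases h : c (e - ex u) = 0
    · simp [h]
    · have h1 := hc _ h
      simp [h1, he, hA h1, hA he]
  · rw [if_neg he]
    exact Finset.sum_eq_zero fun u _ => by simp [shiftEnd_apply, he]

/-- inverse shift commutes -/
lemma act_shift_comm {A : Set (Fin (n + 1) → ℤ)} (v : Fin (n + 1) → ℤ)
    (hv : ∀ e, e - v ∈ A ↔ e ∈ A) (p : MvPolynomial (Fin (n + 1)) k) (c) :
    act A p (shiftEnd k A v c) = shiftEnd k A v (act A p c) := by
  funext e
  rw [shiftEnd_apply, act_apply, act_apply]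
  by_cases he : e ∈ A
  · rw [if_pos ⟨he, (hv e).2 he⟩]
    refine Finset.sum_congr rfl fun u _ => ?_
    congr 1
    have h1 : e - v - ex u = e - ex u - v := by abel
    classical
    by_cases h9 : e - ex u ∈ A <;> simp [shiftEnd_apply, hv, h1, h9]
  · rw [if_neg (by simp [he])]
    exact Finset.sum_eq_zero fun u _ => by simp [shiftEnd_apply, he]

/-- total degree -/
def deg (e : Fin (n + 1) → ℤ) : ℤ := ∑ i, e i

lemma deg_sub (e e' : Fin (n + 1) → ℤ) : deg (e - e') = deg e - deg e' := by
  simp [deg]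

lemma deg_ex (u : Fin (n + 1) →₀ ℕ) : deg (ex u) = (u.degree : ℤ) := by
  simp [deg, ex, Finsupp.degree_eq_sum]

/-- chains -/
def CC (k : Type*) [Field k] {n : ℕ} (m d : ℕ) (b : ℤ) (A : Set (Fin (n + 1) → ℤ)) (j : ℕ) :
    Submodule k (Finset (Fin (m + 1)) → (Fin (n + 1) → ℤ) → k) where
  carrier := {c | ∀ T e, c T e ≠ 0 → e ∈ A ∧ T.card = j ∧ deg e = b - j * d}
  zero_mem' := by intro T e h; exact absurd rfl h
  add_mem' := by
    intro c c' hc hc' T e h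
    by_cases h1 : c T e = 0
    · refine hc' T e ?_
      intro h2; apply h; simp [h1, h2]
    · exact hc T e h1
  smul_mem' := by
    intro a c hc T e h
    refine hc T e ?_
    intro h2; apply h; simp [h2]

lemma mem_CC {m d : ℕ} {b : ℤ} {A : Set (Fin (n + 1) → ℤ)} {j : ℕ}
    {c : Finset (Fin (m + 1)) → (Fin (n + 1) → ℤ) → k} :
    c ∈ CC k m d b A j ↔ ∀ T e, c T e ≠ 0 → e ∈ A ∧ T.card = j ∧ deg e = b - j * d := Iff.rfl

variable {m d : ℕ} {f : Fin (m + 1) → MvPolynomial (Fin (n + 1)) k}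

/-- differential -/
abbrev DD (f : Fin (m + 1) → MvPolynomial (Fin (n + 1)) k) (A : Set (Fin (n + 1) → ℤ)) :
    (Finset (Fin (m + 1)) → (Fin (n + 1) → ℤ) → k) →ₗ[k]
    (Finset (Fin (m + 1)) → (Fin (n + 1) → ℤ) → k) :=
  dd (fun i => act A (f i))

lemma DD_mem (hf : ∀ i, (f i).IsHomogeneous d) (A : Set (Fin (n + 1) → ℤ)) (b : ℤ) (j : ℕ)
    (c) (hc : c ∈ CC k m d b A (j + 1)) : DD f A c ∈ CC k m d b A j := by
  intro T e h
  rw [dd_apply, Finset.sum_apply] at h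
  obtain ⟨i, _, h⟩ := Finset.exists_ne_zero_of_sum_ne_zero h
  by_cases hi : i ∈ T
  · simp [hi] at h
  rw [if_neg hi, Pi.smul_apply, smul_eq_mul] at h
  obtain ⟨u, hu, heA, -, h3⟩ := act_ne_zero (right_ne_zero_of_mul h)
  obtain ⟨-, h5, h6⟩ := hc _ _ h3
  rw [Finset.card_insert_of_notMem hi] at h5
  refine ⟨heA, by omega, ?_⟩
  have h7 : u.degree = d := by
    have := hf i hu
    rwa [Finsupp.degree_eq_weight_one]
  rw [deg_sub, deg_ex, h7] at h6
  push_cast at h6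
  linarith

lemma DD_zero (A : Set (Fin (n + 1) → ℤ)) (b : ℤ)
    (c) (hc : c ∈ CC k m d b A 0) : DD f A c = 0 := by
  funext T e
  rw [dd_apply, Finset.sum_apply]
  refine Finset.sum_eq_zero fun i _ => ?_
  by_cases hi : i ∈ T
  · simp [hi]
  · rw [if_neg hi]
    have : c (insert i T) = 0 := by
      funext e'
      by_contra h
      have := (hc _ _ h).2.1
      simp at this
    simp [this]

lemma DD_DD {A : Set (Fin (n + 1) → ℤ)} (hA : A.OrdConnected) (c) : DD f A (DD f A c) = 0 :=
  dd_dd _ (fun i l x => act_comm hA _ _ _) c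

end Shift

end KD

set_option linter.all false

namespace KD

section Chain

variable {k : Type*} [Field k] {n m d : ℕ} {f : Fin (m + 1) → MvPolynomial (Fin (n + 1)) k}

/-- monomials of the `r`-th local cohomology module -/
def SA (n r : ℕ) : Set (Fin (n + 1) → ℤ) :=
  {e | ∀ i : Fin (n + 1), (i.val < r → e i < 0) ∧ (r ≤ i.val → 0 ≤ e i)}

/-- monomials of the localisation of the `r`-th local cohomology module -/
def SN (n r : ℕ) : Set (Fin (n + 1) → ℤ) :=
  {e | ∀ i : Fin (n + 1), (i.val < r → e i < 0) ∧ (r < i.val → 0 ≤ e i)}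

lemma SA_conn (n r : ℕ) : (SA n r).OrdConnected := by
  constructor
  intro x hx y hy z hz i
  exact ⟨fun h => lt_of_le_of_lt (hz.2 i) ((hy i).1 h), fun h => le_trans ((hx i).2 h) (hz.1 i)⟩

lemma SN_conn (n r : ℕ) : (SN n r).OrdConnected := by
  constructor
  intro x hx y hy z hz i
  exact ⟨fun h => lt_of_le_of_lt (hz.2 i) ((hy i).1 h), fun h => le_trans ((hx i).2 h) (hz.1 i)⟩

lemma exists_pow (hf : ∀ i, (f i).IsHomogeneous d)
    (hz : ∀ x : Fin (n + 1) → AlgebraicClosure k,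
      (∀ i, aeval x (f i) = 0) → x = 0) (r : Fin (n + 1)) :
    ∃ (s : ℕ) (g : Fin (m + 1) → MvPolynomial (Fin (n + 1)) k), d ≤ s ∧
      (∀ i, (g i).IsHomogeneous (s - d)) ∧ ∑ i, f i * g i = monomial (Finsupp.single r s) 1 := by
  have h1 : (MvPolynomial.X r : MvPolynomial (Fin (n + 1)) k) ∈
      (Ideal.span (Set.range f)).radical := by
    rw [← vanishingIdeal_zeroLocus_eq_radical (K := AlgebraicClosure k)]
    intro x hx
    rw [zeroLocus_span] at hx
    have := hz x (fun i => hx _ ⟨i, rfl⟩)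
    simp [this]
  obtain ⟨s, hs⟩ := h1
  have hs' : (MvPolynomial.X r ^ (s + d) : MvPolynomial (Fin (n + 1)) k) ∈
      Ideal.span (Set.range f) := by
    rw [pow_add]; exact Ideal.mul_mem_right _ _ hs
  obtain ⟨g, hg⟩ := Ideal.mem_span_range_iff_exists_fun.mp hs'
  refine ⟨s + d, fun i => homogeneousComponent s (g i), by omega, ?_, ?_⟩
  · intro i
    rw [Nat.add_sub_cancel]
    exact homogeneousComponent_isHomogeneous _ _
  · have h2 := congrArg (homogeneousComponent (s + d)) hg
    rw [map_sum] at h2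
    have h3 : ∀ i, homogeneousComponent (s + d) (g i * f i) =
        homogeneousComponent s (g i) * f i := by
      intro i
      conv_lhs => rw [← sum_homogeneousComponent (g i), Finset.sum_mul, map_sum]
      have h5 : ∀ t, homogeneousComponent (s + d) (homogeneousComponent t (g i) * f i)
          = if t = s then homogeneousComponent s (g i) * f i else 0 := by
        intro t
        have h6 : (homogeneousComponent t (g i) * f i).IsHomogeneous (t + d) :=
          (homogeneousComponent_isHomogeneous _ _).mul (hf i)
        rw [homogeneousComponent_of_mem (n := t + d) h6]
        by_cases ht : t = s
        · subst ht; simp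
        · rw [if_neg ht, if_neg (by omega)]
      rw [Finset.sum_congr rfl fun t _ => h5 t, Finset.sum_ite_eq']
      split_ifs with h7
      · rfl
      · rw [homogeneousComponent_eq_zero, zero_mul]
        simp only [Finset.mem_range] at h7
        omega
    simp only [h3] at h2
    rw [MvPolynomial.X_pow_eq_monomial] at h2
    have h4 : (monomial (Finsupp.single r (s + d)) (1 : k)).IsHomogeneous (s + d) :=
      isHomogeneous_monomial _ (by simp)
    rw [homogeneousComponent_of_mem (n := s + d) h4, if_pos rfl] at h2
    rw [← h2]
    exact Finset.sum_congr rfl fun i _ => mul_comm _ _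

lemma hh_mem {s : ℕ} (hs : d ≤ s) {g : Fin (m + 1) → MvPolynomial (Fin (n + 1)) k}
    (hg : ∀ i, (g i).IsHomogeneous (s - d)) (A : Set (Fin (n + 1) → ℤ)) (b : ℤ) (j : ℕ)
    (c) (hc : c ∈ CC k m d (b - s) A j) :
    hh (fun i => act A (g i)) c ∈ CC k m d b A (j + 1) := by
  intro T e h
  rw [hh_apply, Finset.sum_apply] at h
  obtain ⟨i, _, h⟩ := Finset.exists_ne_zero_of_sum_ne_zero h
  by_cases hi : i ∈ T
  swap
  · simp [hi] at h
  rw [if_pos hi, Pi.smul_apply, smul_eq_mul] at h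
  obtain ⟨u, hu, heA, -, h3⟩ := act_ne_zero (right_ne_zero_of_mul h)
  obtain ⟨-, h5, h6⟩ := hc _ _ h3
  rw [Finset.card_erase_of_mem hi] at h5
  have := Finset.card_pos.mpr ⟨i, hi⟩
  refine ⟨heA, by omega, ?_⟩
  have h7 : u.degree = s - d := by
    have := hg i hu
    rwa [Finsupp.degree_eq_weight_one]
  rw [deg_sub, deg_ex, h7] at h6
  push_cast [hs] at h6 ⊢
  linarith

lemma exact_SN (hf : ∀ i, (f i).IsHomogeneous d)
    (hz : ∀ x : Fin (n + 1) → AlgebraicClosure k,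
      (∀ i, aeval x (f i) = 0) → x = 0) (r : Fin (n + 1)) (b : ℤ) (j : ℕ)
    (c) (hc : c ∈ CC k m d b (SN n r) j) (h0 : DD f (SN n r) c = 0) :
    ∃ y ∈ CC k m d b (SN n r) (j + 1), DD f (SN n r) y = c := by
  obtain ⟨s, g, hs, hg, e⟩ := exists_pow hf hz r
  set v := ex (Finsupp.single r s) with hv
  have hvi : ∀ i : Fin (n + 1), i ≠ r → v i = 0 := by
    intro i hi
    simp [hv, ex, Finsupp.single_apply, hi.symm]
  have hN : ∀ e, e - (-v) ∈ SN n r ↔ e ∈ SN n r := by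
    intro e
    refine forall_congr' fun i => ?_
    by_cases hi : i = r
    · subst hi; simp
    · simp [hvi i hi]
  have hdv : deg v = s := by rw [hv, deg_ex]; simp
  set τ := shiftEnd k (SN n r) (-v) with hτ
  have hτc : τ.compLeft _ c ∈ CC k m d (b - s) (SN n r) j := by
    intro T e h
    simp only [LinearMap.compLeft_apply, Function.comp_apply] at h
    rw [hτ, shiftEnd_apply] at h
    split_ifs at h with h1
    · obtain ⟨h2, h3, h4⟩ := hc _ _ h
      refine ⟨h1.1, h3, ?_⟩
      rw [sub_neg_eq_add] at h4
      have : deg (e + v) = deg e + deg v := by simp [deg, Finset.sum_add_distrib]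
      rw [this, hdv] at h4
      linarith
    · exact absurd rfl h
  refine ⟨hh (fun i => act (SN n r) (g i)) (τ.compLeft _ c), hh_mem hs hg _ _ _ _ hτc, ?_⟩
  have h1 := dd_hh (fun i => act (SN n r) (f i)) (fun i => act (SN n r) (g i))
    (fun i l x => act_comm (SN_conn n r) _ _ _) (τ.compLeft _ c)
  have h2 : dd (fun i => act (SN n r) (f i)) (τ.compLeft _ c) = 0 := by
    have : dd (fun i => act (SN n r) (f i)) (τ.compLeft _ c) = τ.compLeft _ (DD f (SN n r) c) := by
      funext T
      simp only [LinearMap.compLeft_apply, Function.comp_apply, dd_apply, map_sum]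
      refine Finset.sum_congr rfl fun i _ => ?_
      by_cases hi : i ∈ T
      · simp [hi]
      · simp only [hi, if_false, map_smul]
        rw [hτ, act_shift_comm _ hN]
    rw [this, h0, map_zero]
  rw [h2, map_zero, add_zero] at h1
  rw [h1]
  funext T
  have h3 : ∑ i, act (SN n r) (f i) (act (SN n r) (g i) (τ.compLeft _ c T))
      = shiftEnd k (SN n r) v (τ (c T)) := by
    have h4 : act (SN n r) (∑ i, f i * g i) = shiftEnd k (SN n r) v := by
      rw [e, act_monomial, one_smul]
    rw [← h4, map_sum, LinearMap.sum_apply]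
    refine Finset.sum_congr rfl fun i _ => ?_
    rw [act_mul (SN_conn n r)]; rfl
  rw [h3]
  funext e
  have hN' : e - v ∈ SN n r ↔ e ∈ SN n r := by
    have := hN (e - v); simp only [sub_neg_eq_add, sub_add_cancel] at this
    exact this.symm
  classical
  rw [shiftEnd_apply, hτ, shiftEnd_apply]
  simp only [sub_neg_eq_add, sub_add_cancel, hN', and_self]
  by_cases he : e ∈ SN n r
  · simp [he]
  · simp only [he, if_false]
    by_contra h
    exact he (hc T e (Ne.symm h)).1

open Classical in
/-- restriction -/
def res (k : Type*) [Field k] (m : ℕ) (A : Set (Fin (n + 1) → ℤ)) :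
    (Finset (Fin (m + 1)) → (Fin (n + 1) → ℤ) → k) →ₗ[k]
    (Finset (Fin (m + 1)) → (Fin (n + 1) → ℤ) → k) where
  toFun c := fun T e => if e ∈ A then c T e else 0
  map_add' c c' := by ext T e; simp only [Pi.add_apply]; split_ifs <;> simp
  map_smul' a c := by ext T e; simp only [Pi.smul_apply, RingHom.id_apply]; split_ifs <;> simp

open Classical in
lemma res_apply (A : Set (Fin (n + 1) → ℤ)) (c : Finset (Fin (m + 1)) → (Fin (n + 1) → ℤ) → k)
    (T e) : res k m A c T e = if e ∈ A then c T e else 0 := rfl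

lemma mem_SN_iff (r : ℕ) (hr : r < n + 1) (e) : e ∈ SN n r ↔ (e ∈ SA n r ∨ e ∈ SA n (r + 1)) := by
  constructor
  · intro h
    by_cases h0 : 0 ≤ e ⟨r, hr⟩
    · left
      intro i
      refine ⟨(h i).1, fun hi => ?_⟩
      rcases eq_or_lt_of_le hi with h1 | h1
      · have : i = ⟨r, hr⟩ := Fin.ext h1.symm
        rw [this]; exact h0
      · exact (h i).2 h1
    · right
      intro i
      refine ⟨fun hi => ?_, fun hi => (h i).2 (by omega)⟩
      rcases eq_or_lt_of_le (Nat.le_of_lt_succ hi) with h1 | h1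
      · have : i = ⟨r, hr⟩ := Fin.ext h1
        rw [this]; omega
      · exact (h i).1 h1
  · rintro (h | h) i
    · exact ⟨(h i).1, fun hi => (h i).2 hi.le⟩
    · exact ⟨fun hi => (h i).1 (by omega), fun hi => (h i).2 hi⟩

lemma not_both (r : ℕ) (hr : r < n + 1) (e) (h : e ∈ SA n r) (h' : e ∈ SA n (r + 1)) : False := by
  have h1 := (h ⟨r, hr⟩).2 le_rfl
  have h2 := (h' ⟨r, hr⟩).1 (Nat.lt_succ_self r)
  omega

lemma CC_mono {A B : Set (Fin (n + 1) → ℤ)} (h : A ⊆ B) (b : ℤ) (j : ℕ) :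
    CC k m d b A j ≤ CC k m d b B j :=
  fun c hc T e he => ⟨h (hc T e he).1, (hc T e he).2⟩

lemma res_mem {A B : Set (Fin (n + 1) → ℤ)} (b : ℤ) (j : ℕ) (c) (hc : c ∈ CC k m d b B j) :
    res k m A c ∈ CC k m d b A j := by
  intro T e h
  rw [res_apply] at h
  split_ifs at h with h1
  · exact ⟨h1, (hc T e h).2⟩
  · exact absurd rfl h

lemma finrank_step (hf : ∀ i, (f i).IsHomogeneous d)
    (hz : ∀ x : Fin (n + 1) → AlgebraicClosure k,
      (∀ i, aeval x (f i) = 0) → x = 0) (r : ℕ) (hr : r < n + 1) (b : ℤ) (j : ℕ) :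
    Module.finrank k (HH (DD f (SA n (r + 1))) (CC k m d b (SA n (r + 1))) (j + 1)) =
    Module.finrank k (HH (DD f (SA n r)) (CC k m d b (SA n r)) j) := by
  have s1 : SA n r ⊆ SN n r := fun e he => (mem_SN_iff r hr e).2 (Or.inl he)
  have s2 : SA n (r + 1) ⊆ SN n r := fun e he => (mem_SN_iff r hr e).2 (Or.inr he)
  have hup : ∀ e ∈ SA n r, ∀ e' ∈ SN n r, e ≤ e' → e' ∈ SA n r := by
    intro e he e' he' hle i
    exact ⟨(he' i).1, fun hi => le_trans ((he i).2 hi) (hle i)⟩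
  have hD' : ∀ j, ∀ x ∈ CC k m d b (SA n r) j, DD f (SA n r) x = DD f (SN n r) x := by
    intro j x hx
    funext T
    rw [dd_apply, dd_apply]
    refine Finset.sum_congr rfl fun i _ => ?_
    rw [act_up s1 hup _ _ (fun e he => (hx _ e he).1)]
  refine finrank_connecting (DD f (SN n r)) (DD f (SA n r)) (DD f (SA n (r + 1)))
    (res k m (SA n r)) (res k m (SA n (r + 1))) (CC k m d b (SN n r)) _ _
    (fun j => CC_mono s1 b j) (fun j => CC_mono s2 b j)
    (fun j x hx => res_mem b j x hx) (fun j x hx => res_mem b j x hx) ?_ ?_ ?_ hD' ?_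
    (fun j x hx => DD_mem hf _ b j x hx) ?_ (DD_DD (SN_conn n r))
    (fun j x hx h0 => exact_SN hf hz ⟨r, hr⟩ b j x hx h0) j
  · intro j x hx
    funext T e
    rw [Pi.add_apply, Pi.add_apply, res_apply, res_apply]
    by_cases h1 : e ∈ SA n r
    · have h2 : e ∉ SA n (r + 1) := fun h => not_both r hr e h1 h
      simp [h1, h2]
    · by_cases h2 : e ∈ SA n (r + 1)
      · simp [h1, h2]
      · simp only [h1, h2, if_false, add_zero]
        by_contra h
        rcases (mem_SN_iff r hr e).1 (hx T e (Ne.symm h)).1 with h | h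
        · exact h1 h
        · exact h2 h
  · intro j x hx
    funext T e
    rw [res_apply]
    split_ifs with h1
    · by_contra h
      exact not_both r hr e (hx T e h).1 h1
    · rfl
  · intro j x hx
    funext T e
    rw [res_apply]
    split_ifs with h1
    · rfl
    · by_contra h
      exact h1 (hx T e (Ne.symm h)).1
  · intro j x hx
    funext T e
    rw [res_apply, dd_apply, dd_apply, Finset.sum_apply, Finset.sum_apply]
    classical
    have : ∀ i, (if i ∈ T then 0 else sg k i T • act (SA n (r + 1)) (f i) (x (insert i T))) e
      = if e ∈ SA n (r + 1) then
        (if i ∈ T then 0 else sg k i T • act (SN n r) (f i) (x (insert i T))) e else 0 := by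
      intro i
      by_cases hi : i ∈ T
      · simp [hi]
      · simp only [hi, if_false, Pi.smul_apply]
        rw [act_down s2 _ _ (fun e he => (hx _ e he).1)]
        split_ifs <;> simp
    rw [Finset.sum_congr rfl fun i _ => this i]
    split_ifs <;> simp
  · intro j x hx
    rw [← hD' _ x hx]
    exact DD_mem hf _ b j x hx

lemma finrank_chain (hf : ∀ i, (f i).IsHomogeneous d)
    (hz : ∀ x : Fin (n + 1) → AlgebraicClosure k,
      (∀ i, aeval x (f i) = 0) → x = 0) (r : ℕ) (hr : r ≤ n + 1) (b : ℤ) (j : ℕ) :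
    Module.finrank k (HH (DD f (SA n r)) (CC k m d b (SA n r)) (j + r)) =
    Module.finrank k (HH (DD f (SA n 0)) (CC k m d b (SA n 0)) j) := by
  induction r with
  | zero => rfl
  | succ r ih => rw [← ih (by omega), ← finrank_step hf hz r (by omega) b (j + r)]; rfl

end Chain

end KD

set_option linter.all false

namespace KD

section Duality

variable {k : Type*} [Field k] {n m d : ℕ} {f : Fin (m + 1) → MvPolynomial (Fin (n + 1)) k}

lemma finite_deg_zero (n : ℕ) (t : ℤ) :
    {e : Fin (n + 1) → ℤ | e ∈ SA n 0 ∧ deg e = t}.Finite := by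
  refine (Set.finite_Icc (0 : Fin (n + 1) → ℤ) (fun _ => t)).subset ?_
  rintro e ⟨he, h⟩
  have h0 : ∀ i, 0 ≤ e i := fun i => (he i).2 (Nat.zero_le _)
  refine ⟨h0, fun i => ?_⟩
  rw [← h]
  exact Finset.single_le_sum (f := e) (fun i _ => h0 i) (Finset.mem_univ i)

lemma refl_mem (e : Fin (n + 1) → ℤ) : -1 - e ∈ SA n (n + 1) ↔ e ∈ SA n 0 := by
  refine forall_congr' fun i => ?_
  have := i.isLt
  have h1 : (-1 - e) i = -1 - e i := rfl
  rw [h1]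
  constructor
  · intro h; have := h.1 this; constructor <;> intro <;> omega
  · intro h; have := h.2 (Nat.zero_le _); constructor <;> intro <;> omega

lemma refl_mem' (e : Fin (n + 1) → ℤ) : -1 - e ∈ SA n 0 ↔ e ∈ SA n (n + 1) := by
  rw [← refl_mem]; simp

lemma deg_refl (e : Fin (n + 1) → ℤ) : deg (-1 - e) = -(n + 1) - deg e := by
  simp [deg]

lemma finite_deg_top (n : ℕ) (t : ℤ) :
    {e : Fin (n + 1) → ℤ | e ∈ SA n (n + 1) ∧ deg e = t}.Finite := by
  refine ((finite_deg_zero n (-(n + 1) - t)).image (fun e => -1 - e)).subset ?_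
  rintro e ⟨he, h⟩
  refine ⟨-1 - e, ⟨(refl_mem' e).2 he, ?_⟩, by simp⟩
  rw [deg_refl, h]

lemma finite_CC {A : Set (Fin (n + 1) → ℤ)} (b : ℤ) (j : ℕ)
    (hA : ∀ t, {e | e ∈ A ∧ deg e = t}.Finite) : FiniteDimensional k (CC k m d b A j) := by
  have := (hA (b - j * d)).to_subtype
  let F : CC k m d b A j →ₗ[k]
      (Finset (Fin (m + 1)) × {e | e ∈ A ∧ deg e = b - j * d} → k) :=
    { toFun := fun c p => c.1 p.1 p.2.1
      map_add' := fun _ _ => rfl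
      map_smul' := fun _ _ => rfl }
  refine Module.Finite.of_injective F ?_
  rw [← LinearMap.ker_eq_bot, LinearMap.ker_eq_bot']
  intro c hc
  apply Subtype.ext
  funext T e
  by_contra h
  have h1 := c.2 T e h
  exact h (congrFun hc (T, ⟨e, h1.1, h1.2.2⟩))

instance (b : ℤ) (j : ℕ) : FiniteDimensional k (CC k m d b (SA n 0) j) :=
  finite_CC b j (finite_deg_zero n)

instance (b : ℤ) (j : ℕ) : FiniteDimensional k (CC k m d b (SA n (n + 1)) j) :=
  finite_CC b j (finite_deg_top n)

/-- residue pairing -/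
def pr (p q : (Fin (n + 1) → ℤ) → k) : k := ∑ᶠ e, p e * q (-1 - e)

lemma supp_fin {p : (Fin (n + 1) → ℤ) → k} (hp : p.support.Finite) (q : (Fin (n + 1) → ℤ) → k) :
    (Function.support fun e => p e * q (-1 - e)).Finite :=
  hp.subset (fun e he => left_ne_zero_of_mul he)

lemma pr_shift (u : Fin (n + 1) →₀ ℕ) (p q : (Fin (n + 1) → ℤ) → k) :
    pr (shiftEnd k (SA n 0) (ex u) p) q = pr p (shiftEnd k (SA n (n + 1)) (ex u) q) := by
  unfold pr
  rw [← finsum_comp_equiv (Equiv.addRight (ex u))]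
  refine finsum_congr fun e => ?_
  classical
  simp only [Equiv.coe_addRight, shiftEnd_apply, add_sub_cancel_right]
  have h1 : -1 - e - ex u = -1 - (e + ex u) := by abel
  rw [refl_mem, h1, refl_mem]
  by_cases h2 : e ∈ SA n 0 <;> by_cases h3 : e + ex u ∈ SA n 0 <;> simp [h2, h3]

lemma finite_support_act (A : Set (Fin (n + 1) → ℤ)) (g : MvPolynomial (Fin (n + 1)) k)
    {p : (Fin (n + 1) → ℤ) → k} (hp : p.support.Finite) : (act A g p).support.Finite := by
  refine ((g.support.finite_toSet.image2 (fun u e => e + ex u) hp)).subset ?_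
  intro e he
  obtain ⟨u, h1, -, -, h2⟩ := act_ne_zero he
  exact ⟨u, by simpa using h1, e - ex u, h2, by simp⟩

lemma pr_sum_left {ι : Type*} (s : Finset ι) (p : ι → (Fin (n + 1) → ℤ) → k)
    (q : (Fin (n + 1) → ℤ) → k) (hp : ∀ i ∈ s, (p i).support.Finite) :
    pr (∑ i ∈ s, p i) q = ∑ i ∈ s, pr (p i) q := by
  unfold pr
  rw [← finsum_sum_comm _ _ (fun i hi => supp_fin (hp i hi) q)]
  refine finsum_congr fun e => ?_
  rw [Finset.sum_apply, Finset.sum_mul]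

lemma pr_sum_right {ι : Type*} (s : Finset ι) (q : ι → (Fin (n + 1) → ℤ) → k)
    (p : (Fin (n + 1) → ℤ) → k) (hp : p.support.Finite) :
    pr p (∑ i ∈ s, q i) = ∑ i ∈ s, pr p (q i) := by
  unfold pr
  rw [← finsum_sum_comm _ _ (fun i hi => supp_fin hp (q i))]
  refine finsum_congr fun e => ?_
  rw [Finset.sum_apply, Finset.mul_sum]

lemma pr_smul_left (a : k) (p q : (Fin (n + 1) → ℤ) → k) (hp : p.support.Finite) :
    pr (a • p) q = a * pr p q := by
  unfold pr
  rw [mul_finsum' _ _ (supp_fin hp q)]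
  refine finsum_congr fun e => ?_
  simp [mul_assoc]

lemma pr_smul_right (a : k) (p q : (Fin (n + 1) → ℤ) → k) (hp : p.support.Finite) :
    pr p (a • q) = a * pr p q := by
  unfold pr
  rw [mul_finsum' _ _ (supp_fin hp q)]
  refine finsum_congr fun e => ?_
  simp [mul_left_comm]

lemma pr_add_left (p p' q : (Fin (n + 1) → ℤ) → k) (hp : p.support.Finite)
    (hp' : p'.support.Finite) : pr (p + p') q = pr p q + pr p' q := by
  unfold pr
  rw [← finsum_add_distrib (supp_fin hp q) (supp_fin hp' q)]
  refine finsum_congr fun e => ?_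
  simp [add_mul]

lemma pr_add_right (p q q' : (Fin (n + 1) → ℤ) → k) (hp : p.support.Finite) :
    pr p (q + q') = pr p q + pr p q' := by
  unfold pr
  rw [← finsum_add_distrib (supp_fin hp q) (supp_fin hp q')]
  refine finsum_congr fun e => ?_
  simp [mul_add]

lemma pr_act (g : MvPolynomial (Fin (n + 1)) k) (p q : (Fin (n + 1) → ℤ) → k)
    (hp : p.support.Finite) :
    pr (act (SA n 0) g p) q = pr p (act (SA n (n + 1)) g q) := by
  have hs : ∀ u, (shiftEnd k (SA n 0) (ex u) p).support.Finite := by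
    intro u
    have := finite_support_act (SA n 0) (monomial u (1 : k)) hp
    rwa [act_monomial, one_smul] at this
  have h : ∀ (A : Set (Fin (n + 1) → ℤ)) (p : (Fin (n + 1) → ℤ) → k),
      act A g p = ∑ u ∈ g.support, coeff u g • shiftEnd k A (ex u) p := by
    intro A p
    funext e
    rw [act_apply]; simp [Finset.sum_apply]
  rw [h, h, pr_sum_left, pr_sum_right _ _ _ hp]
  · refine Finset.sum_congr rfl fun u _ => ?_
    rw [pr_smul_left _ _ _ (hs u), pr_smul_right _ _ _ hp, pr_shift]
  · intro u _
    exact (hs u).subset (Function.support_const_smul_subset _ _)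

/-- global sign -/
def ss (k : Type*) [Field k] {m : ℕ} (T : Finset (Fin (m + 1))) : k := ∏ t ∈ T, (-1) ^ t.val

lemma ss_ne (T : Finset (Fin (m + 1))) : ss k T ≠ 0 :=
  Finset.prod_ne_zero_iff.mpr fun t _ => pow_ne_zero _ (by simp)

/-- pairing of chains -/
def BB (c c' : Finset (Fin (m + 1)) → (Fin (n + 1) → ℤ) → k) : k :=
  ∑ T, ss k T * pr (c T) (c' Tᶜ)

lemma sign_id (i : Fin (m + 1)) (T : Finset (Fin (m + 1))) (hi : i ∉ T) :
    ss k T * sg k i T = ss k (insert i T) * sg k i (insert i T)ᶜ := by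
  have h1 : ss k (insert i T) = (-1) ^ i.val * ss k T := Finset.prod_insert hi
  have h2 : sg k i T * sg k i (insert i T)ᶜ = (-1) ^ i.val := by
    unfold sg
    rw [← pow_add, ← Finset.card_union_of_disjoint]
    · congr 1
      rw [← Finset.filter_union]
      have : (T ∪ (insert i T)ᶜ).filter (fun t => t < i) = Finset.Iio i := by
        ext t
        simp only [Finset.mem_filter, Finset.mem_union, Finset.mem_compl, Finset.mem_insert,
          Finset.mem_Iio]
        constructor
        · exact fun h => h.2
        · intro h
          refine ⟨?_, h⟩
          have := h.ne
          tauto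
      rw [this, Fin.card_Iio]
    · refine Finset.disjoint_filter_filter ?_
      rw [Finset.disjoint_left]
      intro t h1 h2
      simp [h1] at h2
  have h3 : sg k i T = (-1) ^ i.val * sg k i (insert i T)ᶜ := by
    rw [← h2, mul_assoc, sg_mul_self, mul_one]
  rw [h1, h3]; ring

lemma BB_adj (c c' : Finset (Fin (m + 1)) → (Fin (n + 1) → ℤ) → k)
    (hc : ∀ T, (c T).support.Finite) :
    BB (DD f (SA n 0) c) c' = BB c (DD f (SA n (n + 1)) c') := by
  have h1 : BB (DD f (SA n 0) c) c' = ∑ i, ∑ T ∈ Finset.univ.filter (fun T => i ∉ T),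
      ss k T * sg k i T * pr (c (insert i T)) (act (SA n (n + 1)) (f i) (c' Tᶜ)) := by
    unfold BB
    have : ∀ T, ss k T * pr (DD f (SA n 0) c T) (c' Tᶜ) = ∑ i, if i ∉ T then
      ss k T * sg k i T * pr (c (insert i T)) (act (SA n (n + 1)) (f i) (c' Tᶜ)) else 0 := by
      intro T
      rw [dd_apply, pr_sum_left, Finset.mul_sum]
      · refine Finset.sum_congr rfl fun i _ => ?_
        by_cases hi : i ∈ T
        · simp [hi, pr]
        · simp only [hi, if_false, not_false_eq_true, if_true]
          rw [pr_smul_left _ _ _ (finite_support_act _ _ (hc _)), pr_act _ _ _ (hc _), mul_assoc]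
      · intro i _
        by_cases hi : i ∈ T
        · simp [hi]
        · simp only [hi, if_false]
          exact (finite_support_act _ _ (hc _)).subset (Function.support_const_smul_subset _ _)
    rw [Finset.sum_congr rfl fun T _ => this T, Finset.sum_comm]
    simp only [Finset.sum_filter]
  have h2 : BB c (DD f (SA n (n + 1)) c') = ∑ i, ∑ U ∈ Finset.univ.filter (fun U => i ∈ U),
      ss k U * sg k i Uᶜ * pr (c U) (act (SA n (n + 1)) (f i) (c' (insert i Uᶜ))) := by
    unfold BB
    have : ∀ U, ss k U * pr (c U) (DD f (SA n (n + 1)) c' Uᶜ) = ∑ i, if i ∈ U then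
      ss k U * sg k i Uᶜ * pr (c U) (act (SA n (n + 1)) (f i) (c' (insert i Uᶜ))) else 0 := by
      intro U
      rw [dd_apply, pr_sum_right _ _ _ (hc _), Finset.mul_sum]
      refine Finset.sum_congr rfl fun i _ => ?_
      by_cases hi : i ∈ U
      · simp only [hi, Finset.mem_compl, not_true_eq_false, if_false, if_true]
        rw [pr_smul_right _ _ _ (hc _), mul_assoc]
      · simp [hi, pr]
    rw [Finset.sum_congr rfl fun T _ => this T, Finset.sum_comm]
    simp only [Finset.sum_filter]
  rw [h1, h2]
  refine Finset.sum_congr rfl fun i _ => ?_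
  refine Finset.sum_bij' (fun T _ => insert i T) (fun U _ => U.erase i) ?_ ?_ ?_ ?_ ?_
  · intro T _; simp
  · intro U _; simp
  · intro T hT
    simp only [Finset.mem_filter, Finset.mem_univ, true_and] at hT
    exact Finset.erase_insert hT
  · intro U hU
    simp only [Finset.mem_filter, Finset.mem_univ, true_and] at hU
    exact Finset.insert_erase hU
  · intro T hT
    simp only [Finset.mem_filter, Finset.mem_univ, true_and] at hT
    have h3 : insert i (insert i T)ᶜ = Tᶜ := by
      ext t
      by_cases ht : t = i
      · subst ht; simp [hT]
      · simp [ht]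
    rw [h3, sign_id i T hT]

lemma CC_supp {b : ℤ} {j : ℕ} {c} (hc : c ∈ CC k m d b (SA n 0) j) (T) :
    (c T).support.Finite :=
  (finite_deg_zero n (b - j * d)).subset fun e he => ⟨(hc T e he).1, (hc T e he).2.2⟩

/-- the pairing as a linear map -/
def PP (b b' : ℤ) (j j' : ℕ) : CC k m d b' (SA n (n + 1)) j' →ₗ[k]
    Module.Dual k (CC k m d b (SA n 0) j) :=
  LinearMap.mk₂ k (fun c' c => BB c.1 c'.1)
    (by
      intro c' c'' c
      simp only [BB, ← Finset.sum_add_distrib, ← mul_add]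
      refine Finset.sum_congr rfl fun T _ => ?_
      congr 1
      exact pr_add_right _ _ _ (CC_supp c.2 T))
    (by
      intro a c' c
      simp only [BB, smul_eq_mul, Finset.mul_sum]
      refine Finset.sum_congr rfl fun T _ => ?_
      rw [mul_left_comm]
      congr 1
      exact pr_smul_right _ _ _ (CC_supp c.2 T))
    (by
      intro c' c c2
      simp only [BB, ← Finset.sum_add_distrib, ← mul_add]
      refine Finset.sum_congr rfl fun T _ => ?_
      congr 1
      exact pr_add_left _ _ _ (CC_supp c.2 T) (CC_supp c2.2 T))
    (by
      intro a c' c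
      simp only [BB, smul_eq_mul, Finset.mul_sum]
      refine Finset.sum_congr rfl fun T _ => ?_
      rw [mul_left_comm]
      congr 1
      exact pr_smul_left _ _ _ (CC_supp c.2 T))

lemma PP_apply (b b' : ℤ) (j j' : ℕ) (c' : CC k m d b' (SA n (n + 1)) j')
    (c : CC k m d b (SA n 0) j) : PP b b' j j' c' c = BB c.1 c'.1 := rfl

/-- delta function -/
def del (k : Type*) [Field k] (T₀ : Finset (Fin (m + 1))) (e₀ : Fin (n + 1) → ℤ) :
    Finset (Fin (m + 1)) → (Fin (n + 1) → ℤ) → k := Pi.single T₀ (Pi.single e₀ 1)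

lemma del_mem {A : Set (Fin (n + 1) → ℤ)} (b : ℤ) (j : ℕ) (T₀ : Finset (Fin (m + 1)))
    (e₀ : Fin (n + 1) → ℤ) (h : e₀ ∈ A) (hT : T₀.card = j) (he : deg e₀ = b - j * d) :
    del k T₀ e₀ ∈ CC k m d b A j := by
  intro T e h1
  unfold del at h1
  by_cases h2 : T = T₀
  · subst h2
    rw [Pi.single_eq_same] at h1
    by_cases h3 : e = e₀
    · subst h3; exact ⟨h, hT, he⟩
    · rw [Pi.single_eq_of_ne h3] at h1; exact absurd rfl h1
  · rw [Pi.single_eq_of_ne h2] at h1; exact absurd rfl h1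

lemma BB_del_left (T₀ : Finset (Fin (m + 1))) (e₀ : Fin (n + 1) → ℤ) (c') :
    BB (del k T₀ e₀) c' = ss k T₀ * c' T₀ᶜ (-1 - e₀) := by
  unfold BB del
  rw [Finset.sum_eq_single T₀]
  · congr 1
    unfold pr
    rw [finsum_eq_single _ e₀]
    · simp
    · intro e he; simp [Pi.single_eq_of_ne he]
  · intro T _ hT
    rw [Pi.single_eq_of_ne hT]
    simp [pr]
  · simp

lemma BB_del_right (T₀ : Finset (Fin (m + 1))) (e₀ : Fin (n + 1) → ℤ) (c) :
    BB c (del k T₀ e₀) = ss k T₀ᶜ * c T₀ᶜ (-1 - e₀) := by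
  unfold BB del
  rw [Finset.sum_eq_single T₀ᶜ]
  · congr 1
    unfold pr
    rw [finsum_eq_single _ (-1 - e₀)]
    · simp
    · intro e he
      have : -1 - e ≠ e₀ := by rintro rfl; simp at he
      simp [Pi.single_eq_of_ne this]
  · intro T _ hT
    have : Tᶜ ≠ T₀ := by rintro rfl; simp at hT
    rw [Pi.single_eq_of_ne this]
    simp [pr]
  · simp

lemma PP_inj (b : ℤ) (j j' : ℕ) (hj : j + j' = m + 1) :
    Function.Injective (PP (k := k) (n := n) (m := m) (d := d) b
      (((m + 1) * d - (n + 1) : ℤ) - b) j j') := by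
  rw [← LinearMap.ker_eq_bot, LinearMap.ker_eq_bot']
  intro c' hc'
  apply Subtype.ext
  funext T e
  by_contra h
  obtain ⟨h1, h2, h3⟩ := c'.2 T e h
  have h4 : del k Tᶜ (-1 - e) ∈ CC k m d b (SA n 0) j := by
    refine del_mem b j _ _ ((refl_mem' e).2 h1) ?_ ?_
    · rw [Finset.card_compl, h2, Fintype.card_fin]; omega
    · rw [deg_refl, h3]
      have : (j : ℤ) = m + 1 - j' := by omega
      rw [this]; ring
  have h5 := LinearMap.congr_fun hc' ⟨_, h4⟩
  rw [PP_apply, BB_del_left] at h5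
  simp only [compl_compl, sub_sub_cancel] at h5
  rcases mul_eq_zero.1 h5 with h6 | h6
  · exact ss_ne _ h6
  · exact h h6

lemma PP_flip_inj (b : ℤ) (j j' : ℕ) (hj : j + j' = m + 1) :
    Function.Injective (PP (k := k) (n := n) (m := m) (d := d) b
      (((m + 1) * d - (n + 1) : ℤ) - b) j j').flip := by
  rw [← LinearMap.ker_eq_bot, LinearMap.ker_eq_bot']
  intro c hc
  apply Subtype.ext
  funext T e
  by_contra h
  obtain ⟨h1, h2, h3⟩ := c.2 T e h
  have h4 : del k Tᶜ (-1 - e) ∈ CC k m d (((m + 1) * d - (n + 1) : ℤ) - b) (SA n (n + 1)) j' := by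
    refine del_mem _ j' _ _ ((refl_mem e).2 h1) ?_ ?_
    · rw [Finset.card_compl, h2, Fintype.card_fin]; omega
    · rw [deg_refl, h3]
      have : (j : ℤ) = m + 1 - j' := by omega
      rw [this]; ring
  have h5 := LinearMap.congr_fun hc ⟨_, h4⟩
  rw [LinearMap.flip_apply, PP_apply, BB_del_right] at h5
  simp only [compl_compl, sub_sub_cancel] at h5
  rcases mul_eq_zero.1 h5 with h6 | h6
  · exact ss_ne _ h6
  · exact h h6

lemma finrank_CC (b : ℤ) (j j' : ℕ) (hj : j + j' = m + 1) :
    Module.finrank k (CC k m d (((m + 1) * d - (n + 1) : ℤ) - b) (SA n (n + 1)) j') =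
    Module.finrank k (CC k m d b (SA n 0) j) := by
  apply le_antisymm
  · rw [← Subspace.dual_finrank_eq (V := CC k m d b (SA n 0) j)]
    exact LinearMap.finrank_le_finrank_of_injective (PP_inj b j j' hj)
  · rw [← Subspace.dual_finrank_eq
      (V := CC k m d (((m + 1) * d - (n + 1) : ℤ) - b) (SA n (n + 1)) j')]
    exact LinearMap.finrank_le_finrank_of_injective (PP_flip_inj b j j' hj)

lemma PP_surj (b : ℤ) (j j' : ℕ) (hj : j + j' = m + 1) :
    Function.Surjective (PP (k := k) (n := n) (m := m) (d := d) b
      (((m + 1) * d - (n + 1) : ℤ) - b) j j') := by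
  refine (LinearMap.injective_iff_surjective_of_finrank_eq_finrank ?_).1 (PP_inj b j j' hj)
  rw [Subspace.dual_finrank_eq, finrank_CC b j j' hj]

lemma finrank_map_DD (hf : ∀ i, (f i).IsHomogeneous d) (b : ℤ) (j j' : ℕ) (hj : j + j' = m) :
    Module.finrank k (Submodule.map (DD f (SA n (n + 1)))
      (CC k m d (((m + 1) * d - (n + 1) : ℤ) - b) (SA n (n + 1)) (j' + 1))) =
    Module.finrank k (Submodule.map (DD f (SA n 0)) (CC k m d b (SA n 0) (j + 1))) := by
  have e : ∀ (A : Set (Fin (n + 1) → ℤ)) (b : ℤ) (j : ℕ),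
      Module.finrank k (LinearMap.range ((DD f A).restrict
        (p := CC k m d b A (j + 1)) (q := CC k m d b A j) (DD_mem hf A b j)))
      = Module.finrank k (Submodule.map (DD f A) (CC k m d b A (j + 1))) := by
    intro A b j
    have h1 : Submodule.map (CC k m d b A j).subtype (LinearMap.range ((DD f A).restrict
        (p := CC k m d b A (j + 1)) (q := CC k m d b A j) (DD_mem hf A b j))) =
        Submodule.map (DD f A) (CC k m d b A (j + 1)) := by
      ext x
      constructor
      · rintro ⟨_, ⟨y, rfl⟩, rfl⟩
        exact ⟨y.1, y.2, rfl⟩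
      · rintro ⟨y, hy, rfl⟩
        exact ⟨_, ⟨⟨y, hy⟩, rfl⟩, rfl⟩
    rw [← h1]
    exact LinearEquiv.finrank_eq (Submodule.equivMapOfInjective _ (Submodule.subtype_injective _) _)
  rw [← e, ← e]
  refine finrank_adjoint _ _ (PP b _ (j + 1) j') (PP b _ j (j' + 1)) (PP_inj b _ _ (by omega))
    (PP_surj b _ _ (by omega)) ?_
  intro w' v
  rw [PP_apply, PP_apply]
  exact (BB_adj (f := f) v.1 w'.1 (CC_supp v.2)).symm

lemma CC_big (A : Set (Fin (n + 1) → ℤ)) (b : ℤ) (j : ℕ) (hj : m + 1 < j) :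
    CC k m d b A j = ⊥ := by
  rw [eq_bot_iff]
  intro c hc
  rw [Submodule.mem_bot]
  funext T e
  by_contra h
  have h1 := (hc T e h).2.1
  have h2 := Finset.card_le_univ T
  rw [Fintype.card_fin] at h2
  omega

lemma finrank_dual (hf : ∀ i, (f i).IsHomogeneous d) (b : ℤ) (j j' : ℕ) (hj : j + j' = m + 1)
    (hj' : 0 < j') :
    Module.finrank k (HH (DD f (SA n (n + 1)))
      (CC k m d (((m + 1) * d - (n + 1) : ℤ) - b) (SA n (n + 1))) j') =
    Module.finrank k (HH (DD f (SA n 0)) (CC k m d b (SA n 0)) j) := by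
  have a1 := finrank_HH (DD f (SA n (n + 1)))
      (CC k m d (((m + 1) * d - (n + 1) : ℤ) - b) (SA n (n + 1))) j'
      (DD_DD (SA_conn n _)) (DD_mem hf _ _ _)
  have a2 := finrank_HH (DD f (SA n 0)) (CC k m d b (SA n 0)) j
      (DD_DD (SA_conn n _)) (DD_mem hf _ _ _)
  have a3 := finrank_CC (k := k) (n := n) (m := m) (d := d) b j j' hj
  obtain ⟨j'', rfl⟩ : ∃ j'', j' = j'' + 1 := ⟨j' - 1, by omega⟩
  have a4 := finrank_map_DD (n := n) hf b j j'' (by omega)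
  have a5 : Module.finrank k (Submodule.map (DD f (SA n (n + 1)))
      (CC k m d (((m + 1) * d - (n + 1) : ℤ) - b) (SA n (n + 1)) (j'' + 1 + 1))) =
    Module.finrank k (Submodule.map (DD f (SA n 0)) (CC k m d b (SA n 0) j)) := by
    rcases Nat.eq_zero_or_pos j with h0 | h0
    · subst h0
      rw [CC_big _ _ (j'' + 1 + 1) (by omega), Submodule.map_bot]
      have : Submodule.map (DD f (SA n 0)) (CC k m d b (SA n 0) 0) = ⊥ := by
        rw [eq_bot_iff]
        rintro _ ⟨c, hc, rfl⟩
        exact DD_zero _ _ c hc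
      rw [this]
    · obtain ⟨i, rfl⟩ : ∃ i, j = i + 1 := ⟨j - 1, by omega⟩
      exact finrank_map_DD (n := n) hf b i (j'' + 1) (by omega)
  omega

lemma finrank_main (hf : ∀ i, (f i).IsHomogeneous d) (hm : n ≤ m)
    (hz : ∀ x : Fin (n + 1) → AlgebraicClosure k,
      (∀ i, aeval x (f i) = 0) → x = 0) (a : ℤ) (i : ℕ) (hi : i ≤ m - n) :
    Module.finrank k (HH (DD f (SA n 0))
      (CC k m d (((m + 1) * d - (n + 1) : ℤ) - a) (SA n 0)) i) =
    Module.finrank k (HH (DD f (SA n 0)) (CC k m d a (SA n 0)) (m - n - i)) := by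
  rw [← finrank_dual hf _ i (m - n - i + (n + 1)) (by omega) (by omega), sub_sub_cancel,
    finrank_chain hf hz (n + 1) le_rfl]

end Duality

end KD

set_option linter.all false

namespace KD

section Compare

variable {k : Type*} [Field k] {n m d : ℕ} {f : Fin (m + 1) → MvPolynomial (Fin (n + 1)) k}

lemma DD_single (A : Set (Fin (n + 1) → ℤ)) (T : Finset (Fin (m + 1)))
    (c : (Fin (n + 1) → ℤ) → k) :
    DD f A (Pi.single T c) = ∑ i ∈ T, sg k i T • Pi.single (T.erase i) (act A (f i) c) := by
  funext T'
  have h0 : (∑ i ∈ T, sg k i T • (Pi.single (T.erase i) (act A (f i) c) :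
      Finset (Fin (m + 1)) → (Fin (n + 1) → ℤ) → k)) T' =
      ∑ i, if i ∈ T then sg k i T • (Pi.single (T.erase i) (act A (f i) c) :
      Finset (Fin (m + 1)) → (Fin (n + 1) → ℤ) → k) T' else 0 := by
    rw [Finset.sum_apply, ← Finset.sum_filter]
    simp
  rw [h0]
  unfold DD
  rw [dd_apply]
  refine Finset.sum_congr rfl fun i _ => ?_
  by_cases hi : i ∈ T'
  · rw [if_pos hi]
    by_cases hT : i ∈ T
    · have : T' ≠ T.erase i := by rintro rfl; simp at hi
      rw [if_pos hT, Pi.single_eq_of_ne this, smul_zero]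
    · rw [if_neg hT]
  · rw [if_neg hi]
    by_cases hT : insert i T' = T
    · subst hT
      rw [if_pos (Finset.mem_insert_self _ _), Finset.erase_insert hi, Pi.single_eq_same,
        Pi.single_eq_same, sg_insert_not_lt _ (lt_irrefl _)]
    · rw [Pi.single_eq_of_ne hT, map_zero, smul_zero]
      split_ifs with h
      · have : T' ≠ T.erase i := by
          rintro rfl
          exact hT (Finset.insert_erase h)
        rw [Pi.single_eq_of_ne this, smul_zero]
      · rfl

lemma sum_orderEmb {M : Type*} [AddCommMonoid M] (T : Finset (Fin (m + 1))) (j : ℕ)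
    (h : T.card = j) (F : Fin (m + 1) → M) :
    ∑ i ∈ T, F i = ∑ t : Fin j, F (T.orderEmbOfFin h t) := by
  conv_lhs => rw [← Finset.map_orderEmbOfFin_univ T h]
  rw [Finset.sum_map]
  rfl

lemma sg_orderEmb (T : Finset (Fin (m + 1))) (j : ℕ)
    (h : T.card = j) (t : Fin j) : sg k (T.orderEmbOfFin h t) T = (-1) ^ (t : ℕ) := by
  unfold sg
  congr 1
  have : T.filter (fun x => x < T.orderEmbOfFin h t) =
      (Finset.Iio t).map (T.orderEmbOfFin h).toEmbedding := by
    ext x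
    simp only [Finset.mem_filter, Finset.mem_map, Finset.mem_Iio]
    constructor
    · rintro ⟨hx, hlt⟩
      have : x ∈ Set.range (T.orderEmbOfFin h) := by
        rw [Finset.range_orderEmbOfFin]; exact hx
      obtain ⟨s, rfl⟩ := this
      exact ⟨s, (T.orderEmbOfFin h).lt_iff_lt.1 hlt, rfl⟩
    · rintro ⟨s, hs, rfl⟩
      exact ⟨Finset.orderEmbOfFin_mem T h s, (T.orderEmbOfFin h).lt_iff_lt.2 hs⟩
  rw [this, Finset.card_map, Fin.card_Iio]

/-- coefficient function of a polynomial -/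
def coef (k : Type*) [Field k] (n : ℕ) :
    MvPolynomial (Fin (n + 1)) k →ₗ[k] ((Fin (n + 1) → ℤ) → k) :=
  (LinearMap.applyₗ (Pi.single 0 1 : (Fin (n + 1) → ℤ) → k)).comp (act (SA n 0))

lemma coef_def (q : MvPolynomial (Fin (n + 1)) k) :
    coef k n q = act (SA n 0) q (Pi.single 0 1) := rfl

lemma act_coef (p q : MvPolynomial (Fin (n + 1)) k) :
    act (SA n 0) p (coef k n q) = coef k n (p * q) := by
  rw [coef_def, coef_def, act_mul (SA_conn n 0)]
  rfl

lemma mem_SA_zero (e : Fin (n + 1) → ℤ) : e ∈ SA n 0 ↔ ∀ i, 0 ≤ e i := by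
  simp [SA]

lemma ex_mem (u : Fin (n + 1) →₀ ℕ) : ex u ∈ SA n 0 :=
  (mem_SA_zero _).2 (ex_nonneg u)

lemma ex_inj {u v : Fin (n + 1) →₀ ℕ} (h : ex u = ex v) : u = v := by
  ext i
  have := congrFun h i
  simpa [ex] using this

lemma exists_ex {e : Fin (n + 1) → ℤ} (h : e ∈ SA n 0) : ∃ u, e = ex u := by
  rw [mem_SA_zero] at h
  refine ⟨Finsupp.equivFunOnFinite.symm fun i => (e i).toNat, ?_⟩
  funext i
  simp [ex, h i]

lemma coef_ex (q : MvPolynomial (Fin (n + 1)) k) (u : Fin (n + 1) →₀ ℕ) :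
    coef k n q (ex u) = coeff u q := by
  rw [coef_def, act_apply]
  rw [Finset.sum_eq_single u]
  · have h0 : (0 : Fin (n + 1) → ℤ) ∈ SA n 0 := (mem_SA_zero _).2 (fun i => le_rfl)
    rw [shiftEnd_apply, sub_self, if_pos ⟨ex_mem u, h0⟩]
    simp
  · intro v _ hv
    rw [shiftEnd_apply]
    have : ex u - ex v ≠ 0 := fun h => hv (ex_inj (sub_eq_zero.1 h)).symm
    rw [Pi.single_eq_of_ne this]
    simp
  · intro hu
    rw [notMem_support_iff.1 hu, zero_mul]

lemma coef_notMem (q : MvPolynomial (Fin (n + 1)) k) {e} (he : e ∉ SA n 0) :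
    coef k n q e = 0 := by
  rw [coef_def, act_apply]
  refine Finset.sum_eq_zero fun u _ => ?_
  rw [shiftEnd_apply, if_neg (fun h => he h.1), mul_zero]

lemma coef_inj {q : MvPolynomial (Fin (n + 1)) k} (h : coef k n q = 0) : q = 0 := by
  ext u
  rw [← coef_ex, h]
  simp

lemma mem_gradedPiece (t : ℤ) (q : MvPolynomial (Fin (n + 1)) k) :
    q ∈ gradedPiece k n t ↔ ∀ e, coef k n q e ≠ 0 → deg e = t := by
  unfold gradedPiece
  split_ifs with ht
  · rw [mem_homogeneousSubmodule]
    constructor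
    · intro h e he
      have h1 : e ∈ SA n 0 := by
        by_contra h2; exact he (coef_notMem q h2)
      obtain ⟨u, rfl⟩ := exists_ex h1
      rw [coef_ex] at he
      have := h he
      rw [deg_ex]
      have h3 : u.degree = t.toNat := by
        rwa [Finsupp.degree_eq_weight_one]
      omega
    · intro h u hu
      rw [← coef_ex] at hu
      have := h _ hu
      rw [deg_ex] at this
      have h3 : u.degree = t.toNat := by omega
      rwa [Finsupp.degree_eq_weight_one] at h3
  · rw [Submodule.mem_bot]
    constructor
    · rintro rfl e he
      simp at he
    · intro h
      ext u
      by_contra hu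
      rw [← coef_ex] at hu
      have := h _ hu
      rw [deg_ex] at this
      omega

lemma coef_surj (t : ℤ) (c : (Fin (n + 1) → ℤ) → k)
    (hc : ∀ e, c e ≠ 0 → e ∈ SA n 0 ∧ deg e = t) :
    ∃ q : gradedPiece k n t, coef k n (q : MvPolynomial (Fin (n + 1)) k) = c := by
  have hfin : (Function.support fun u : Fin (n + 1) →₀ ℕ => c (ex u)).Finite := by
    refine Set.Finite.subset (Finset.univ.finsuppAntidiag t.toNat).finite_toSet ?_
    intro u hu
    have h1 := (hc _ hu).2
    rw [deg_ex, Finsupp.degree_eq_sum] at h1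
    simp only [Finset.mem_coe, Finset.mem_finsuppAntidiag]
    refine ⟨?_, Finset.subset_univ _⟩
    rw [← h1]
    exact (Int.toNat_natCast _).symm
  let q : MvPolynomial (Fin (n + 1)) k := ∑ u ∈ hfin.toFinset, monomial u (c (ex u))
  have hq : coef k n q = c := by
    funext e
    by_cases he : e ∈ SA n 0
    · obtain ⟨u, rfl⟩ := exists_ex he
      rw [coef_ex]
      simp only [q, coeff_sum, coeff_monomial, Finset.sum_ite_eq', Set.Finite.mem_toFinset,
        Function.mem_support]
      split_ifs with h
      · rfl
      · by_contra h'
        exact h ((Set.Finite.mem_toFinset hfin).2 (Ne.symm h'))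
    · rw [coef_notMem _ he]
      by_contra h
      exact he (hc e (Ne.symm h)).1
  refine ⟨⟨q, (mem_gradedPiece t q).2 ?_⟩, hq⟩
  intro e he
  rw [hq] at he
  exact (hc e he).2

/-- the standard basis of the exterior power -/
def EB (k : Type*) [Field k] (m j : ℕ) :
    Module.Basis (Set.powersetCard (Fin (m + 1)) j) k (⋀[k]^j (Fin (m + 1) → k)) :=
  (Pi.basisFun k (Fin (m + 1))).exteriorPower j

/-- the comparison map -/
def Psi (k : Type*) [Field k] (n m d j : ℕ) (b : ℤ) : koszulPiece k n m d j b →ₗ[k]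
    (Finset (Fin (m + 1)) → (Fin (n + 1) → ℤ) → k) :=
  LinearMap.pi fun T => if h : T.card = j then
    (coef k n).comp ((gradedPiece k n (b - (j : ℤ) * d)).subtype.comp
      ((Finsupp.lapply (⟨T, h⟩ : Set.powersetCard (Fin (m + 1)) j)).comp
        (TensorProduct.equivFinsuppOfBasisLeft (EB k m j)).toLinearMap)) else 0

lemma Psi_pos (j : ℕ) (b : ℤ) (x : koszulPiece k n m d j b) (T : Finset (Fin (m + 1))) (h : T.card = j) :
    Psi k n m d j b x T = coef k n
      (TensorProduct.equivFinsuppOfBasisLeft (EB k m j) x ⟨T, h⟩ :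
        gradedPiece k n (b - (j : ℤ) * d)) := by
  unfold Psi
  rw [LinearMap.pi_apply, dif_pos h]
  rfl

lemma Psi_neg (j : ℕ) (b : ℤ) (x : koszulPiece k n m d j b) (T) (h : T.card ≠ j) :
    Psi k n m d j b x T = 0 := by
  unfold Psi
  rw [LinearMap.pi_apply, dif_neg h]
  rfl

lemma Psi_inj (j : ℕ) (b : ℤ) : Function.Injective (Psi k n m d j b) := by
  rw [← LinearMap.ker_eq_bot, LinearMap.ker_eq_bot']
  intro x hx
  rw [← (TensorProduct.equivFinsuppOfBasisLeft (EB k m j)).map_eq_zero_iff]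
  apply Finsupp.ext
  intro s
  apply Subtype.ext
  apply coef_inj
  have := congrFun hx s.1
  rw [Psi_pos _ _ _ _ s.2] at this
  exact this

lemma Psi_range (j : ℕ) (b : ℤ) :
    LinearMap.range (Psi k n m d j b) = CC k m d b (SA n 0) j := by
  apply le_antisymm
  · rintro _ ⟨x, rfl⟩ T e h
    by_cases hT : T.card = j
    · rw [Psi_pos _ _ _ _ hT] at h
      refine ⟨?_, hT, ?_⟩
      · by_contra h2; exact h (coef_notMem _ h2)
      · exact (mem_gradedPiece _ _).1 (Subtype.property _) e h
    · rw [Psi_neg _ _ _ _ hT] at h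
      exact absurd rfl h
  · intro c hc
    have h1 : ∀ s : Set.powersetCard (Fin (m + 1)) j, ∃ q : gradedPiece k n (b - (j : ℤ) * d),
        coef k n (q : MvPolynomial (Fin (n + 1)) k) = c s.1 :=
      fun s => coef_surj _ _ fun e he => ⟨(hc _ e he).1, (hc _ e he).2.2⟩
    choose q hq using h1
    refine ⟨(TensorProduct.equivFinsuppOfBasisLeft (EB k m j)).symm
      (Finsupp.equivFunOnFinite.symm q), ?_⟩
    funext T
    by_cases hT : T.card = j
    · rw [Psi_pos _ _ _ _ hT, LinearEquiv.apply_symm_apply]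
      exact hq ⟨T, hT⟩
    · rw [Psi_neg _ _ _ _ hT]
      funext e
      by_contra h
      exact hT (hc T e (Ne.symm h)).2.1

lemma Psi_basis (j : ℕ) (b : ℤ) (s : Set.powersetCard (Fin (m + 1)) j)
    (q : gradedPiece k n (b - (j : ℤ) * d)) :
    Psi k n m d j b (EB k m j s ⊗ₜ[k] q) =
      Pi.single s.1 (coef k n (q : MvPolynomial (Fin (n + 1)) k)) := by
  funext T
  by_cases hT : T.card = j
  · rw [Psi_pos _ _ _ _ hT, TensorProduct.equivFinsuppOfBasisLeft_apply_tmul_apply,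
      Module.Basis.repr_self]
    by_cases hs : s = ⟨T, hT⟩
    · subst hs
      simp
    · have : T ≠ s.1 := by rintro rfl; exact hs rfl
      rw [Pi.single_eq_of_ne this, Finsupp.single_eq_of_ne (Ne.symm hs)]
      simp
  · have : T ≠ s.1 := by rintro rfl; exact hT s.2
    rw [Psi_neg _ _ _ _ hT, Pi.single_eq_of_ne this]

lemma EB_coe (j : ℕ) (T : Finset (Fin (m + 1))) (h : T.card = j) :
    (EB k m j ⟨T, h⟩ : ExteriorAlgebra k (Fin (m + 1) → k)) =
      ExteriorAlgebra.ιMulti k j (fun t => Pi.single (T.orderEmbOfFin h t) 1) := by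
  unfold EB
  rw [exteriorPower.basis_apply, exteriorPower.ιMulti_family_apply_coe]
  unfold ExteriorAlgebra.ιMulti_family
  congr 1
  funext t
  simp [Set.powersetCard.ofFinEmbEquiv_symm_apply]

lemma orderEmb_erase (j : ℕ) (T : Finset (Fin (m + 1))) (h : T.card = j + 1) (t : Fin (j + 1))
    (h' : (T.erase (T.orderEmbOfFin h t)).card = j) :
    (T.erase (T.orderEmbOfFin h t)).orderEmbOfFin h' = T.orderEmbOfFin h ∘ t.succAbove := by
  refine (Finset.orderEmbOfFin_unique h' ?_ ?_).symm
  · intro x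
    simp only [Function.comp_apply, Finset.mem_erase, Finset.orderEmbOfFin_mem, and_true]
    intro hx
    exact Fin.succAbove_ne t x ((T.orderEmbOfFin h).injective hx)
  · exact (T.orderEmbOfFin h).strictMono.comp (Fin.strictMono_succAbove t)

lemma mul_mem_graded (hf : ∀ i, (f i).IsHomogeneous d) (j : ℕ) (b : ℤ) (i : Fin (m + 1))
    (q : gradedPiece k n (b - ((j : ℤ) + 1) * d)) :
    f i * (q : MvPolynomial (Fin (n + 1)) k) ∈ gradedPiece k n (b - (j : ℤ) * d) := by
  rw [mem_gradedPiece]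
  intro e he
  rw [← act_coef] at he
  obtain ⟨u, hu, h1, h2, h3⟩ := act_ne_zero he
  have h4 := (mem_gradedPiece _ _).1 q.2 _ h3
  have h5 := hf i hu
  have h6 : u.degree = d := by
    rwa [Finsupp.degree_eq_weight_one]
  have h7 : deg (e - ex u) = deg e - u.degree := by
    rw [← deg_ex]; simp [deg, Finset.sum_sub_distrib]
  rw [h7, h6] at h4
  linarith

/-- the defining property of the Koszul differential -/
def IsKoszul (f : Fin (m + 1) → MvPolynomial (Fin (n + 1)) k)
    (δ : ∀ (j : ℕ) (b : ℤ), koszulPiece k n m d (j + 1) b →ₗ[k] koszulPiece k n m d j b) : Prop :=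
  ∀ (j : ℕ) (b : ℤ) (g : Fin (j + 1) → (Fin (m + 1) → k))
        (w : ↥(⋀[k]^(j + 1) (Fin (m + 1) → k))),
        ((w : ExteriorAlgebra k (Fin (m + 1) → k)) = ExteriorAlgebra.ιMulti k (j + 1) g) →
        ∀ (q : ↥(gradedPiece k n (b - ((j : ℤ) + 1) * d)))
          (w' : Fin (j + 1) → ↥(⋀[k]^j (Fin (m + 1) → k))),
          (∀ t, (w' t : ExteriorAlgebra k (Fin (m + 1) → k)) =
            ExteriorAlgebra.ιMulti k j (g ∘ t.succAbove)) →
        ∀ (gq : Fin (j + 1) → ↥(gradedPiece k n (b - (j : ℤ) * d))),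
          (∀ t, (gq t : MvPolynomial (Fin (n + 1)) k) =
            (∑ i : Fin (m + 1), g t i • f i) * (q : MvPolynomial (Fin (n + 1)) k)) →
          δ j b (w ⊗ₜ[k] q) = ∑ t : Fin (j + 1), (-1 : k) ^ (t : ℕ) • (w' t ⊗ₜ[k] gq t)

lemma Psi_delta (hf : ∀ i, (f i).IsHomogeneous d)
    {δ : ∀ (j : ℕ) (b : ℤ), koszulPiece k n m d (j + 1) b →ₗ[k] koszulPiece k n m d j b}
    (hδ : IsKoszul f δ) (j : ℕ) (b : ℤ) (x : koszulPiece k n m d (j + 1) b) :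
    Psi k n m d j b (δ j b x) = DD f (SA n 0) (Psi k n m d (j + 1) b x) := by
  have key : (Psi k n m d j b).comp (δ j b) =
      (DD f (SA n 0)).comp (Psi k n m d (j + 1) b) := by
    apply TensorProduct.ext
    apply (EB k m (j + 1)).ext
    rintro ⟨T, hT⟩
    change T.card = j + 1 at hT
    apply LinearMap.ext
    intro q
    change Psi k n m d j b (δ j b (EB k m (j + 1) ⟨T, hT⟩ ⊗ₜ[k] q)) =
      DD f (SA n 0) (Psi k n m d (j + 1) b (EB k m (j + 1) ⟨T, hT⟩ ⊗ₜ[k] q))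
    have hc : ∀ t : Fin (j + 1), (T.erase (T.orderEmbOfFin hT t)).card = j := by
      intro t
      rw [Finset.card_erase_of_mem (Finset.orderEmbOfFin_mem _ _ _)]
      omega
    rw [hδ j b (fun t => Pi.single (T.orderEmbOfFin hT t) 1) (EB k m (j + 1) ⟨T, hT⟩)
      (EB_coe (j + 1) T hT) q
      (fun t => EB k m j ⟨T.erase (T.orderEmbOfFin hT t), hc t⟩) ?_
      (fun t => ⟨f (T.orderEmbOfFin hT t) * (q : MvPolynomial (Fin (n + 1)) k),
        mul_mem_graded hf j b _ q⟩) ?_]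
    · rw [Psi_basis, DD_single, sum_orderEmb T (j + 1) hT, map_sum]
      refine Finset.sum_congr rfl fun t _ => ?_
      rw [map_smul, Psi_basis, sg_orderEmb, act_coef]
    · intro t
      rw [EB_coe]
      congr 1
      funext x
      have := congrFun (orderEmb_erase j T hT t (hc t)) x
      simp only [Function.comp_apply] at this ⊢
      rw [← this]
    · intro t
      congr 1
      rw [Finset.sum_eq_single (T.orderEmbOfFin hT t)]
      · simp
      · intro i _ hi
        simp [hi]
      · simp
  exact LinearMap.congr_fun key x

lemma map_cycles (hf : ∀ i, (f i).IsHomogeneous d)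
    {δ : ∀ (j : ℕ) (b : ℤ), koszulPiece k n m d (j + 1) b →ₗ[k] koszulPiece k n m d j b}
    (hδ : IsKoszul f δ) (i : ℕ) (b : ℤ) :
    (koszulCycles k n m d δ i b).map (Psi k n m d i b) =
      LinearMap.ker (DD f (SA n 0)) ⊓ CC k m d b (SA n 0) i := by
  rcases i with _ | i
  · change Submodule.map _ ⊤ = _
    rw [Submodule.map_top, Psi_range]
    symm
    rw [inf_eq_right]
    intro c hc
    exact DD_zero _ _ c hc
  · change Submodule.map _ (LinearMap.ker (δ i b)) = _
    apply le_antisymm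
    · rintro _ ⟨x, hx, rfl⟩
      refine ⟨?_, ?_⟩
      · change DD f (SA n 0) _ = 0
        rw [← Psi_delta hf hδ]
        have : δ i b x = 0 := hx
        rw [this, map_zero]
      · rw [← Psi_range]; exact ⟨x, rfl⟩
    · rintro c ⟨h1, h2⟩
      rw [← Psi_range] at h2
      obtain ⟨x, rfl⟩ := h2
      refine ⟨x, ?_, rfl⟩
      change δ i b x = 0
      apply Psi_inj
      rw [Psi_delta hf hδ, map_zero]
      exact h1

lemma nonempty_equiv (hf : ∀ i, (f i).IsHomogeneous d)
    {δ : ∀ (j : ℕ) (b : ℤ), koszulPiece k n m d (j + 1) b →ₗ[k] koszulPiece k n m d j b}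
    (hδ : IsKoszul f δ) (i : ℕ) (b : ℤ) :
    Nonempty (koszulHomology k n m d δ i b ≃ₗ[k]
      HH (DD f (SA n 0)) (CC k m d b (SA n 0)) i) := by
  let e : koszulCycles k n m d δ i b ≃ₗ[k]
      (LinearMap.ker (DD f (SA n 0)) ⊓ CC k m d b (SA n 0) i : Submodule k _) :=
    (Submodule.equivMapOfInjective (Psi k n m d i b) (Psi_inj i b) _).trans
      (LinearEquiv.ofEq _ _ (map_cycles hf hδ i b))
  have he : ∀ x, ((e x : _) : Finset (Fin (m + 1)) → (Fin (n + 1) → ℤ) → k) =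
    Psi k n m d i b x := fun x => rfl
  refine ⟨Submodule.Quotient.equiv _ _ e ?_⟩
  ext y
  constructor
  · rintro ⟨x, ⟨z, hz⟩, rfl⟩
    change ((e x : _) : Finset (Fin (m + 1)) → (Fin (n + 1) → ℤ) → k) ∈ Submodule.map _ _
    rw [he]
    refine ⟨Psi k n m d (i + 1) b z, ?_, ?_⟩
    · rw [SetLike.mem_coe, ← Psi_range]; exact ⟨z, rfl⟩
    · rw [← Psi_delta hf hδ, hz]; rfl
  · rintro ⟨c, hc, hcy⟩
    rw [SetLike.mem_coe, ← Psi_range] at hc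
    obtain ⟨z, rfl⟩ := hc
    refine ⟨e.symm y, ?_, e.apply_symm_apply y⟩
    refine ⟨z, ?_⟩
    apply Psi_inj
    rw [Psi_delta hf hδ, hcy]
    change (y : Finset (Fin (m + 1)) → (Fin (n + 1) → ℤ) → k) = Psi k n m d i b (e.symm y)
    rw [← he, e.apply_symm_apply]

lemma finite_HH (i : ℕ) (b : ℤ) :
    FiniteDimensional k (HH (DD f (SA n 0)) (CC k m d b (SA n 0)) i) := by
  have : FiniteDimensional k
      (LinearMap.ker (DD f (SA n 0)) ⊓ CC k m d b (SA n 0) i : Submodule k _) :=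
    Submodule.finiteDimensional_of_le (S₂ := CC k m d b (SA n 0) i) inf_le_right
  infer_instance

end Compare

end KD

/-- (Koszul duality.)  Let `m ≥ n` and let `f_0,…,f_m ∈ S_d` be
linearly independent forms with no common projective zero, `K_•` their Koszul complex
(with its internal grading) and `σ = (m+1)d − (n+1)`.  Then for every integer `a` and
every `0 ≤ i ≤ m−n` there is a `k`-linear isomorphism
`(H_i(K_•)_{σ−a})^* ≅ H_{m−n−i}(K_•)_a`; in particular the graded pieces have equal
dimensions. -/
theorem koszul_duality
    (k : Type*) [Field k] (n m d : ℕ) (hd : 1 ≤ d) (hm : n ≤ m)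
    (f : Fin (m + 1) → MvPolynomial (Fin (n + 1)) k)
    (hf : ∀ i, (f i).IsHomogeneous d)
    (hindep : LinearIndependent k f)
    (hz : ∀ x : Fin (n + 1) → AlgebraicClosure k,
      (∀ i, aeval x (f i) = 0) → x = 0)
    (δ : ∀ (j : ℕ) (b : ℤ), koszulPiece k n m d (j + 1) b →ₗ[k] koszulPiece k n m d j b)
    (hδ : ∀ (j : ℕ) (b : ℤ) (g : Fin (j + 1) → (Fin (m + 1) → k))
        (w : ↥(⋀[k]^(j + 1) (Fin (m + 1) → k))),
        ((w : ExteriorAlgebra k (Fin (m + 1) → k)) = ExteriorAlgebra.ιMulti k (j + 1) g) →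
        ∀ (q : ↥(gradedPiece k n (b - ((j : ℤ) + 1) * d)))
          (w' : Fin (j + 1) → ↥(⋀[k]^j (Fin (m + 1) → k))),
          (∀ t, (w' t : ExteriorAlgebra k (Fin (m + 1) → k)) =
            ExteriorAlgebra.ιMulti k j (g ∘ t.succAbove)) →
        ∀ (gq : Fin (j + 1) → ↥(gradedPiece k n (b - (j : ℤ) * d))),
          (∀ t, (gq t : MvPolynomial (Fin (n + 1)) k) =
            (∑ i : Fin (m + 1), g t i • f i) * (q : MvPolynomial (Fin (n + 1)) k)) →
          δ j b (w ⊗ₜ[k] q) = ∑ t : Fin (j + 1), (-1 : k) ^ (t : ℕ) • (w' t ⊗ₜ[k] gq t)) :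
    ∀ (a : ℤ) (i : ℕ), i ≤ m - n →
      Nonempty
        ((Module.Dual k (koszulHomology k n m d δ i (((m + 1) * d - (n + 1) : ℤ) - a)))
          ≃ₗ[k] koszulHomology k n m d δ (m - n - i) a) ∧
      Module.finrank k
          (koszulHomology k n m d δ i (((m + 1) * d - (n + 1) : ℤ) - a)) =
        Module.finrank k (koszulHomology k n m d δ (m - n - i) a) := by
  intro a i hi
  have hK : KD.IsKoszul f δ := hδ
  obtain ⟨e1⟩ := KD.nonempty_equiv hf hK i (((m + 1) * d - (n + 1) : ℤ) - a)
  obtain ⟨e2⟩ := KD.nonempty_equiv hf hK (m - n - i) a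
  have h := KD.finrank_main hf hm hz a i hi
  rw [← e1.finrank_eq, ← e2.finrank_eq] at h
  have f1 := KD.finite_HH (k := k) (d := d) (f := f) i (((m + 1) * d - (n + 1) : ℤ) - a)
  have f2 := KD.finite_HH (k := k) (d := d) (f := f) (m - n - i) a
  have g1 := Module.Finite.equiv e1.symm
  have g2 := Module.Finite.equiv e2.symm
  refine ⟨?_, h⟩
  apply FiniteDimensional.nonempty_linearEquiv_of_finrank_eq
  rw [Subspace.dual_finrank_eq]
  exact h
end
end
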